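/- arXiv:1911.03253 — 6 statements merged into one kernel-verified Lean document; each statement's English description precedes it below -/
import Mathlib

section
/- Let φ : ℝ → ℂ be a smooth function supported in {ξ : 1/2 ≤ |ξ| ≤ 2}. Then there exists a constant C > 0 (depending only on φ) such that for all t, x ∈ ℝ, |∫_ℝ e^{i(tξ⁴ + xξ)} φ(ξ) dξ| ≤ C (1 + t²)^{-1/4}. -/
open MeasureTheory Complex

/-- The primitive `arctan (g / s) / s` of `g' / (g² + s²)` for `g ξ = 4 t ξ³ + x`. -/
theorem hasDerivAt_arctan_cubic_div (t x ξ : ℝ) {s : ℝ} (hs : 0 < s) :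
    HasDerivAt (fun ξ : ℝ => Real.arctan ((4 * t * ξ ^ 3 + x) / s) / s)
      (12 * t * ξ ^ 2 / ((4 * t * ξ ^ 3 + x) ^ 2 + s ^ 2)) ξ := by
  have hg : HasDerivAt (fun ξ : ℝ => 4 * t * ξ ^ 3 + x) (4 * t * (3 * ξ ^ 2)) ξ := by
    simpa using ((hasDerivAt_pow 3 ξ).const_mul (4 * t)).add_const x
  refine ((hg.div_const s).arctan.div_const s).congr_deriv ?_
  have : (4 * t * ξ ^ 3 + x) ^ 2 + s ^ 2 ≠ 0 := by positivity
  have : 1 + ((4 * t * ξ ^ 3 + x) / s) ^ 2 ≠ 0 := by positivity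
  field_simp
  ring

/-- The change of variables bound `∫ |g'| / (g² + s²) ≤ π / s` for `g ξ = 4 t ξ³ + x`. -/
theorem integral_abs_deriv_cubic_div_le (t x a b : ℝ) {s : ℝ} (hs : 0 < s) :
    ∫ ξ in a..b, 12 * |t| * ξ ^ 2 / ((4 * t * ξ ^ 3 + x) ^ 2 + s ^ 2) ≤ Real.pi / s := by
  have hcont : Continuous fun ξ : ℝ =>
      12 * t * ξ ^ 2 / ((4 * t * ξ ^ 3 + x) ^ 2 + s ^ 2) :=
    Continuous.div (by fun_prop) (by fun_prop) fun ξ => by positivity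
  have hint := intervalIntegral.integral_eq_sub_of_hasDerivAt (a := a) (b := b)
    (fun ξ _ => hasDerivAt_arctan_cubic_div t x ξ hs) (hcont.intervalIntegrable a b)
  have ha := Real.arctan_lt_pi_div_two ((4 * t * a ^ 3 + x) / s)
  have ha' := Real.neg_pi_div_two_lt_arctan ((4 * t * a ^ 3 + x) / s)
  have hb := Real.arctan_lt_pi_div_two ((4 * t * b ^ 3 + x) / s)
  have hb' := Real.neg_pi_div_two_lt_arctan ((4 * t * b ^ 3 + x) / s)
  rcases abs_choice t with h | h
  · rw [h, hint, ← sub_div]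
    gcongr
    linarith
  · have hneg : ∀ ξ : ℝ, 12 * |t| * ξ ^ 2 / ((4 * t * ξ ^ 3 + x) ^ 2 + s ^ 2) =
        -(12 * t * ξ ^ 2 / ((4 * t * ξ ^ 3 + x) ^ 2 + s ^ 2)) := fun ξ => by rw [h]; ring
    simp_rw [hneg]
    rw [intervalIntegral.integral_neg, hint, ← sub_div, ← neg_div]
    gcongr
    linarith

/-- The derivative of the regularised reciprocal `g / (g² + s²)` of `g ξ = 4 t ξ³ + x`. -/
theorem hasDerivAt_cubic_div (t x ξ : ℝ) {s : ℝ} (hs : 0 < s) :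
    HasDerivAt (fun ξ : ℝ => (4 * t * ξ ^ 3 + x) / ((4 * t * ξ ^ 3 + x) ^ 2 + s ^ 2))
      (12 * t * ξ ^ 2 * (s ^ 2 - (4 * t * ξ ^ 3 + x) ^ 2) /
        ((4 * t * ξ ^ 3 + x) ^ 2 + s ^ 2) ^ 2) ξ := by
  have hg : HasDerivAt (fun ξ : ℝ => 4 * t * ξ ^ 3 + x) (4 * t * (3 * ξ ^ 2)) ξ := by
    simpa using ((hasDerivAt_pow 3 ξ).const_mul (4 * t)).add_const x
  have hq : (4 * t * ξ ^ 3 + x) ^ 2 + s ^ 2 ≠ 0 := by positivity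
  refine (hg.fun_div ((hg.fun_pow 2).add_const (s ^ 2)) hq).congr_deriv ?_
  congr 1
  push_cast
  ring

theorem hasDerivAt_exp_quartic (t x ξ : ℝ) :
    HasDerivAt (fun ξ : ℝ => Complex.exp (Complex.I * (t * ξ ^ 4 + x * ξ)))
      (Complex.exp (Complex.I * (t * ξ ^ 4 + x * ξ)) *
        (Complex.I * ((4 * t * ξ ^ 3 + x : ℝ) : ℂ))) ξ := by
  have h1 : HasDerivAt (fun ξ : ℝ => t * ξ ^ 4 + x * ξ) (4 * t * ξ ^ 3 + x) ξ := by
    refine (((hasDerivAt_pow 4 ξ).const_mul t).fun_add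
      ((hasDerivAt_id' ξ).const_mul x)).congr_deriv ?_
    push_cast
    ring
  convert (h1.ofReal_comp.const_mul Complex.I).cexp using 2 <;> push_cast <;> rfl

theorem norm_exp_quartic (t x ξ : ℝ) :
    ‖Complex.exp (Complex.I * (t * ξ ^ 4 + x * ξ))‖ = 1 := by
  have := Complex.norm_exp_I_mul_ofReal (t * ξ ^ 4 + x * ξ)
  push_cast at this
  exact this

/-- The pointwise bound left after integrating by parts against `g / (g² + s²)`. -/
theorem norm_remainder_le {E u v : ℂ} {g d s M N A : ℝ} (hE : ‖E‖ = 1) (hs : 1 ≤ s)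
    (hu : ‖u‖ ≤ M) (hv : ‖v‖ ≤ N) (hd : |d| = 3 * A) (hsu : s ^ 2 * ‖u‖ ≤ M * (1 + A)) :
    ‖E * u - -Complex.I * (((d * (s ^ 2 - g ^ 2) / (g ^ 2 + s ^ 2) ^ 2 : ℝ) : ℂ) * (E * u) +
        ((g / (g ^ 2 + s ^ 2) : ℝ) : ℂ) * (E * (Complex.I * (g : ℂ)) * u + E * v))‖ ≤
      (M + N) / s + 2 * M * (3 * A / (g ^ 2 + s ^ 2)) := by
  have hs0 : 0 < s := by linarith
  have hM : 0 ≤ M := (norm_nonneg _).trans hu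
  have hN : 0 ≤ N := (norm_nonneg _).trans hv
  have hA : 0 ≤ A := by linarith [abs_nonneg d]
  have hq : 0 < g ^ 2 + s ^ 2 := by positivity
  set k : ℝ := g / (g ^ 2 + s ^ 2) with hk
  set k' : ℝ := d * (s ^ 2 - g ^ 2) / (g ^ 2 + s ^ 2) ^ 2 with hk'
  have hkey : E * u - -Complex.I * ((k' : ℂ) * (E * u) +
      (k : ℂ) * (E * (Complex.I * (g : ℂ)) * u + E * v)) =
      E * (((1 - k * g : ℝ) : ℂ) * u + Complex.I * ((k' : ℂ) * u) + Complex.I * ((k : ℂ) * v)) := by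
    push_cast
    linear_combination (E * u * k * g) * Complex.I_sq
  have h1 : ‖((1 - k * g : ℝ) : ℂ) * u‖ ≤ M / s + M * (A / (g ^ 2 + s ^ 2)) := by
    have e : 1 - k * g = s ^ 2 / (g ^ 2 + s ^ 2) := by rw [hk]; field_simp; ring
    rw [norm_mul, Complex.norm_real, e, Real.norm_of_nonneg (by positivity)]
    calc s ^ 2 / (g ^ 2 + s ^ 2) * ‖u‖ = s ^ 2 * ‖u‖ / (g ^ 2 + s ^ 2) := by ring
      _ ≤ M * (1 + A) / (g ^ 2 + s ^ 2) := by gcongr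
      _ = M / (g ^ 2 + s ^ 2) + M * (A / (g ^ 2 + s ^ 2)) := by ring
      _ ≤ M / s + M * (A / (g ^ 2 + s ^ 2)) := by
        gcongr
        nlinarith [sq_nonneg g]
  have h2 : ‖Complex.I * ((k' : ℂ) * u)‖ ≤ M * (3 * A / (g ^ 2 + s ^ 2)) := by
    have hle : |k'| ≤ 3 * A / (g ^ 2 + s ^ 2) := by
      have hsub : |s ^ 2 - g ^ 2| ≤ g ^ 2 + s ^ 2 :=
        abs_le.2 ⟨by nlinarith [sq_nonneg s], by nlinarith [sq_nonneg g]⟩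
      rw [hk', abs_div, abs_mul, hd, abs_of_pos (pow_pos hq 2)]
      calc 3 * A * |s ^ 2 - g ^ 2| / (g ^ 2 + s ^ 2) ^ 2
          ≤ 3 * A * (g ^ 2 + s ^ 2) / (g ^ 2 + s ^ 2) ^ 2 := by gcongr
        _ = 3 * A / (g ^ 2 + s ^ 2) := by field_simp
    rw [norm_mul, Complex.norm_I, one_mul, norm_mul, Complex.norm_real, Real.norm_eq_abs,
      mul_comm M]
    gcongr
  have h3 : ‖Complex.I * ((k : ℂ) * v)‖ ≤ N / s := by
    have hle : |k| ≤ 1 / s := by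
      rw [hk, abs_div, abs_of_pos hq, div_le_div_iff₀ hq hs0]
      nlinarith [sq_nonneg (|g| - s), sq_abs g, abs_nonneg g]
    rw [norm_mul, Complex.norm_I, one_mul, norm_mul, Complex.norm_real, Real.norm_eq_abs]
    calc |k| * ‖v‖ ≤ 1 / s * N := by gcongr
      _ = N / s := by ring
  have h4 : M * (A / (g ^ 2 + s ^ 2)) ≤ M * (3 * A / (g ^ 2 + s ^ 2)) := by
    gcongr
    linarith
  rw [hkey, norm_mul, hE, one_mul]
  refine (norm_add₃_le).trans ?_
  rw [add_div]
  linarith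

/-- Oscillatory integral decay: for a smooth cutoff `φ` supported in `{1/2 ≤ |ξ| ≤ 2}`,
`|∫ e^{i(tξ⁴+xξ)} φ(ξ) dξ| ≤ C ⟨t⟩^{-1/2}` with `⟨t⟩ = (1+t²)^{1/2}`. -/
theorem stmt_0 (φ : ℝ → ℂ) (hφ : ContDiff ℝ (⊤ : ℕ∞) φ)
    (hsupp : Function.support φ ⊆ {ξ : ℝ | 1/2 ≤ |ξ| ∧ |ξ| ≤ 2}) :
    ∃ C > (0:ℝ), ∀ t x : ℝ,
      ‖∫ ξ : ℝ, Complex.exp (Complex.I * (t * ξ^4 + x * ξ)) * φ ξ‖ ≤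
        C * (1 + t^2) ^ (-(1/4) : ℝ) := by
  have hφ' : Continuous (deriv φ) := hφ.continuous_deriv (by simp)
  have hdiff : Differentiable ℝ φ := hφ.differentiable (by simp)
  obtain ⟨M, hM⟩ := (isCompact_Icc (a := (-3 : ℝ)) (b := 3)).exists_bound_of_continuousOn
    hφ.continuous.continuousOn
  obtain ⟨N, hN⟩ := (isCompact_Icc (a := (-3 : ℝ)) (b := 3)).exists_bound_of_continuousOn
    hφ'.continuousOn
  have hM0 : 0 ≤ M := (norm_nonneg _).trans (hM 0 (by norm_num))
  have hN0 : 0 ≤ N := (norm_nonneg _).trans (hN 0 (by norm_num))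
  have hzero : ∀ ξ : ℝ, 2 < |ξ| → φ ξ = 0 := fun ξ h => by
    by_contra hne
    exact absurd (hsupp hne).2 (not_le.2 h)
  refine ⟨6 * (M + N) + 2 * M * Real.pi + 1, by positivity, fun t x => ?_⟩
  set s : ℝ := (1 + t ^ 2) ^ (1 / 4 : ℝ) with hsdef
  have hs : 1 ≤ s := Real.one_le_rpow (by nlinarith [sq_nonneg t]) (by norm_num)
  have hs0 : 0 < s := by linarith
  have hs4 : s ^ 4 = 1 + t ^ 2 := by
    rw [hsdef, ← Real.rpow_natCast, ← Real.rpow_mul (by positivity)]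
    norm_num
  have hs2 : s ^ 2 ≤ 1 + |t| := by
    refine (abs_le_of_sq_le_sq' ?_ (by positivity)).2
    nlinarith [sq_abs t, abs_nonneg t]
  rw [Real.rpow_neg (by positivity), ← hsdef]
  set E : ℝ → ℂ := fun ξ => Complex.exp (Complex.I * (t * ξ ^ 4 + x * ξ)) with hE
  have hint : ∫ ξ : ℝ, E ξ * φ ξ = ∫ ξ in (-3 : ℝ)..3, E ξ * φ ξ := by
    refine (intervalIntegral.integral_eq_integral_of_support_subset fun ξ h => ?_).symm
    have := abs_le.1 (hsupp (right_ne_zero_of_mul h)).2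
    exact ⟨by linarith, by linarith⟩
  have hder : ∀ ξ : ℝ, HasDerivAt
      (fun ξ : ℝ => -Complex.I *
        ((((4 * t * ξ ^ 3 + x) / ((4 * t * ξ ^ 3 + x) ^ 2 + s ^ 2) : ℝ) : ℂ) * (E ξ * φ ξ)))
      (-Complex.I * (((12 * t * ξ ^ 2 * (s ^ 2 - (4 * t * ξ ^ 3 + x) ^ 2) /
        ((4 * t * ξ ^ 3 + x) ^ 2 + s ^ 2) ^ 2 : ℝ) : ℂ) * (E ξ * φ ξ) +
        (((4 * t * ξ ^ 3 + x) / ((4 * t * ξ ^ 3 + x) ^ 2 + s ^ 2) : ℝ) : ℂ) *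
          (E ξ * (Complex.I * ((4 * t * ξ ^ 3 + x : ℝ) : ℂ)) * φ ξ + E ξ * deriv φ ξ))) ξ :=
    fun ξ => ((hasDerivAt_cubic_div t x ξ hs0).ofReal_comp.mul
      ((hasDerivAt_exp_quartic t x ξ).mul (hdiff ξ).hasDerivAt)).const_mul _
  have hEc : Continuous E := by fun_prop
  have hφc : Continuous φ := hφ.continuous
  have hkc : Continuous fun ξ : ℝ =>
      (4 * t * ξ ^ 3 + x) / ((4 * t * ξ ^ 3 + x) ^ 2 + s ^ 2) :=
    Continuous.div (by fun_prop) (by fun_prop) fun ξ => by positivity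
  have hkc' : Continuous fun ξ : ℝ => 12 * t * ξ ^ 2 * (s ^ 2 - (4 * t * ξ ^ 3 + x) ^ 2) /
      ((4 * t * ξ ^ 3 + x) ^ 2 + s ^ 2) ^ 2 :=
    Continuous.div (by fun_prop) (by fun_prop) fun ξ => by positivity
  have hbc : Continuous fun ξ : ℝ =>
      12 * |t| * ξ ^ 2 / ((4 * t * ξ ^ 3 + x) ^ 2 + s ^ 2) :=
    Continuous.div (by fun_prop) (by fun_prop) fun ξ => by positivity
  have hDc : Continuous fun ξ : ℝ =>
      -Complex.I * (((12 * t * ξ ^ 2 * (s ^ 2 - (4 * t * ξ ^ 3 + x) ^ 2) /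
        ((4 * t * ξ ^ 3 + x) ^ 2 + s ^ 2) ^ 2 : ℝ) : ℂ) * (E ξ * φ ξ) +
        (((4 * t * ξ ^ 3 + x) / ((4 * t * ξ ^ 3 + x) ^ 2 + s ^ 2) : ℝ) : ℂ) *
          (E ξ * (Complex.I * ((4 * t * ξ ^ 3 + x : ℝ) : ℂ)) * φ ξ + E ξ * deriv φ ξ)) :=
    continuous_const.mul (((Complex.continuous_ofReal.comp hkc').mul (hEc.mul hφc)).add
      ((Complex.continuous_ofReal.comp hkc).mul (by fun_prop)))
  have hD := intervalIntegral.integral_eq_sub_of_hasDerivAt (a := (-3 : ℝ)) (b := 3)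
    (fun ξ _ => hder ξ) (hDc.intervalIntegrable _ _)
  rw [hzero 3 (by norm_num), hzero (-3) (by norm_num)] at hD
  simp only [mul_zero, sub_zero] at hD
  change ‖∫ ξ : ℝ, E ξ * φ ξ‖ ≤ _
  rw [hint, ← sub_zero (∫ ξ in (-3 : ℝ)..3, E ξ * φ ξ), ← hD,
    ← intervalIntegral.integral_sub ((hEc.fun_mul hφc).intervalIntegrable _ _)
      (hDc.intervalIntegrable _ _)]
  have hbound : ∀ ξ ∈ Set.Ioc (-3 : ℝ) 3, _ := fun ξ hξ =>
    norm_remainder_le (E := E ξ) (u := φ ξ) (v := deriv φ ξ) (g := 4 * t * ξ ^ 3 + x)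
      (d := 12 * t * ξ ^ 2) (s := s) (M := M) (N := N) (A := 4 * |t| * ξ ^ 2)
      (norm_exp_quartic t x ξ) hs (hM ξ ⟨hξ.1.le, hξ.2⟩) (hN ξ ⟨hξ.1.le, hξ.2⟩)
      (by rw [abs_mul, abs_mul, abs_of_pos (by norm_num : (0 : ℝ) < 12),
            abs_of_nonneg (sq_nonneg ξ)]; ring)
      (by
        by_cases h0 : φ ξ = 0
        · rw [h0, norm_zero, mul_zero]
          positivity
        · have h4 : 1 ≤ 4 * ξ ^ 2 := by
            have := (hsupp h0).1
            nlinarith [sq_abs ξ]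
          have h5 : s ^ 2 ≤ 1 + 4 * |t| * ξ ^ 2 := by
            nlinarith [mul_le_mul_of_nonneg_left h4 (abs_nonneg t)]
          rw [mul_comm]
          exact mul_le_mul (hM ξ ⟨hξ.1.le, hξ.2⟩) h5 (by positivity) hM0)
  refine (intervalIntegral.norm_integral_le_of_norm_le (by norm_num)
    (Filter.Eventually.of_forall hbound)
    (Continuous.intervalIntegrable ?_ _ _)).trans ?_
  · refine continuous_const.add (continuous_const.mul ?_)
    convert hbc using 3
    ring
  · have hI := integral_abs_deriv_cubic_div_le t x (-3) 3 hs0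
    have he : ∀ ξ : ℝ, 3 * (4 * |t| * ξ ^ 2) = 12 * |t| * ξ ^ 2 := fun ξ => by ring
    simp_rw [he]
    rw [intervalIntegral.integral_add (by simp)
      ((hbc.const_mul _).intervalIntegrable _ _), intervalIntegral.integral_const,
      intervalIntegral.integral_const_mul, smul_eq_mul]
    calc (3 - -3) * ((M + N) / s) + 2 * M * _
        ≤ (3 - -3) * ((M + N) / s) + 2 * M * (Real.pi / s) := by gcongr
      _ = (6 * (M + N) + 2 * M * Real.pi) * s⁻¹ := by ring
      _ ≤ (6 * (M + N) + 2 * M * Real.pi + 1) * s⁻¹ := by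
        exact mul_le_mul_of_nonneg_right (le_add_of_nonneg_right zero_le_one) (by positivity)
end

section
/- Let φ : ℝ → ℂ be a smooth function supported in {ξ : 1/2 ≤ |ξ| ≤ 2}. Then there exist constants A ≥ 1 and C > 0 (depending only on φ) such that for all t, x ∈ ℝ with (t,x) ≠ (0,0) and with either |x| ≥ A|t| or |t| ≥ A|x|, one has |∫_ℝ e^{i(tξ⁴ + xξ)} φ(ξ) dξ| ≤ C / max(x², t²). -/
open MeasureTheory Complex

/-- The phase derivative `4tξ³ + x` is bounded below on the annulus when one of `|x|`, `|t|` dominates. -/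
theorem max_abs_le_four_mul_abs_phase_deriv {t x ξ : ℝ}
    (h : |x| ≥ 64 * |t| ∨ |t| ≥ 64 * |x|) (h1 : 1 / 2 ≤ |ξ|) (h2 : |ξ| ≤ 2) :
    max |x| |t| ≤ 4 * |4 * t * ξ ^ 3 + x| := by
  have hl : (1 / 2 : ℝ) ^ 3 ≤ |ξ| ^ 3 := by gcongr
  have hu : |ξ| ^ 3 ≤ 2 ^ 3 := by gcongr
  have ht := abs_nonneg t
  have hx := abs_nonneg x
  have e : |4 * t * ξ ^ 3| = 4 * |t| * |ξ| ^ 3 := by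
    rw [abs_mul, abs_mul, abs_pow, abs_of_pos (by norm_num : (0 : ℝ) < 4)]
  have a1 : |4 * t * ξ ^ 3| - |x| ≤ |4 * t * ξ ^ 3 + x| := by
    have := abs_sub_abs_le_abs_sub (4 * t * ξ ^ 3) (-x)
    rwa [abs_neg, sub_neg_eq_add] at this
  have a2 : |x| - |4 * t * ξ ^ 3| ≤ |4 * t * ξ ^ 3 + x| := by
    have := abs_sub_abs_le_abs_sub x (-(4 * t * ξ ^ 3))
    rwa [abs_neg, sub_neg_eq_add, add_comm x] at this
  rw [e] at a1 a2
  have b1 := mul_le_mul_of_nonneg_left hl ht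
  have b2 := mul_le_mul_of_nonneg_left hu ht
  rcases h with h | h
  · exact max_le (by linarith) (by linarith)
  · exact max_le (by linarith) (by linarith)

/-- Two integrations by parts at once: the displayed product, minus a primitive of `e^{ip} f`,
has a derivative of order `(p')⁻²`. -/
theorem hasDerivAt_exp_mul_nonstationary {t x ξ : ℝ} {f f' : ℝ → ℂ} {f'' : ℂ}
    (hf : HasDerivAt f (f' ξ) ξ) (hf' : HasDerivAt f' f'' ξ)
    (hP : (4 * t * ξ ^ 3 + x : ℂ) ≠ 0) :
    HasDerivAt (fun y : ℝ => exp (I * (t * y ^ 4 + x * y)) *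
        (-I * f y * (4 * t * y ^ 3 + x : ℂ)⁻¹ + f' y * (4 * t * y ^ 3 + x : ℂ)⁻¹ ^ 2
          - f y * (12 * t * y ^ 2) * (4 * t * y ^ 3 + x : ℂ)⁻¹ ^ 3))
      (exp (I * (t * ξ ^ 4 + x * ξ)) * f ξ + exp (I * (t * ξ ^ 4 + x * ξ)) *
        (f'' * (4 * t * ξ ^ 3 + x : ℂ)⁻¹ ^ 2
          - 3 * f' ξ * (12 * t * ξ ^ 2) * (4 * t * ξ ^ 3 + x : ℂ)⁻¹ ^ 3
          - f ξ * (24 * t * ξ) * (4 * t * ξ ^ 3 + x : ℂ)⁻¹ ^ 3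
          + 3 * f ξ * (12 * t * ξ ^ 2) ^ 2 * (4 * t * ξ ^ 3 + x : ℂ)⁻¹ ^ 4)) ξ := by
  have hid : HasDerivAt (fun y : ℝ => (y : ℂ)) 1 ξ := by
    simpa using (hasDerivAt_id ξ).ofReal_comp
  have he := ((((hid.fun_pow 4).const_mul (t : ℂ)).fun_add
    (hid.const_mul (x : ℂ))).const_mul I).cexp
  have hu := (((hid.fun_pow 3).const_mul (4 * t : ℂ)).add_const (x : ℂ)).fun_inv hP
  have hq := (hid.fun_pow 2).const_mul (12 * t : ℂ)
  refine (he.fun_mul ((((hf.const_mul (-I)).fun_mul hu).fun_add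
    (hf'.fun_mul (hu.fun_pow 2))).fun_sub
      ((hf.fun_mul hq).fun_mul (hu.fun_pow 3)))).congr_deriv ?_
  rw [div_eq_mul_inv, ← inv_pow]
  have hc := mul_inv_cancel₀ hP
  set u := (4 * t * ξ ^ 3 + x : ℂ)⁻¹
  set e := exp (I * (t * ξ ^ 4 + x * ξ))
  linear_combination (-I ^ 2 * e * f ξ + e * I * f' ξ * u
    - e * I * f ξ * (12 * t * ξ ^ 2) * u ^ 2) * hc - e * f ξ * I_sq

/-- Pointwise bound for the amplitude left after two integrations by parts. -/
theorem norm_nonstationary_amplitude_le {a b c p q u : ℂ} {l M : ℝ} (hl : 0 < l)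
    (ha : ‖a‖ ≤ M) (hb : ‖b‖ ≤ M) (hc : ‖c‖ ≤ M)
    (hp : ‖p‖ ≤ 48 * l) (hq : ‖q‖ ≤ 48 * l) (hu : ‖u‖ ≤ 4 / l) :
    ‖c * u ^ 2 - 3 * b * p * u ^ 3 - a * q * u ^ 3 + 3 * a * p ^ 2 * u ^ 4‖
      ≤ 1781776 * M / l ^ 2 := by
  have hM : 0 ≤ M := (norm_nonneg a).trans ha
  calc ‖c * u ^ 2 - 3 * b * p * u ^ 3 - a * q * u ^ 3 + 3 * a * p ^ 2 * u ^ 4‖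
      ≤ ‖c * u ^ 2‖ + ‖3 * b * p * u ^ 3‖ + ‖a * q * u ^ 3‖ + ‖3 * a * p ^ 2 * u ^ 4‖ :=
        (norm_add_le _ _).trans (by
          gcongr
          exact (norm_sub_le _ _).trans (by gcongr; exact norm_sub_le _ _))
    _ = ‖c‖ * ‖u‖ ^ 2 + 3 * ‖b‖ * ‖p‖ * ‖u‖ ^ 3 + ‖a‖ * ‖q‖ * ‖u‖ ^ 3
          + 3 * ‖a‖ * ‖p‖ ^ 2 * ‖u‖ ^ 4 := by simp
    _ ≤ M * (4 / l) ^ 2 + 3 * M * (48 * l) * (4 / l) ^ 3 + M * (48 * l) * (4 / l) ^ 3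
          + 3 * M * (48 * l) ^ 2 * (4 / l) ^ 4 := by gcongr
    _ = 1781776 * M / l ^ 2 := by field_simp; ring

/-- Oscillatory integral decay in the nonstationary regime: for a smooth cutoff `φ`
supported in `{1/2 ≤ |ξ| ≤ 2}`, if `|x| ≫ |t|` or `|t| ≫ |x|` then
`|∫ e^{i(tξ⁴+xξ)} φ(ξ) dξ| ≤ C / max(x², t²)`. -/
theorem stmt_1 (φ : ℝ → ℂ) (hφ : ContDiff ℝ (⊤ : ℕ∞) φ)
    (hsupp : Function.support φ ⊆ {ξ : ℝ | 1/2 ≤ |ξ| ∧ |ξ| ≤ 2}) :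
    ∃ A ≥ (1:ℝ), ∃ C > (0:ℝ), ∀ t x : ℝ, (t, x) ≠ ((0:ℝ), (0:ℝ)) →
      (|x| ≥ A * |t| ∨ |t| ≥ A * |x|) →
      ‖∫ ξ : ℝ, Complex.exp (Complex.I * (t * ξ^4 + x * ξ)) * φ ξ‖ ≤
        C / max (x^2) (t^2) := by
  set S : Set ℝ := {ξ : ℝ | 1/2 ≤ |ξ| ∧ |ξ| ≤ 2} with hS
  have hSc : IsClosed S :=
    (isClosed_le continuous_const continuous_abs).inter
      (isClosed_le continuous_abs continuous_const)
  have hd1 : ContDiff ℝ (⊤ : ℕ∞) (deriv φ) := (contDiff_infty_iff_deriv.1 hφ).2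
  have hd2 : ContDiff ℝ (⊤ : ℕ∞) (deriv (deriv φ)) := (contDiff_infty_iff_deriv.1 hd1).2
  have hDφ (ξ : ℝ) : HasDerivAt φ (deriv φ ξ) ξ :=
    ((contDiff_infty_iff_deriv.1 hφ).1 ξ).hasDerivAt
  have hDφ' (ξ : ℝ) : HasDerivAt (deriv φ) (deriv (deriv φ) ξ) ξ :=
    ((contDiff_infty_iff_deriv.1 hd1).1 ξ).hasDerivAt
  have hzero (ξ : ℝ) (h : ξ ∉ S) : φ ξ = 0 := by
    by_contra hne
    exact h (hsupp hne)
  have hzero' (ξ : ℝ) (h : ξ ∉ S) : deriv φ ξ = 0 := by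
    have : φ =ᶠ[nhds ξ] fun _ => 0 := by
      filter_upwards [hSc.isOpen_compl.mem_nhds h] with y hy using hzero y hy
    simpa using this.deriv_eq
  have hnot (y : ℝ) (hy : 2 < |y|) : y ∉ S := fun h => absurd h.2 (not_le.2 hy)
  obtain ⟨M0, hM0⟩ := (isCompact_Icc (a := (-3 : ℝ)) (b := 3)).exists_bound_of_continuousOn
    hφ.continuous.continuousOn
  obtain ⟨M1, hM1⟩ := (isCompact_Icc (a := (-3 : ℝ)) (b := 3)).exists_bound_of_continuousOn
    hd1.continuous.continuousOn
  obtain ⟨M2, hM2⟩ := (isCompact_Icc (a := (-3 : ℝ)) (b := 3)).exists_bound_of_continuousOn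
    hd2.continuous.continuousOn
  set M := max 1 (max M0 (max M1 M2)) with hM
  have hMpos : 0 < M := lt_of_lt_of_le one_pos (le_max_left _ _)
  refine ⟨64, by norm_num, 1781776 * M * 6, by positivity, fun t x htx hA => ?_⟩
  set l := max |x| |t| with hl
  have hlpos : 0 < l := by
    by_contra! hle
    have h1 : |x| ≤ 0 := (le_max_left _ _).trans hle
    have h2 : |t| ≤ 0 := (le_max_right _ _).trans hle
    exact htx (by rw [abs_nonpos_iff.1 h1, abs_nonpos_iff.1 h2])
  have hmax : max (x ^ 2) (t ^ 2) ≤ l ^ 2 := by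
    rw [← sq_abs x, ← sq_abs t]
    exact max_le (by gcongr; exact le_max_left _ _) (by gcongr; exact le_max_right _ _)
  have hmaxpos : 0 < max (x ^ 2) (t ^ 2) := by
    by_contra! hle
    have h1 : x ^ 2 ≤ 0 := (le_max_left _ _).trans hle
    have h2 : t ^ 2 ≤ 0 := (le_max_right _ _).trans hle
    exact htx (by rw [_root_.sq_nonpos_iff x |>.1 h1, _root_.sq_nonpos_iff t |>.1 h2])
  set g : ℝ → ℂ := fun ξ => exp (I * (t * ξ ^ 4 + x * ξ)) * φ ξ with hg
  have hgc : Continuous g := by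
    have := hφ.continuous
    fun_prop
  set F : ℝ → ℂ := fun y => exp (I * (t * y ^ 4 + x * y)) *
        (-I * φ y * (4 * t * y ^ 3 + x : ℂ)⁻¹ + deriv φ y * (4 * t * y ^ 3 + x : ℂ)⁻¹ ^ 2
          - φ y * (12 * t * y ^ 2) * (4 * t * y ^ 3 + x : ℂ)⁻¹ ^ 3) with hF
  have hF0 (ξ : ℝ) (h : ξ ∉ S) : F ξ = 0 := by simp [hF, hzero ξ h, hzero' ξ h]
  have hderiv (ξ : ℝ) (hξ : ξ ∈ Set.Icc (-3 : ℝ) 3) :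
      ∃ d : ℂ, HasDerivAt F (g ξ + d) ξ ∧ ‖d‖ ≤ 1781776 * M / l ^ 2 := by
    by_cases h : ξ ∈ S
    · have hlow := max_abs_le_four_mul_abs_phase_deriv hA h.1 h.2
      have hnorm : ‖(4 * t * ξ ^ 3 + x : ℂ)‖ = |4 * t * ξ ^ 3 + x| := by
        rw [← Real.norm_eq_abs, ← Complex.norm_real]
        push_cast
        rfl
      have hPpos : 0 < ‖(4 * t * ξ ^ 3 + x : ℂ)‖ := by rw [hnorm]; linarith
      refine ⟨_, hasDerivAt_exp_mul_nonstationary (hDφ ξ) (hDφ' ξ) (norm_pos_iff.1 hPpos), ?_⟩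
      have hexp : ‖exp (I * (t * ξ ^ 4 + x * ξ))‖ = 1 := by
        rw [mul_comm]
        exact_mod_cast norm_exp_ofReal_mul_I (t * ξ ^ (4 : ℕ) + x * ξ)
      rw [norm_mul, hexp, one_mul]
      have htl : |t| ≤ l := le_max_right _ _
      have hξ2 : |ξ| ≤ 2 := h.2
      refine norm_nonstationary_amplitude_le hlpos ((hM0 ξ hξ).trans (by simp [hM]))
        ((hM1 ξ hξ).trans (by simp [hM])) ((hM2 ξ hξ).trans (by simp [hM])) ?_ ?_ ?_
      · have : ‖(12 * t * ξ ^ 2 : ℂ)‖ = 12 * |t| * |ξ| ^ 2 := by simp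
        rw [this]
        calc 12 * |t| * |ξ| ^ 2 ≤ 12 * l * 2 ^ 2 := by gcongr
          _ = 48 * l := by ring
      · have : ‖(24 * t * ξ : ℂ)‖ = 24 * |t| * |ξ| := by simp
        rw [this]
        calc 24 * |t| * |ξ| ≤ 24 * l * 2 := by gcongr
          _ = 48 * l := by ring
      · rw [norm_inv, inv_le_comm₀ hPpos (by positivity), inv_div, hnorm]
        linarith
    · refine ⟨0, ?_, by simp; positivity⟩
      have hev : F =ᶠ[nhds ξ] fun _ => 0 := by
        filter_upwards [hSc.isOpen_compl.mem_nhds h] with y hy using hF0 y hy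
      simpa [hg, hzero ξ h] using (hasDerivAt_const ξ (0 : ℂ)).congr_of_eventuallyEq hev
  choose! d hd hdle using hderiv
  have hE (ξ : ℝ) (hξ : ξ ∈ Set.Icc (-3 : ℝ) 3) :
      HasDerivAt (fun y => F y - ∫ s in (-3 : ℝ)..y, g s) (d ξ) ξ := by
    simpa using (hd ξ hξ).fun_sub (hgc.integral_hasStrictDerivAt (-3) ξ).hasDerivAt
  have hmv := norm_image_sub_le_of_norm_deriv_le_segment'
    (fun ξ hξ => (hE ξ hξ).hasDerivWithinAt)
    (fun ξ hξ => hdle ξ (Set.Ico_subset_Icc_self hξ)) 3 (by norm_num)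
  have hwhole : ∫ s in (-3 : ℝ)..3, g s = ∫ s, g s := by
    apply intervalIntegral.integral_eq_integral_of_support_subset
    intro y hy
    have hyS : y ∈ S := by
      by_contra h
      exact hy (by simp [hg, hzero y h])
    have := abs_le.1 hyS.2
    exact ⟨by linarith, by linarith⟩
  rw [hF0 3 (hnot 3 (by norm_num)), hF0 (-3) (hnot (-3) (by norm_num)), hwhole] at hmv
  calc ‖∫ ξ, g ξ‖ ≤ 1781776 * M / l ^ 2 * (3 - -3) := by simpa using hmv
    _ = 1781776 * M * 6 / l ^ 2 := by ring
    _ ≤ 1781776 * M * 6 / max (x ^ 2) (t ^ 2) := by gcongr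
end

section
/- For every α ∈ [0,1] there exists a constant C_α > 0 such that for every Schwartz function u₀ on ℝ, every t ≠ 0, and every x ∈ ℝ, |(D^α e^{it∂_x⁴} u₀)(x)| ≤ C_α |t|^{-(α+1)/4} ‖u₀‖_{L¹(ℝ)}. -/
open MeasureTheory Complex

/-- The Fourier transform `û(ξ) = ∫ e^{-ixξ} u(x) dx`. -/
noncomputable def fourierInt (u : ℝ → ℂ) (ξ : ℝ) : ℂ :=
  ∫ x : ℝ, Complex.exp (-(Complex.I * x * ξ)) * u x

/-- `(D^α e^{it∂_x⁴} u)(x) = (2π)⁻¹ ∫ |ξ|^α e^{i(xξ+tξ⁴)} û(ξ) dξ`. -/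
noncomputable def DbihamGroup (α t : ℝ) (u : ℝ → ℂ) (x : ℝ) : ℂ :=
  (2 * Real.pi)⁻¹ * ∫ ξ : ℝ, ((|ξ| ^ α : ℝ) : ℂ) *
    Complex.exp (Complex.I * (x * ξ + t * ξ^4)) * fourierInt u ξ

/-- Integration by parts for an oscillatory integral with amplitude `f = h * φ'`, where the
variation of `h` is controlled by a primitive `G`. -/
lemma norm_integral_mul_exp_le {a b : ℝ} (hab : a ≤ b) {f h h' φ φ' G G' : ℝ → ℝ}
    (hf : Continuous f) (hφc : Continuous φ)
    (hh : ∀ s ∈ Set.Icc a b, HasDerivAt h (h' s) s)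
    (hφ : ∀ s ∈ Set.Icc a b, HasDerivAt φ (φ' s) s)
    (hG : ∀ s ∈ Set.Icc a b, HasDerivAt G (G' s) s)
    (hfac : ∀ s ∈ Set.Icc a b, f s = h s * φ' s)
    (hle : ∀ s ∈ Set.Icc a b, |h' s| ≤ G' s) :
    ‖∫ s in a..b, (f s : ℂ) * exp (I * φ s)‖ ≤ |h a| + |h b| + (G b - G a) := by
  have hnorm : ∀ s : ℝ, ‖exp (I * φ s)‖ = 1 := fun s => by
    rw [mul_comm]; exact norm_exp_ofReal_mul_I _
  have hcont : Continuous fun s : ℝ => (f s : ℂ) * exp (I * φ s) := by fun_prop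
  let F : ℝ → ℂ := fun s => (∫ r in a..s, (f r : ℂ) * exp (I * φ r)) + I * h s * exp (I * φ s)
  have hF : ∀ s ∈ Set.Icc a b, HasDerivAt F (I * h' s * exp (I * φ s)) s := by
    intro s hs
    have h1 := intervalIntegral.integral_hasDerivAt_right (hcont.intervalIntegrable a s)
      (hcont.stronglyMeasurableAtFilter _ _) hcont.continuousAt
    have h2 := ((hh s hs).ofReal_comp.const_mul I).mul
      (((hφ s hs).ofReal_comp.const_mul I).cexp)
    refine (h1.add h2).congr_deriv ?_
    rw [hfac s hs]
    push_cast
    linear_combination (h s * φ' s * exp (I * φ s) : ℂ) * I_mul_I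
  have key := image_norm_le_of_norm_deriv_right_le_deriv_boundary'
    (f := F) (f' := fun s => I * h' s * exp (I * φ s)) (a := a) (b := b)
    (B := fun s => |h a| + (G s - G a)) (B' := G')
    (fun s hs => (hF s hs).continuousAt.continuousWithinAt)
    (fun s hs => (hF s (Set.Ico_subset_Icc_self hs)).hasDerivWithinAt)
    (by simp [F, hnorm])
    (fun s hs => (((hG s hs).sub_const _).const_add _).continuousAt.continuousWithinAt)
    (fun s hs =>
      (((hG s (Set.Ico_subset_Icc_self hs)).sub_const _).const_add _).hasDerivWithinAt)
    (fun s hs => by simpa [hnorm] using hle s (Set.Ico_subset_Icc_self hs))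
    (Set.right_mem_Icc.2 hab)
  have hsplit : (∫ s in a..b, (f s : ℂ) * exp (I * φ s)) = F b - I * h b * exp (I * φ b) := by
    simp [F]
  rw [hsplit]
  refine (norm_sub_le _ _).trans ?_
  have : ‖I * (h b : ℂ) * exp (I * φ b)‖ = |h b| := by simp [hnorm]
  rw [this]
  linarith

/-- The oscillatory integrand `s^α e^{i(ws+s⁴)}`. -/
noncomputable def quarticOsc (α w s : ℝ) : ℂ :=
  ((|s| ^ α : ℝ) : ℂ) * exp (I * ((w * s + s ^ 4 : ℝ) : ℂ))

lemma continuous_abs_rpow {α : ℝ} (hα : 0 ≤ α) : Continuous fun s : ℝ => |s| ^ α :=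
  continuous_abs.rpow_const fun _ => Or.inr hα

lemma continuous_quarticOsc {α : ℝ} (hα : 0 ≤ α) (w : ℝ) : Continuous (quarticOsc α w) := by
  have := continuous_abs_rpow hα
  unfold quarticOsc
  fun_prop

lemma norm_quarticOsc (α w s : ℝ) : ‖quarticOsc α w s‖ = |s| ^ α := by
  rw [quarticOsc, norm_mul, mul_comm I, norm_exp_ofReal_mul_I, mul_one, norm_real,
    Real.norm_of_nonneg (by positivity)]

lemma rpow_le_self_of_one_le {α s : ℝ} (hα : α ≤ 1) (hs : 1 ≤ s) : s ^ α ≤ s := by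
  simpa using Real.rpow_le_rpow_of_exponent_le hs hα

lemma hasDerivAt_rpow_div_cubic {α w s : ℝ} (hs : 0 < s) (hD : w + 4 * s ^ 3 ≠ 0) :
    HasDerivAt (fun s : ℝ => |s| ^ α / (w + 4 * s ^ 3))
      (s ^ (α - 1) * (α * (w + 4 * s ^ 3) - 12 * s ^ 3) / (w + 4 * s ^ 3) ^ 2) s := by
  have h1 : HasDerivAt (fun s : ℝ => |s| ^ α) (α * s ^ (α - 1)) s := by
    refine (Real.hasDerivAt_rpow_const (Or.inl hs.ne')).congr_of_eventuallyEq ?_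
    filter_upwards [lt_mem_nhds hs] with r hr
    rw [abs_of_pos hr]
  have h2 : HasDerivAt (fun s : ℝ => w + 4 * s ^ 3) (4 * (3 * s ^ 2)) s := by
    simpa using ((hasDerivAt_pow 3 s).const_mul 4).const_add w
  refine (h1.div h2 hD).congr_deriv ?_
  have h3 : |s| ^ α = s ^ (α - 1) * s := by
    rw [abs_of_pos hs, ← Real.rpow_add_one hs.ne', sub_add_cancel]
  rw [h3]
  ring

lemma hasDerivAt_quartic_phase (w s : ℝ) :
    HasDerivAt (fun s : ℝ => w * s + s ^ 4) (w + 4 * s ^ 3) s := by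
  refine (((hasDerivAt_id s).const_mul w).add (hasDerivAt_pow 4 s)).congr_deriv ?_
  norm_num

lemma norm_integral_quarticOsc_le_of_nonneg {α w a b : ℝ} (hα : α ∈ Set.Icc (0 : ℝ) 1)
    (hw : 0 ≤ w) (ha : 1 ≤ a) (hab : a ≤ b) :
    ‖∫ s in a..b, quarticOsc α w s‖ ≤ 2 := by
  have hpos : ∀ s, 1 ≤ s → 0 < s ∧ 4 * s ^ 3 ≤ w + 4 * s ^ 3 ∧ 0 < w + 4 * s ^ 3 := by
    intro s hs
    have : 0 < s := by linarith
    exact ⟨this, by linarith, by positivity⟩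
  have hbd : ∀ s, 1 ≤ s → |(|s| ^ α / (w + 4 * s ^ 3))| ≤ 1 / 4 := by
    intro s hs
    obtain ⟨h0, h4, hD⟩ := hpos s hs
    rw [abs_of_pos h0, abs_of_nonneg (by positivity), div_le_iff₀ hD]
    have := rpow_le_self_of_one_le hα.2 hs
    nlinarith [pow_le_pow_right₀ hs (show 1 ≤ 3 by norm_num)]
  have key := norm_integral_mul_exp_le hab (f := fun s => |s| ^ α)
    (φ := fun s => w * s + s ^ 4) (φ' := fun s => w + 4 * s ^ 3)
    (h := fun s => |s| ^ α / (w + 4 * s ^ 3)) (G := fun s => -s⁻¹) (G' := fun s => (s ^ 2)⁻¹)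
    (continuous_abs_rpow hα.1) (by fun_prop)
    (fun s hs => hasDerivAt_rpow_div_cubic (hpos s (ha.trans hs.1)).1
      (hpos s (ha.trans hs.1)).2.2.ne')
    (fun s _ => hasDerivAt_quartic_phase w s)
    (fun s hs => (hasDerivAt_inv (hpos s (ha.trans hs.1)).1.ne').neg.congr_deriv (neg_neg _))
    (fun s hs => by
      have := (hpos s (ha.trans hs.1)).2.2.ne'
      field_simp)
    (fun s hs => by
      have h1 : 1 ≤ s := ha.trans hs.1
      obtain ⟨h0, h4, hD⟩ := hpos s h1
      set D := w + 4 * s ^ 3 with hDdef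
      have hr1 : s ^ (α - 1) ≤ 1 := Real.rpow_le_one_of_one_le_of_nonpos h1 (by linarith [hα.2])
      have hr0 : 0 ≤ s ^ (α - 1) := by positivity
      have hnum : |α * D - 12 * s ^ 3| ≤ 4 * D := by
        have : 0 < s ^ 3 := by positivity
        have h5 : 0 ≤ α * D := mul_nonneg hα.1 hD.le
        have h6 : α * D ≤ D := by nlinarith [hα.2]
        rw [abs_le]; constructor <;> linarith
      rw [abs_div, abs_mul, abs_of_nonneg hr0, abs_of_nonneg (sq_nonneg D)]
      have h7 : s ^ (α - 1) * |α * D - 12 * s ^ 3| ≤ 4 * D :=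
        (mul_le_of_le_one_left (abs_nonneg _) hr1).trans hnum
      rw [div_le_iff₀ (by positivity), inv_mul_eq_div, le_div_iff₀ (by positivity)]
      have h8 : s ^ 2 ≤ s ^ 3 := pow_le_pow_right₀ h1 (by norm_num)
      calc _ ≤ 4 * D * s ^ 2 := by gcongr
        _ ≤ D * D := by nlinarith
        _ = D ^ 2 := by ring)
  have h1 := hbd a ha
  have h2 := hbd b (ha.trans hab)
  have h3 : a⁻¹ ≤ 1 := inv_le_one_of_one_le₀ ha
  have h4 : 0 ≤ b⁻¹ := by have := ha.trans hab; positivity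
  unfold quarticOsc
  beta_reduce at key
  linarith

lemma norm_integral_quarticOsc_le_of_far {α c a b : ℝ} (hα : α ∈ Set.Icc (0 : ℝ) 1)
    (hc : 0 ≤ c) (ha : 1 ≤ a) (hab : a ≤ b)
    (hfar : ∀ s ∈ Set.Icc a b, (max c 1)⁻¹ ≤ |s - c|) :
    ‖∫ s in a..b, quarticOsc α (-(4 * c ^ 3)) s‖ ≤ 1 := by
  have hM : 0 < max c 1 := by positivity
  have hlow : ∀ s ∈ Set.Icc a b, 0 < s ∧ s ≤ |s ^ 3 - c ^ 3| := by
    intro s hs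
    have h1 : 1 ≤ s := ha.trans hs.1
    refine ⟨by linarith, ?_⟩
    have hfac : s ^ 3 - c ^ 3 = (s - c) * (s ^ 2 + s * c + c ^ 2) := by ring
    have hQ : s * max c 1 ≤ s ^ 2 + s * c + c ^ 2 := by
      rcases max_cases c 1 with h | h <;> rw [h.1] <;> nlinarith
    have hQ0 : 0 ≤ s ^ 2 + s * c + c ^ 2 := by positivity
    rw [hfac, abs_mul, abs_of_nonneg hQ0]
    calc s = (max c 1)⁻¹ * (s * max c 1) := by field_simp
      _ ≤ _ := mul_le_mul (hfar s hs) hQ (by positivity) (abs_nonneg _)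
  have hDeq : ∀ s : ℝ, -(4 * c ^ 3) + 4 * s ^ 3 = 4 * (s ^ 3 - c ^ 3) := fun s => by ring
  have hD : ∀ s ∈ Set.Icc a b, -(4 * c ^ 3) + 4 * s ^ 3 ≠ 0 := by
    intro s hs
    obtain ⟨h0, h1⟩ := hlow s hs
    rw [hDeq]
    exact mul_ne_zero (by norm_num) (abs_pos.1 (h0.trans_le h1))
  have hbd : ∀ s ∈ Set.Icc a b, |(|s| ^ α / (-(4 * c ^ 3) + 4 * s ^ 3))| ≤ 1 / 4 := by
    intro s hs
    obtain ⟨h0, h1⟩ := hlow s hs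
    rw [hDeq, abs_of_pos h0, abs_div, abs_mul, abs_of_nonneg (by positivity : 0 ≤ s ^ α),
      abs_of_pos (by norm_num : (0 : ℝ) < 4), div_le_iff₀ (by linarith)]
    linarith [rpow_le_self_of_one_le hα.2 (ha.trans hs.1)]
  have key := norm_integral_mul_exp_le hab (f := fun s => |s| ^ α)
    (φ := fun s => -(4 * c ^ 3) * s + s ^ 4) (φ' := fun s => -(4 * c ^ 3) + 4 * s ^ 3)
    (h := fun s => |s| ^ α / (-(4 * c ^ 3) + 4 * s ^ 3))
    (G := fun s => -(|s| ^ α / (-(4 * c ^ 3) + 4 * s ^ 3)))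
    (continuous_abs_rpow hα.1) (by fun_prop)
    (fun s hs => hasDerivAt_rpow_div_cubic (hlow s hs).1 (hD s hs))
    (fun s _ => hasDerivAt_quartic_phase _ s)
    (fun s hs => (hasDerivAt_rpow_div_cubic (hlow s hs).1 (hD s hs)).neg)
    (fun s hs => by
      have := hD s hs
      exact (div_mul_cancel₀ _ this).symm)
    (fun s hs => by
      have h0 := (hlow s hs).1
      refine (abs_of_nonpos ?_).le
      refine div_nonpos_of_nonpos_of_nonneg (mul_nonpos_of_nonneg_of_nonpos (by positivity) ?_)
        (sq_nonneg _)
      have h3 : 0 < s ^ 3 := by positivity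
      have h4 : 0 ≤ c ^ 3 := by positivity
      nlinarith [hα.1, hα.2, mul_nonneg hα.1 h4])
  have h1 := hbd a (Set.left_mem_Icc.2 hab)
  have h2 := hbd b (Set.right_mem_Icc.2 hab)
  unfold quarticOsc
  beta_reduce at key
  linarith [le_abs_self (|a| ^ α / (-(4 * c ^ 3) + 4 * a ^ 3)),
    neg_abs_le (|b| ^ α / (-(4 * c ^ 3) + 4 * b ^ 3))]

lemma norm_integral_quarticOsc_le_of_near {α w c a b : ℝ} (hα : α ∈ Set.Icc (0 : ℝ) 1)
    (ha : 1 ≤ a) (hab : a ≤ b)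
    (hac : c - (max c 1)⁻¹ ≤ a) (hbc : b ≤ c + (max c 1)⁻¹) :
    ‖∫ s in a..b, quarticOsc α w s‖ ≤ 4 := by
  have hM : 1 ≤ max c 1 := le_max_right _ _
  have hMc : c ≤ max c 1 := le_max_left _ _
  have hMi : (max c 1)⁻¹ ≤ 1 := inv_le_one_of_one_le₀ hM
  have h := intervalIntegral.norm_integral_le_of_norm_le_const (a := a) (b := b)
    (f := quarticOsc α w) (C := 2 * max c 1) (fun s hs => by
      rw [Set.uIoc_of_le hab] at hs
      have h1 : 1 ≤ s := ha.trans hs.1.le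
      rw [norm_quarticOsc, abs_of_pos (by linarith)]
      linarith [rpow_le_self_of_one_le hα.2 h1, hs.2])
  refine h.trans ?_
  rw [abs_of_nonneg (by linarith)]
  calc 2 * max c 1 * (b - a) ≤ 2 * max c 1 * (2 * (max c 1)⁻¹) := by gcongr; linarith
    _ = 4 := by field_simp; norm_num

lemma norm_integral_quarticOsc_zero_one_le {α w R : ℝ} (hα : 0 ≤ α) (hR : 0 ≤ R) (hR1 : R ≤ 1) :
    ‖∫ s in (0 : ℝ)..R, quarticOsc α w s‖ ≤ 1 := by
  have h := intervalIntegral.norm_integral_le_of_norm_le_const (a := 0) (b := R)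
    (f := quarticOsc α w) (C := 1) (fun s hs => by
      rw [Set.uIoc_of_le hR] at hs
      rw [norm_quarticOsc, abs_of_pos hs.1]
      exact Real.rpow_le_one hs.1.le (hs.2.trans hR1) hα)
  rw [sub_zero, abs_of_nonneg hR] at h
  linarith

lemma norm_integral_quarticOsc_one_le {α R : ℝ} (hα : α ∈ Set.Icc (0 : ℝ) 1) (w : ℝ)
    (hR : 1 ≤ R) : ‖∫ s in (1 : ℝ)..R, quarticOsc α w s‖ ≤ 6 := by
  rcases le_or_gt 0 w with hw | hw
  · linarith [norm_integral_quarticOsc_le_of_nonneg hα hw le_rfl hR]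
  obtain ⟨c, hc, rfl⟩ : ∃ c : ℝ, 0 ≤ c ∧ w = -(4 * c ^ 3) := by
    refine ⟨(-w / 4) ^ ((3 : ℕ)⁻¹ : ℝ), Real.rpow_nonneg (by linarith) _, ?_⟩
    rw [Real.rpow_inv_natCast_pow (by linarith) (by norm_num)]
    ring
  set δ := (max c 1)⁻¹ with hδ
  have hδ0 : 0 < δ := by positivity
  let p := max 1 (min R (c - δ))
  let q := max 1 (min R (c + δ))
  have hp1 : 1 ≤ p := le_max_left _ _
  have hq1 : 1 ≤ q := le_max_left _ _
  have hpq : p ≤ q := by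
    have : c - δ ≤ c + δ := by linarith
    exact max_le_max le_rfl (min_le_min le_rfl this)
  have hqR : q ≤ R := max_le hR (min_le_left _ _)
  have hint : ∀ a b : ℝ, IntervalIntegrable (quarticOsc α (-(4 * c ^ 3))) volume a b :=
    fun a b => (continuous_quarticOsc hα.1 _).intervalIntegrable a b
  have h1 : ‖∫ s in (1 : ℝ)..p, quarticOsc α (-(4 * c ^ 3)) s‖ ≤ 1 := by
    rcases hp1.eq_or_lt with h | h
    · rw [← h]; simp
    · refine norm_integral_quarticOsc_le_of_far hα hc le_rfl hp1 fun s hs => ?_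
      have hpc : p ≤ c - δ := by
        have : 1 < min R (c - δ) := (lt_max_iff.1 h).resolve_left (lt_irrefl _)
        exact max_le (this.le.trans (min_le_right _ _)) (min_le_right _ _)
      rw [abs_sub_comm]
      exact (by linarith [hs.2] : δ ≤ c - s).trans (le_abs_self _)
  have h2 : ‖∫ s in p..q, quarticOsc α (-(4 * c ^ 3)) s‖ ≤ 4 := by
    rcases hpq.eq_or_lt with h | h
    · rw [← h]; simp
    · refine norm_integral_quarticOsc_le_of_near (c := c) hα hp1 hpq ?_ ?_
      · have hpR : p < R := h.trans_le hqR
        have : min R (c - δ) < R := (le_max_right _ _).trans_lt hpR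
        have h3 : c - δ < R := by simpa using this
        exact (min_eq_right h3.le).symm.le.trans (le_max_right _ _)
      · have : 1 < max 1 (min R (c + δ)) := hp1.trans_lt h
        have h4 : 1 < min R (c + δ) := by simpa using this
        exact max_le (h4.le.trans (min_le_right _ _)) (min_le_right _ _)
  have h3 : ‖∫ s in q..R, quarticOsc α (-(4 * c ^ 3)) s‖ ≤ 1 := by
    rcases hqR.eq_or_lt with h | h
    · rw [← h]; simp
    · refine norm_integral_quarticOsc_le_of_far hα hc hq1 hqR fun s hs => ?_
      have : min R (c + δ) < R := (le_max_right _ _).trans_lt h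
      have h4 : c + δ < R := by simpa using this
      have h5 : c + δ ≤ q := (min_eq_right h4.le).symm.le.trans (le_max_right _ _)
      exact (by linarith [hs.1] : δ ≤ s - c).trans (le_abs_self _)
  rw [← intervalIntegral.integral_add_adjacent_intervals (hint 1 p) (hint p R),
    ← intervalIntegral.integral_add_adjacent_intervals (hint p q) (hint q R)]
  refine (norm_add_le _ _).trans ?_
  linarith [norm_add_le (∫ s in p..q, quarticOsc α (-(4 * c ^ 3)) s)
    (∫ s in q..R, quarticOsc α (-(4 * c ^ 3)) s)]

lemma norm_integral_quarticOsc_zero_le {α R : ℝ} (hα : α ∈ Set.Icc (0 : ℝ) 1) (w : ℝ)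
    (hR : 0 ≤ R) : ‖∫ s in (0 : ℝ)..R, quarticOsc α w s‖ ≤ 7 := by
  rcases le_total R 1 with h | h
  · linarith [norm_integral_quarticOsc_zero_one_le (w := w) hα.1 hR h]
  have hint : ∀ a b : ℝ, IntervalIntegrable (quarticOsc α w) volume a b :=
    fun a b => (continuous_quarticOsc hα.1 _).intervalIntegrable a b
  rw [← intervalIntegral.integral_add_adjacent_intervals (hint 0 1) (hint 1 R)]
  refine (norm_add_le _ _).trans ?_
  linarith [norm_integral_quarticOsc_zero_one_le (w := w) hα.1 zero_le_one le_rfl,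
    norm_integral_quarticOsc_one_le hα w h]

lemma norm_integral_quarticOsc_symm_le {α R : ℝ} (hα : α ∈ Set.Icc (0 : ℝ) 1) (w : ℝ)
    (hR : 0 ≤ R) : ‖∫ s in (-R)..R, quarticOsc α w s‖ ≤ 14 := by
  have hint : ∀ a b : ℝ, IntervalIntegrable (quarticOsc α w) volume a b :=
    fun a b => (continuous_quarticOsc hα.1 _).intervalIntegrable a b
  have hneg : (∫ s in (-R)..0, quarticOsc α w s) = ∫ s in (0 : ℝ)..R, quarticOsc α (-w) s := by
    have := intervalIntegral.integral_comp_neg (a := 0) (b := R) (quarticOsc α w)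
    rw [neg_zero] at this
    rw [← this]
    congr 1
    ext s
    simp [quarticOsc, Even.neg_pow (show Even 4 by decide)]
  rw [← intervalIntegral.integral_add_adjacent_intervals (hint (-R) 0) (hint 0 R), hneg]
  refine (norm_add_le _ _).trans ?_
  linarith [norm_integral_quarticOsc_zero_le hα w hR, norm_integral_quarticOsc_zero_le hα (-w) hR]

/-- The integrand of the convolution kernel of the group. -/
noncomputable def biharmKernelIntegrand (α t z ξ : ℝ) : ℂ :=
  ((|ξ| ^ α : ℝ) : ℂ) * exp (I * ((z * ξ + t * ξ ^ 4 : ℝ) : ℂ))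

lemma norm_integral_biharmKernelIntegrand_le_of_pos {α t R : ℝ} (hα : α ∈ Set.Icc (0 : ℝ) 1)
    (ht : 0 < t) (z : ℝ) (hR : 0 ≤ R) :
    ‖∫ ξ in (-R)..R, biharmKernelIntegrand α t z ξ‖ ≤ 14 * t ^ (-(α + 1) / 4) := by
  set l : ℝ := t ^ (1 / 4 : ℝ) with hl
  have hl0 : 0 < l := by positivity
  have hl4 : l ^ 4 = t := by
    rw [hl, ← Real.rpow_natCast, ← Real.rpow_mul ht.le]; norm_num
  have hlα : (l ^ α)⁻¹ * l⁻¹ = t ^ (-(α + 1) / 4) := by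
    rw [← mul_inv, ← Real.rpow_add_one hl0.ne', hl, ← Real.rpow_mul ht.le, ← Real.rpow_neg ht.le]
    congr 1; ring
  have hscale : ∀ ξ, biharmKernelIntegrand α t z ξ =
      ((l ^ α)⁻¹ : ℝ) * quarticOsc α (z / l) (l * ξ) := by
    intro ξ
    have h1 : z / l * (l * ξ) + (l * ξ) ^ 4 = z * ξ + t * ξ ^ 4 := by
      rw [← hl4]; field_simp
    have h2 : |ξ| ^ α = (l ^ α)⁻¹ * |l * ξ| ^ α := by
      rw [abs_mul, abs_of_pos hl0, Real.mul_rpow hl0.le (abs_nonneg _),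
        inv_mul_cancel_left₀ (by positivity)]
    rw [biharmKernelIntegrand, quarticOsc, h1, h2]
    push_cast
    ring
  simp_rw [hscale]
  rw [intervalIntegral.integral_const_mul, intervalIntegral.integral_comp_mul_left _ hl0.ne',
    mul_neg, norm_mul, norm_smul, norm_real, Real.norm_of_nonneg (by positivity),
    Real.norm_of_nonneg (by positivity), ← mul_assoc, hlα, mul_comm]
  gcongr
  exact norm_integral_quarticOsc_symm_le hα _ (by positivity)

lemma norm_integral_biharmKernelIntegrand_le {α t R : ℝ} (hα : α ∈ Set.Icc (0 : ℝ) 1)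
    (ht : t ≠ 0) (z : ℝ) (hR : 0 ≤ R) :
    ‖∫ ξ in (-R)..R, biharmKernelIntegrand α t z ξ‖ ≤ 14 * |t| ^ (-(α + 1) / 4) := by
  rcases ht.lt_or_gt with h | h
  · have hconj : ∀ ξ, biharmKernelIntegrand α t z ξ =
        (starRingEnd ℂ) (biharmKernelIntegrand α (-t) (-z) ξ) := by
      intro ξ
      simp only [biharmKernelIntegrand, map_mul, ← exp_conj, conj_I, conj_ofReal]
      congr 2
      push_cast
      ring
    have : (∫ ξ in (-R)..R, biharmKernelIntegrand α t z ξ) =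
        (starRingEnd ℂ) (∫ ξ in (-R)..R, biharmKernelIntegrand α (-t) (-z) ξ) := by
      simp_rw [hconj]
      rw [intervalIntegral.integral_of_le (by linarith), intervalIntegral.integral_of_le (by linarith)]
      exact integral_conj
    rw [this, RCLike.norm_conj, abs_of_neg h]
    exact norm_integral_biharmKernelIntegrand_le_of_pos hα (neg_pos.2 h) _ hR
  · rw [abs_of_pos h]
    exact norm_integral_biharmKernelIntegrand_le_of_pos hα h z hR

lemma norm_truncated_DbihamGroup_le {α t R : ℝ} (hα : α ∈ Set.Icc (0 : ℝ) 1) (ht : t ≠ 0)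
    (x : ℝ) (hR : 0 ≤ R) {u : ℝ → ℂ} (hu : Integrable u) :
    ‖∫ ξ in (-R)..R, ((|ξ| ^ α : ℝ) : ℂ) * exp (I * (x * ξ + t * ξ ^ 4)) * fourierInt u ξ‖ ≤
      14 * |t| ^ (-(α + 1) / 4) * ∫ y, ‖u y‖ := by
  have hle : -R ≤ R := by linarith
  have hcα := continuous_abs_rpow hα.1
  have hK : ∀ y ξ : ℝ, ((|ξ| ^ α : ℝ) : ℂ) * exp (I * (x * ξ + t * ξ ^ 4)) *
      (exp (-(I * y * ξ)) * u y) = biharmKernelIntegrand α t (x - y) ξ * u y := by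
    intro y ξ
    have : exp (I * ((((x - y) * ξ + t * ξ ^ 4 : ℝ)) : ℂ)) =
        exp (I * (x * ξ + t * ξ ^ 4)) * exp (-(I * y * ξ)) := by
      rw [← exp_add]; congr 1; push_cast; ring
    rw [biharmKernelIntegrand, this]; ring
  have hcont : ∀ z : ℝ, Continuous (biharmKernelIntegrand α t z) := by
    intro z; unfold biharmKernelIntegrand; fun_prop
  have hprod : Integrable (fun p : ℝ × ℝ => biharmKernelIntegrand α t (x - p.2) p.1 * u p.2)
      ((volume.restrict (Set.Ioc (-R) R)).prod volume) := by
    have h1 : Integrable (fun ξ : ℝ => biharmKernelIntegrand α t x ξ)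
        (volume.restrict (Set.Ioc (-R) R)) :=
      ((hcont x).integrableOn_Icc (a := -R) (b := R)).mono_set Set.Ioc_subset_Icc_self
    have h2 := h1.mul_prod hu
    have h3 := h2.bdd_mul (c := 1) (f := fun p : ℝ × ℝ => exp ((-(p.2 * p.1) : ℝ) * I))
      (by
        have : Continuous fun p : ℝ × ℝ => exp ((-(p.2 * p.1) : ℝ) * I) := by fun_prop
        exact this.aestronglyMeasurable)
      (Filter.Eventually.of_forall fun p => (norm_exp_ofReal_mul_I _).le)
    refine h3.congr (Filter.Eventually.of_forall fun p => ?_)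
    have : exp (I * ((((x - p.2) * p.1 + t * p.1 ^ 4 : ℝ)) : ℂ)) =
        exp (I * ((x * p.1 + t * p.1 ^ 4 : ℝ) : ℂ)) * exp ((-(p.2 * p.1) : ℝ) * I) := by
      rw [← exp_add]; congr 1; push_cast; ring
    simp only [biharmKernelIntegrand, this]
    ring
  have hswap : (∫ ξ in (-R)..R, ((|ξ| ^ α : ℝ) : ℂ) * exp (I * (x * ξ + t * ξ ^ 4)) *
      fourierInt u ξ) = ∫ y, (∫ ξ in (-R)..R, biharmKernelIntegrand α t (x - y) ξ) * u y := by
    simp_rw [fourierInt, ← integral_const_mul, hK, intervalIntegral.integral_of_le hle]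
    rw [integral_integral_swap hprod]
    simp_rw [integral_mul_const]
  rw [hswap, ← integral_const_mul]
  refine norm_integral_le_of_norm_le (hu.norm.const_mul _) (Filter.Eventually.of_forall fun y => ?_)
  rw [norm_mul]
  gcongr
  exact norm_integral_biharmKernelIntegrand_le hα ht _ hR

/-- Dispersive `L¹ → L^∞` estimate for the biharmonic Schrödinger group:
`|D^α e^{it∂_x⁴} u₀(x)| ≤ C_α |t|^{-(α+1)/4} ‖u₀‖_{L¹}`. -/
theorem stmt_2 :
    ∀ α : ℝ, α ∈ Set.Icc (0:ℝ) 1 →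
    ∃ C > (0:ℝ), ∀ u₀ : SchwartzMap ℝ ℂ, ∀ t : ℝ, t ≠ 0 → ∀ x : ℝ,
      ‖DbihamGroup α t (fun y => u₀ y) x‖ ≤
        C * |t| ^ (-(α + 1)/4) * ∫ y : ℝ, ‖u₀ y‖ := by
  intro α hα
  refine ⟨14, by norm_num, fun u₀ t ht x => ?_⟩
  have hpi : ‖((2 * Real.pi : ℂ))⁻¹‖ ≤ 1 := by
    rw [norm_inv]
    refine inv_le_one_of_one_le₀ ?_
    rw [norm_mul, norm_real, Real.norm_of_nonneg Real.pi_pos.le, RCLike.norm_ofNat]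
    linarith [Real.pi_gt_three]
  unfold DbihamGroup
  rw [norm_mul]
  refine (mul_le_of_le_one_left (norm_nonneg _) (by simpa using hpi)).trans ?_
  by_cases hint : Integrable fun ξ : ℝ => ((|ξ| ^ α : ℝ) : ℂ) *
    exp (I * (x * ξ + t * ξ ^ 4)) * fourierInt (fun y => u₀ y) ξ
  · have hlim := (intervalIntegral_tendsto_integral hint Filter.tendsto_neg_atTop_atBot
      Filter.tendsto_id).norm
    refine le_of_tendsto hlim ?_
    filter_upwards [Filter.eventually_ge_atTop 0] with R hR
    exact norm_truncated_DbihamGroup_le hα ht x hR u₀.integrable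
  · rw [integral_undef hint, norm_zero]
    positivity
end

section
/- There exists a constant C > 0 such that the following holds. Let N₁, N₂ ≥ 1 with 8N₁ ≤ N₂, and let φ₁, φ₂ be Schwartz functions on ℝ whose Fourier transforms are supported in {ξ : N₁/2 ≤ |ξ| ≤ 2N₁} and {ξ : N₂/2 ≤ |ξ| ≤ 2N₂}, respectively. Then ‖(e^{it∂_x⁴}φ₁)(e^{it∂_x⁴}φ₂)‖_{L²_{t,x}(ℝ×ℝ)} ≤ C N₂^{-3/2} ‖φ₁‖_{L²(ℝ)} ‖φ₂‖_{L²(ℝ)}. -/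
open MeasureTheory Complex
open scoped ENNReal

/-- `(e^{it∂_x⁴} u)(x) = (2π)⁻¹ ∫ e^{i(xξ+tξ⁴)} û(ξ) dξ`. -/
noncomputable def bihamGroup (t : ℝ) (u : ℝ → ℂ) (x : ℝ) : ℂ :=
  (2 * Real.pi)⁻¹ * ∫ ξ : ℝ, Complex.exp (Complex.I * (x * ξ + t * ξ^4)) * fourierInt u ξ

open scoped FourierTransform in
/-- Plancherel's theorem for the Fourier integral on `L¹ ∩ L²`. -/
theorem eLpNorm_fourier_eq {V : Type*} [NormedAddCommGroup V] [InnerProductSpace ℝ V]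
    [FiniteDimensional ℝ V] [MeasurableSpace V] [BorelSpace V] {f : V → ℂ}
    (hf : Integrable f) (hf2 : MemLp f 2) : eLpNorm (𝓕 f) 2 = eLpNorm f 2 := by
  have hL : Continuous fun p : V × V ↦ (innerₗ V) p.1 p.2 := continuous_inner
  have key : 𝓕 f =ᵐ[volume] (𝓕 (hf2.toLp f) : Lp ℂ 2 (volume : Measure V)) := by
    refine ae_eq_of_integral_contDiff_smul_eq ?_
      ((Lp.memLp _).locallyIntegrable (by norm_num)) ?_
    · exact (VectorFourier.fourierIntegral_continuous Real.continuous_fourierChar hL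
        hf).locallyIntegrable
    · intro g hg hgc
      have hg₁ : HasCompactSupport (Complex.ofRealCLM ∘ g) := hgc.comp_left rfl
      have hg₂ : ContDiff ℝ (⊤ : ℕ∞) (Complex.ofRealCLM ∘ g) := by fun_prop
      let G : SchwartzMap V ℂ := hg₁.toSchwartzMap hg₂
      have h1 := congrArg (fun T => T G) (Lp.fourier_toTemperedDistribution_eq (hf2.toLp f))
      simp only [TemperedDistribution.fourier_apply, Lp.toTemperedDistribution_apply] at h1
      have hGa : ∀ x, G x = (g x : ℂ) := fun x => rfl
      have h2 := VectorFourier.integral_fourierIntegral_smul_eq_flip (μ := volume)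
        (ν := volume) (L := innerₗ V) Real.continuous_fourierChar hL G.integrable hf
      rw [flip_innerₗ] at h2
      calc ∫ x, g x • 𝓕 f x = ∫ x, G x • 𝓕 f x := by
            simp [hGa]
        _ = ∫ x, (𝓕 G) x • f x := h2.symm
        _ = ∫ x, (𝓕 G) x • (hf2.toLp f) x := by
            refine integral_congr_ae ?_
            filter_upwards [hf2.coeFn_toLp] with x hx
            rw [hx]
        _ = _ := by rw [h1]; simp [hGa]
  rw [eLpNorm_congr_ae key, ← eLpNorm_congr_ae hf2.coeFn_toLp]
  have := Lp.norm_fourier_eq (hf2.toLp f)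
  rw [Lp.norm_def, Lp.norm_def] at this
  exact (ENNReal.toReal_eq_toReal_iff' (Lp.eLpNorm_ne_top _) (Lp.eLpNorm_ne_top _)).1 this

/-- Plancherel's theorem on `ℝ × ℝ` for functions in `L¹ ∩ L²`. -/
theorem eLpNorm_fourier_prod_eq {f : ℝ × ℝ → ℂ} (hf : Integrable f) (hf2 : MemLp f 2) :
    eLpNorm (fun p : ℝ × ℝ =>
      ∫ q : ℝ × ℝ, cexp (↑(-2 * Real.pi * (p.1 * q.1 + p.2 * q.2)) * I) * f q) 2 =
      eLpNorm f 2 := by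
  have hm := WithLp.volume_preserving_ofLp ℝ ℝ
  have hem : MeasurableEmbedding (@WithLp.ofLp 2 (ℝ × ℝ)) :=
    (MeasurableEquiv.toLp 2 (ℝ × ℝ)).symm.measurableEmbedding
  have h := eLpNorm_fourier_eq (f := f ∘ (@WithLp.ofLp 2 (ℝ × ℝ)))
    (hm.integrable_comp_of_integrable hf) (hf2.comp_measurePreserving hm)
  rw [eLpNorm_comp_measurePreserving hf2.1 hm] at h
  have h2 := hem.eLpNorm_map_measure (p := 2) (μ := volume) (g := fun p : ℝ × ℝ =>
      ∫ q : ℝ × ℝ, cexp (↑(-2 * Real.pi * (p.1 * q.1 + p.2 * q.2)) * I) * f q)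
  rw [hm.map_eq] at h2
  rw [← h, h2]
  congr 1
  ext p
  simp only [Function.comp_apply]
  rw [Real.fourier_eq', ← hm.integral_comp hem]
  simp [WithLp.prod_inner_apply, mul_comm]

/-- An `L²` bound for oscillatory integrals whose phase is an injective map with Jacobian bounded
from below. -/
theorem eLpNorm_setIntegral_exp_le {S : Set (ℝ × ℝ)} (hS : MeasurableSet S)
    {Φ : ℝ × ℝ → ℝ × ℝ} {Φ' : ℝ × ℝ → ℝ × ℝ →L[ℝ] ℝ × ℝ}
    (hΦ : ∀ x ∈ S, HasFDerivWithinAt Φ (Φ' x) S x) (hinj : Set.InjOn Φ S) {m : ℝ} (hm : 0 < m)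
    (hdet : ∀ x ∈ S, m ≤ |(Φ' x).det|) {g : ℝ × ℝ → ℂ} (hg : IntegrableOn g S)
    (hg2 : MemLp g 2 (volume.restrict S)) :
    eLpNorm (fun p : ℝ × ℝ => ∫ q in S,
      cexp (↑(-2 * Real.pi * (p.1 * (Φ q).1 + p.2 * (Φ q).2)) * I) * g q) 2 ≤
      ENNReal.ofReal (√m)⁻¹ * eLpNorm g 2 (volume.restrict S) := by
  have hT : MeasurableSet (Φ '' S) := measurable_image_of_fderivWithin hS hΦ hinj
  let G : ℝ × ℝ → ℂ := (Φ '' S).indicator fun y =>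
    |(Φ' (Function.invFunOn Φ S y)).det|⁻¹ • g (Function.invFunOn Φ S y)
  have hG : ∀ x ∈ S, G (Φ x) = |(Φ' x).det|⁻¹ • g x := by
    intro x hx
    simp only [G, Set.indicator_of_mem (Set.mem_image_of_mem Φ hx)]
    rw [hinj.leftInvOn_invFunOn hx]
  have hG0 : ∀ y, y ∉ Φ '' S → G y = 0 := fun y hy => Set.indicator_of_notMem hy _
  have hpos : ∀ x ∈ S, 0 < |(Φ' x).det| := fun x hx => hm.trans_le (hdet x hx)
  have hGint : Integrable G := by
    have : IntegrableOn G (Φ '' S) := by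
      rw [integrableOn_image_iff_integrableOn_abs_det_fderiv_smul volume hS hΦ hinj]
      refine hg.congr_fun (fun x hx => ?_) hS
      rw [hG x hx, smul_inv_smul₀ (hpos x hx).ne']
    exact this.integrable_of_forall_notMem_eq_zero hG0
  have hGnorm : eLpNorm G 2 ≤ ENNReal.ofReal (√m)⁻¹ * eLpNorm g 2 (volume.restrict S) := by
    have e1 := eLpNorm_nnreal_pow_eq_lintegral (f := G) (μ := volume) (p := 2) (by norm_num)
    have e2 := eLpNorm_nnreal_pow_eq_lintegral (f := g) (μ := volume.restrict S) (p := 2)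
      (by norm_num)
    norm_num at e1 e2
    rw [← ENNReal.pow_le_pow_left_iff two_ne_zero, mul_pow, e1, e2,
      ← setLIntegral_eq_of_support_subset (s := Φ '' S),
      lintegral_image_eq_lintegral_abs_det_fderiv_mul volume hS hΦ hinj,
      ← ENNReal.ofReal_pow (by positivity), ← lintegral_const_mul']
    · refine setLIntegral_mono' hS fun x hx => ?_
      have hp := hpos x hx
      rw [hG x hx, enorm_smul, mul_pow, ← mul_assoc, Real.enorm_eq_ofReal (by positivity),
        ← ENNReal.ofReal_pow (by positivity), ← ENNReal.ofReal_mul (by positivity)]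
      gcongr
      rw [inv_pow, inv_pow, Real.sq_sqrt hm.le, pow_two, mul_inv, mul_inv_cancel_left₀ hp.ne']
      exact inv_anti₀ hm (hdet x hx)
    · exact ENNReal.ofReal_ne_top
    · intro y hy
      by_contra h
      simp [hG0 y h] at hy
  have hG2 : MemLp G 2 :=
    ⟨hGint.1, hGnorm.trans_lt (ENNReal.mul_lt_top ENNReal.ofReal_lt_top hg2.2)⟩
  refine le_of_eq_of_le ?_ hGnorm
  rw [← eLpNorm_fourier_prod_eq hGint hG2]
  congr 1
  ext p
  rw [← setIntegral_eq_integral_of_forall_compl_eq_zero (μ := volume) (s := Φ '' S)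
      (f := fun q => cexp (↑(-2 * Real.pi * (p.1 * q.1 + p.2 * q.2)) * I) * G q)
      (fun y hy => by rw [hG0 y hy, mul_zero]),
    integral_image_eq_integral_abs_det_fderiv_smul volume hS hΦ hinj]
  refine setIntegral_congr_fun hS fun x hx => ?_
  rw [hG x hx, mul_smul_comm, smul_inv_smul₀ (hpos x hx).ne']

theorem det_prod_smul_fst_add_smul_snd (a b c d : ℝ) :
    ((a • ContinuousLinearMap.fst ℝ ℝ ℝ + b • ContinuousLinearMap.snd ℝ ℝ ℝ).prod
      (c • ContinuousLinearMap.fst ℝ ℝ ℝ + d • ContinuousLinearMap.snd ℝ ℝ ℝ)).det =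
      a * d - b * c := by
  rw [ContinuousLinearMap.det, ← LinearMap.det_toMatrix (Module.Basis.finTwoProd ℝ),
    Matrix.det_fin_two]
  simp [LinearMap.toMatrix_apply]

open scoped FourierTransform in
theorem fourierInt_eq_fourier (φ : SchwartzMap ℝ ℂ) :
    fourierInt (fun y => φ y) = fun ξ => (𝓕 φ) ((2 * Real.pi)⁻¹ * ξ) := by
  ext ξ
  rw [SchwartzMap.fourier_coe, Real.fourier_eq', fourierInt]
  congr 1
  ext x
  rw [smul_eq_mul]
  congr 2
  have : (Real.pi : ℂ) ≠ 0 := by exact_mod_cast Real.pi_ne_zero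
  simp
  field_simp

theorem continuous_fourierInt (φ : SchwartzMap ℝ ℂ) :
    Continuous (fourierInt (fun y => φ y)) := by
  rw [fourierInt_eq_fourier]
  exact (SchwartzMap.continuous _).comp (continuous_const.mul continuous_id)

theorem integrable_fourierInt (φ : SchwartzMap ℝ ℂ) :
    Integrable (fourierInt (fun y => φ y)) := by
  rw [fourierInt_eq_fourier]
  exact (SchwartzMap.integrable _).comp_mul_left' (by positivity)

open scoped FourierTransform in
/-- Plancherel's theorem for the non-unitary normalization of the Fourier transform. -/
theorem eLpNorm_fourierInt (φ : SchwartzMap ℝ ℂ) :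
    eLpNorm (fourierInt (fun y => φ y)) 2 =
      ENNReal.ofReal √(2 * Real.pi) * eLpNorm (fun y : ℝ => φ y) 2 := by
  have hpi := Real.pi_pos
  have hme : MeasurableEmbedding (fun ξ : ℝ => (2 * Real.pi)⁻¹ * ξ) :=
    (Homeomorph.mulLeft₀ (2 * Real.pi)⁻¹ (by positivity)).measurableEmbedding
  have h := hme.eLpNorm_map_measure (p := 2) (μ := volume) (g := (𝓕 φ : SchwartzMap ℝ ℂ))
  rw [Real.map_volume_mul_left (by positivity), eLpNorm_smul_measure_of_ne_top (by simp),
    inv_inv, abs_of_pos (by positivity)] at h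
  rw [fourierInt_eq_fourier]
  refine h.symm.trans ?_
  rw [SchwartzMap.fourier_coe, eLpNorm_fourier_eq φ.integrable (φ.memLp 2), smul_eq_mul]
  congr 1
  rw [ENNReal.ofReal_rpow_of_nonneg (by positivity) (by simp), Real.sqrt_eq_rpow]
  norm_num

theorem eLpNorm_prod_mul {f g : ℝ → ℂ} (hf : AEStronglyMeasurable f volume)
    (hg : AEStronglyMeasurable g volume) :
    eLpNorm (fun q : ℝ × ℝ => f q.1 * g q.2) 2 = eLpNorm f 2 * eLpNorm g 2 := by
  have e0 := eLpNorm_nnreal_pow_eq_lintegral (f := fun q : ℝ × ℝ => f q.1 * g q.2)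
    (μ := volume) (p := 2) (by norm_num)
  have e1 := eLpNorm_nnreal_pow_eq_lintegral (f := f) (μ := volume) (p := 2) (by norm_num)
  have e2 := eLpNorm_nnreal_pow_eq_lintegral (f := g) (μ := volume) (p := 2) (by norm_num)
  norm_num at e0 e1 e2
  refine (ENNReal.pow_right_strictMono two_ne_zero).injective ?_
  rw [mul_pow, e0, e1, e2]
  simp_rw [mul_pow]
  rw [Measure.volume_eq_prod]
  exact lintegral_prod_mul (hf.enorm.pow_const 2) (hg.enorm.pow_const 2)

/-- A product of two biharmonic evolutions as a single double oscillatory integral. -/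
theorem bihamGroup_mul_bihamGroup (t x : ℝ) (u v : ℝ → ℂ) :
    bihamGroup t u x * bihamGroup t v x = ((2 * Real.pi)⁻¹ ^ 2 : ℝ) *
      ∫ q : ℝ × ℝ, cexp (((-2 * Real.pi * (t * (-(2 * Real.pi)⁻¹ * (q.1 ^ 4 + q.2 ^ 4)) +
        x * (-(2 * Real.pi)⁻¹ * (q.1 + q.2))) : ℝ) : ℂ) * I) *
        (fourierInt u q.1 * fourierInt v q.2) := by
  have : (Real.pi : ℂ) ≠ 0 := by exact_mod_cast Real.pi_ne_zero
  rw [bihamGroup, bihamGroup, mul_mul_mul_comm, ← integral_prod_mul, Measure.volume_eq_prod]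
  congr 1
  · push_cast; ring
  · congr 1
    ext q
    rw [mul_mul_mul_comm, ← Complex.exp_add]
    congr 2
    push_cast
    field_simp
    ring

theorem injOn_sum_pow_four {S : Set (ℝ × ℝ)} (hlt : ∀ q ∈ S, |q.1| < |q.2|)
    (hsign : ∀ q ∈ S, ∀ r ∈ S, 0 < q.2 * r.2) {c : ℝ} (hc : c ≠ 0) :
    Set.InjOn (fun q : ℝ × ℝ => (c * (q.1 ^ 4 + q.2 ^ 4), c * (q.1 + q.2))) S := by
  intro q hq r hr h
  simp only [Prod.mk.injEq, mul_right_inj' hc] at h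
  obtain ⟨h4, h1⟩ := h
  have hpos : 0 < (q.2 - q.1) * (r.2 - r.1) := by
    have a := abs_lt.1 (hlt q hq)
    have b := abs_lt.1 (hlt r hr)
    rcases mul_pos_iff.1 (hsign q hq r hr) with ⟨hq2, hr2⟩ | ⟨hq2, hr2⟩
    · rw [abs_of_pos hq2] at a
      rw [abs_of_pos hr2] at b
      exact mul_pos (by linarith) (by linarith)
    · rw [abs_of_neg hq2] at a
      rw [abs_of_neg hr2] at b
      exact mul_pos_of_neg_of_neg (by linarith) (by linarith)
  have hprod : ((q.2 - q.1) ^ 2 - (r.2 - r.1) ^ 2) *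
      (6 * (q.1 + q.2) ^ 2 + (q.2 - q.1) ^ 2 + (r.2 - r.1) ^ 2) = 0 := by
    have hr1 : r.1 = q.1 + q.2 - r.2 := by linarith
    rw [hr1] at h4 ⊢
    linear_combination 8 * h4
  have hsq : (q.2 - q.1) ^ 2 = (r.2 - r.1) ^ 2 := by
    rcases mul_eq_zero.1 hprod with h | h
    · linarith
    · nlinarith [sq_nonneg (q.1 + q.2), sq_nonneg (q.2 - q.1), sq_nonneg (r.2 - r.1)]
  have hd : q.2 - q.1 = r.2 - r.1 := by
    rcases sq_eq_sq_iff_eq_or_eq_neg.1 hsq with h | h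
    · exact h
    · rw [h] at hpos
      nlinarith [sq_nonneg (r.2 - r.1)]
  exact Prod.ext (by linarith) (by linarith)

/-- The `L²` bound for the double oscillatory integral over a region of separated frequencies, on
which the second frequency has constant sign. -/
theorem eLpNorm_setIntegral_biharmonic_le {N₁ N₂ : ℝ} (hN₁ : 1 ≤ N₁) (hN : 8 * N₁ ≤ N₂)
    {S : Set (ℝ × ℝ)} (hS : MeasurableSet S)
    (hS₁ : ∀ q ∈ S, |q.1| ≤ 2 * N₁) (hS₂ : ∀ q ∈ S, N₂ / 2 ≤ |q.2|)
    (hsign : ∀ q ∈ S, ∀ r ∈ S, 0 < q.2 * r.2) {g : ℝ × ℝ → ℂ} (hg : Integrable g)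
    (hg2 : MemLp g 2) :
    eLpNorm (fun p : ℝ × ℝ => ∫ q in S,
      cexp (((-2 * Real.pi * (p.1 * (-(2 * Real.pi)⁻¹ * (q.1 ^ 4 + q.2 ^ 4)) +
        p.2 * (-(2 * Real.pi)⁻¹ * (q.1 + q.2))) : ℝ) : ℂ) * I) * g q) 2 ≤
      ENNReal.ofReal (4 * Real.pi * N₂ ^ (-(3 / 2) : ℝ)) * eLpNorm g 2 := by
  have hpi := Real.pi_pos
  have hN₂ : 0 < N₂ := by linarith
  set c : ℝ := -(2 * Real.pi)⁻¹ with hc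
  have hc0 : c ≠ 0 := by rw [hc]; exact neg_ne_zero.2 (by positivity)
  have hderiv : ∀ q ∈ S, HasFDerivWithinAt
      (fun q : ℝ × ℝ => (c * (q.1 ^ 4 + q.2 ^ 4), c * (q.1 + q.2)))
      (((c * (4 * q.1 ^ 3)) • ContinuousLinearMap.fst ℝ ℝ ℝ +
          (c * (4 * q.2 ^ 3)) • ContinuousLinearMap.snd ℝ ℝ ℝ).prod
        (c • ContinuousLinearMap.fst ℝ ℝ ℝ + c • ContinuousLinearMap.snd ℝ ℝ ℝ)) S q := by
    intro q _
    refine HasFDerivAt.hasFDerivWithinAt (HasFDerivAt.prodMk ?_ ?_)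
    · refine ((((hasFDerivAt_fst (p := q)).pow 4).add
        ((hasFDerivAt_snd (p := q)).pow 4)).const_mul c).congr_fderiv ?_
      ext <;> simp
    · refine (((hasFDerivAt_fst (p := q)).add
        (hasFDerivAt_snd (p := q))).const_mul c).congr_fderiv ?_
      ext <;> simp
  have hlt : ∀ q ∈ S, |q.1| < |q.2| := fun q hq => by linarith [hS₁ q hq, hS₂ q hq]
  have hm : 0 < N₂ ^ 3 / (4 * Real.pi) ^ 2 := by positivity
  have hdet : ∀ q ∈ S, N₂ ^ 3 / (4 * Real.pi) ^ 2 ≤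
      |(((c * (4 * q.1 ^ 3)) • ContinuousLinearMap.fst ℝ ℝ ℝ +
          (c * (4 * q.2 ^ 3)) • ContinuousLinearMap.snd ℝ ℝ ℝ).prod
        (c • ContinuousLinearMap.fst ℝ ℝ ℝ + c • ContinuousLinearMap.snd ℝ ℝ ℝ)).det| := by
    intro q hq
    have h1 : |q.1| ^ 3 ≤ (N₂ / 4) ^ 3 := by
      gcongr
      linarith [hS₁ q hq]
    have h2 : (N₂ / 2) ^ 3 ≤ |q.2| ^ 3 := by
      gcongr
      exact hS₂ q hq
    have h3 : |q.2| ^ 3 - |q.1| ^ 3 ≤ |q.1 ^ 3 - q.2 ^ 3| := by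
      rw [← abs_pow, ← abs_pow, abs_sub_comm]
      exact abs_sub_abs_le_abs_sub _ _
    have hN3 : 0 < N₂ ^ 3 := by positivity
    rw [det_prod_smul_fst_add_smul_snd,
      show c * (4 * q.1 ^ 3) * c - c * (4 * q.2 ^ 3) * c = c ^ 2 * (4 * (q.1 ^ 3 - q.2 ^ 3)) by
        ring, abs_mul, abs_mul, abs_of_nonneg (sq_nonneg c), abs_of_pos (four_pos (α := ℝ)),
      show N₂ ^ 3 / (4 * Real.pi) ^ 2 = c ^ 2 * (N₂ ^ 3 / 4) by rw [hc]; field_simp; norm_num]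
    gcongr
    nlinarith
  refine (eLpNorm_setIntegral_exp_le hS hderiv (injOn_sum_pow_four hlt hsign hc0) hm hdet
    hg.integrableOn (hg2.restrict S)).trans ?_
  gcongr
  · rw [Real.sqrt_div (by positivity), Real.sqrt_sq (by positivity), inv_div, div_eq_mul_inv,
      Real.rpow_neg hN₂.le, Real.sqrt_eq_rpow, ← Real.rpow_natCast, ← Real.rpow_mul hN₂.le]
    norm_num
  · exact Measure.restrict_le_self

/-- Bilinear Strichartz estimate: for frequency-localized data with `8N₁ ≤ N₂`,
`‖(e^{it∂_x⁴}φ₁)(e^{it∂_x⁴}φ₂)‖_{L²_{t,x}} ≤ C N₂^{-3/2} ‖φ₁‖_{L²} ‖φ₂‖_{L²}`. -/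
theorem stmt_7 :
    ∃ C > (0:ℝ), ∀ N₁ N₂ : ℝ, 1 ≤ N₁ → 1 ≤ N₂ → 8 * N₁ ≤ N₂ →
      ∀ φ₁ φ₂ : SchwartzMap ℝ ℂ,
        (Function.support (fourierInt (fun y => φ₁ y)) ⊆
          {ξ : ℝ | N₁ / 2 ≤ |ξ| ∧ |ξ| ≤ 2 * N₁}) →
        (Function.support (fourierInt (fun y => φ₂ y)) ⊆
          {ξ : ℝ | N₂ / 2 ≤ |ξ| ∧ |ξ| ≤ 2 * N₂}) →
        eLpNorm (fun p : ℝ × ℝ =>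
            bihamGroup p.1 (fun y => φ₁ y) p.2 * bihamGroup p.1 (fun y => φ₂ y) p.2)
            2 volume ≤
          ENNReal.ofReal (C * N₂ ^ (-(3/2) : ℝ)) *
            eLpNorm (fun y : ℝ => φ₁ y) 2 volume * eLpNorm (fun y : ℝ => φ₂ y) 2 volume := by
  have hpi := Real.pi_pos
  refine ⟨4, by norm_num, fun N₁ N₂ hN₁ hN₂ hN φ₁ φ₂ h₁ h₂ => ?_⟩
  let g : ℝ × ℝ → ℂ := fun q => fourierInt (fun y => φ₁ y) q.1 * fourierInt (fun y => φ₂ y) q.2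
  have hgint : Integrable g := (integrable_fourierInt φ₁).mul_prod (integrable_fourierInt φ₂)
  have hgnorm : eLpNorm g 2 = ENNReal.ofReal (2 * Real.pi) *
      (eLpNorm (fun y : ℝ => φ₁ y) 2 * eLpNorm (fun y : ℝ => φ₂ y) 2) := by
    rw [eLpNorm_prod_mul (continuous_fourierInt φ₁).aestronglyMeasurable
      (continuous_fourierInt φ₂).aestronglyMeasurable, eLpNorm_fourierInt, eLpNorm_fourierInt,
      mul_mul_mul_comm, ← ENNReal.ofReal_mul (by positivity), Real.mul_self_sqrt (by positivity)]
  have hg2 : MemLp g 2 := by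
    refine ⟨hgint.1, ?_⟩
    rw [hgnorm]
    exact ENNReal.mul_lt_top ENNReal.ofReal_lt_top (ENNReal.mul_lt_top
      (φ₁.memLp 2 volume).eLpNorm_lt_top (φ₂.memLp 2 volume).eLpNorm_lt_top)
  let S : Set (ℝ × ℝ) := {q | |q.1| ≤ 2 * N₁} ∩ {q | N₂ / 2 ≤ q.2}
  let T : Set (ℝ × ℝ) := {q | |q.1| ≤ 2 * N₁} ∩ {q | N₂ / 2 ≤ -q.2}
  have hS : MeasurableSet S := by
    refine MeasurableSet.inter (measurableSet_le ?_ ?_) (measurableSet_le ?_ ?_) <;> fun_prop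
  have hT : MeasurableSet T := by
    refine MeasurableSet.inter (measurableSet_le ?_ ?_) (measurableSet_le ?_ ?_) <;> fun_prop
  have hS₂ : ∀ q ∈ S, N₂ / 2 ≤ q.2 := fun _ hq => hq.2
  have hT₂ : ∀ q ∈ T, N₂ / 2 ≤ -q.2 := fun _ hq => hq.2
  have hST : Disjoint S T := by
    refine Set.disjoint_left.2 fun q hq hq' => ?_
    linarith [hS₂ q hq, hT₂ q hq']
  have hsupp : ∀ q, q ∉ S ∪ T → g q = 0 := by
    intro q hq
    by_contra h
    have hq1 := h₁ (left_ne_zero_of_mul h)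
    have hq2 := h₂ (right_ne_zero_of_mul h)
    refine hq ((le_abs.1 hq2.1).imp (fun h => ⟨hq1.2, h⟩) (fun h => ⟨hq1.2, h⟩))
  let e : ℝ × ℝ → ℝ × ℝ → ℂ := fun p q =>
    cexp (((-2 * Real.pi * (p.1 * (-(2 * Real.pi)⁻¹ * (q.1 ^ 4 + q.2 ^ 4)) +
      p.2 * (-(2 * Real.pi)⁻¹ * (q.1 + q.2))) : ℝ) : ℂ) * I)
  have he : ∀ p, Integrable fun q => e p q * g q := by
    intro p
    refine hgint.bdd_mul (c := 1) (Continuous.aestronglyMeasurable (by fun_prop)) ?_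
    exact Filter.Eventually.of_forall fun q => (Complex.norm_exp_ofReal_mul_I _).le
  have hsplit : (fun p : ℝ × ℝ =>
      bihamGroup p.1 (fun y => φ₁ y) p.2 * bihamGroup p.1 (fun y => φ₂ y) p.2) =
      (((2 * Real.pi)⁻¹ ^ 2 : ℝ) : ℂ) •
        ((fun p => ∫ q in S, e p q * g q) + fun p => ∫ q in T, e p q * g q) := by
    ext p
    rw [bihamGroup_mul_bihamGroup, Pi.smul_apply, Pi.add_apply, smul_eq_mul,
      ← setIntegral_union hST hT (he p).integrableOn (he p).integrableOn,
      setIntegral_eq_integral_of_forall_compl_eq_zero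
        (fun q hq => by rw [hsupp q hq, mul_zero])]
  have hmeas : ∀ U : Set (ℝ × ℝ), AEStronglyMeasurable (fun p => ∫ q in U, e p q * g q) := by
    intro U
    refine (continuous_of_dominated (bound := fun q => ‖g q‖) (fun p => (he p).1.restrict)
      (fun p => Filter.Eventually.of_forall fun q => ?_) hgint.norm.restrict
      (Filter.Eventually.of_forall fun q => by fun_prop)).aestronglyMeasurable
    rw [norm_mul, Complex.norm_exp_ofReal_mul_I, one_mul]
  have hSle := eLpNorm_setIntegral_biharmonic_le hN₁ hN hS (fun q hq => hq.1)
    (fun q hq => (hS₂ q hq).trans (le_abs_self _))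
    (fun q hq r hr => mul_pos (by linarith [hS₂ q hq]) (by linarith [hS₂ r hr])) hgint hg2
  have hTle := eLpNorm_setIntegral_biharmonic_le hN₁ hN hT (fun q hq => hq.1)
    (fun q hq => (hT₂ q hq).trans (neg_le_abs _))
    (fun q hq r hr => mul_pos_of_neg_of_neg (by linarith [hT₂ q hq]) (by linarith [hT₂ r hr]))
    hgint hg2
  rw [hsplit, eLpNorm_const_smul]
  refine (mul_le_mul_right ((eLpNorm_add_le (hmeas S) (hmeas T) one_le_two).trans
    (add_le_add hSle hTle)) _).trans (le_of_eq ?_)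
  rw [hgnorm, ← two_mul, ← ofReal_norm, Complex.norm_of_nonneg (by positivity),
    mul_assoc (ENNReal.ofReal (4 * _))]
  simp only [← mul_assoc]
  congr 2
  rw [← ENNReal.ofReal_ofNat 2, ← ENNReal.ofReal_mul (by positivity),
    ← ENNReal.ofReal_mul (by positivity), ← ENNReal.ofReal_mul (by positivity)]
  congr 1
  field_simp
end

section
/- Let ξ₁, ξ₂, ξ₃, ξ₄ ∈ ℝ with ξ₁ + ξ₂ + ξ₃ + ξ₄ = 0 and τ₁, τ₂, τ₃, τ₄ ∈ ℝ with τ₁ + τ₂ + τ₃ + τ₄ = 0. Then |τ₁ + ξ₁⁴| + |τ₂ − ξ₂⁴| + |τ₃ + ξ₃⁴| + |τ₄ − ξ₄⁴| ≥ |(ξ₁ + ξ₂)(ξ₂ + ξ₃)(ξ₁² + ξ₂² + ξ₃² + (ξ₁ + ξ₂ + ξ₃)² + 2(ξ₁ + ξ₃)²)|. -/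
/-- Resonance lower bound on the hyperplane `ξ₁+ξ₂+ξ₃+ξ₄ = 0`, `τ₁+τ₂+τ₃+τ₄ = 0`:
`|τ₁+ξ₁⁴| + |τ₂−ξ₂⁴| + |τ₃+ξ₃⁴| + |τ₄−ξ₄⁴|
  ≥ |(ξ₁+ξ₂)(ξ₂+ξ₃)(ξ₁²+ξ₂²+ξ₃²+(ξ₁+ξ₂+ξ₃)²+2(ξ₁+ξ₃)²)|`. -/
theorem stmt_8 (ξ₁ ξ₂ ξ₃ ξ₄ τ₁ τ₂ τ₃ τ₄ : ℝ)
    (hξ : ξ₁ + ξ₂ + ξ₃ + ξ₄ = 0) (hτ : τ₁ + τ₂ + τ₃ + τ₄ = 0) :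
    |τ₁ + ξ₁^4| + |τ₂ - ξ₂^4| + |τ₃ + ξ₃^4| + |τ₄ - ξ₄^4| ≥
      |(ξ₁ + ξ₂) * (ξ₂ + ξ₃) *
        (ξ₁^2 + ξ₂^2 + ξ₃^2 + (ξ₁ + ξ₂ + ξ₃)^2 + 2 * (ξ₁ + ξ₃)^2)| := by
  have hres : (ξ₁ + ξ₂) * (ξ₂ + ξ₃) *
      (ξ₁^2 + ξ₂^2 + ξ₃^2 + (ξ₁ + ξ₂ + ξ₃)^2 + 2 * (ξ₁ + ξ₃)^2) =
      -((τ₁ + ξ₁^4) + (τ₂ - ξ₂^4) + (τ₃ + ξ₃^4) + (τ₄ - ξ₄^4)) := by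
    obtain rfl : ξ₄ = -(ξ₁ + ξ₂ + ξ₃) := by linarith
    linear_combination hτ
  rw [hres, abs_neg]
  calc |(τ₁ + ξ₁^4) + (τ₂ - ξ₂^4) + (τ₃ + ξ₃^4) + (τ₄ - ξ₄^4)|
      ≤ |(τ₁ + ξ₁^4) + (τ₂ - ξ₂^4) + (τ₃ + ξ₃^4)| + |τ₄ - ξ₄^4| := abs_add_le _ _
    _ ≤ |τ₁ + ξ₁^4| + |τ₂ - ξ₂^4| + |τ₃ + ξ₃^4| + |τ₄ - ξ₄^4| := by
        gcongr
        exact abs_add_three _ _ _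
end

section
/- Let s ≥ −1/2 and 1/2 < b ≤ 5/6. Then there exists a constant C > 0 such that for all smooth compactly supported functions u₁, u₂, u₃ : ℝ_t × ℝ_x → ℂ whose supports are contained in {(t,x) : |t| ≤ 2}, one has ‖u₁ · conj(u₂) · u₃‖_{X^{s,b−1}} ≤ C ‖u₁‖_{X^{s,b}} ‖u₂‖_{X^{s,b}} ‖u₃‖_{X^{s,b}}, where conj denotes complex conjugation. -/
open MeasureTheory Complex
open scoped ENNReal

/-- The space-time Fourier transform `ũ(τ,ξ) = ∫∫ e^{-i(tτ+xξ)} u(t,x) dt dx`. -/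
noncomputable def spaceTimeFT (u : ℝ × ℝ → ℂ) (τ ξ : ℝ) : ℂ :=
  ∫ p : ℝ × ℝ, Complex.exp (-(Complex.I * (p.1 * τ + p.2 * ξ))) * u p

/-- The Bourgain norm `‖u‖_{X^{s,b}} = ‖⟨ξ⟩^s ⟨τ+ξ⁴⟩^b ũ(τ,ξ)‖_{L²_{τ,ξ}}`,
where `⟨x⟩ = (1+x²)^{1/2}`. -/
noncomputable def Xnorm (s b : ℝ) (u : ℝ × ℝ → ℂ) : ℝ≥0∞ :=
  eLpNorm (fun q : ℝ × ℝ =>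
    (((1 + q.2^2) ^ (s/2) * (1 + (q.1 + q.2^4)^2) ^ (b/2) : ℝ) : ℂ) *
      spaceTimeFT u q.1 q.2) 2 volume

/-- The resonance function of the quartic dispersion factorizes on `ξ₄ = ξ₁ - ξ₂ + ξ₃`, and is
bounded below in terms of the frequency separations. -/
lemma resonance_bound {a b c d : ℝ} (h : d = a - b + c) :
    (a - b) ^ 2 * (b - c) ^ 2 * (a ^ 2 + b ^ 2 + c ^ 2 + d ^ 2) ^ 2 ≤
      (a ^ 4 - b ^ 4 + c ^ 4 - d ^ 4) ^ 2 := by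
  have hfac : a ^ 4 - b ^ 4 + c ^ 4 - d ^ 4 =
      (a - b) * (b - c) * ((a ^ 2 + b ^ 2 + c ^ 2 + d ^ 2) + 2 * (a + c) ^ 2) := by
    subst h; ring
  rw [hfac, mul_pow, mul_pow]
  refine mul_le_mul_of_nonneg_left (pow_le_pow_left₀ (by positivity) ?_ 2) (by positivity)
  nlinarith [sq_nonneg (a + c)]

private lemma frequency_weight_aux {S P Q F D : ℝ} (hS : 0 ≤ S) (hP : 0 ≤ P) (hQ : 0 ≤ Q)
    (hF : 0 ≤ F) (hD : 1 ≤ D) (hQP : Q ≤ P) (hres : P * Q * S ^ 2 ≤ F)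
    (hclose : 100 * P < S → 1 + S ≤ 10 * D) :
    (1 + S) ^ 9 * Q ≤ 100000 * (1 + S) ^ 6 * P * (1 + F) * D ^ 3 := by
  have hD3 : 1 ≤ D ^ 3 := one_le_pow₀ hD
  have hD0 : 0 ≤ D := by linarith
  by_cases hcase : 100 * P < S
  · have h4 := hclose hcase
    have h5 : (1 + S) ^ 3 ≤ 1000 * D ^ 3 := by
      have := pow_le_pow_left₀ (by linarith) h4 3
      linarith [mul_pow 10 D 3]
    calc (1 + S) ^ 9 * Q = ((1 + S) ^ 6 * Q) * (1 + S) ^ 3 := by ring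
      _ ≤ ((1 + S) ^ 6 * P) * (1000 * D ^ 3) := by gcongr
      _ = (1000 * (1 + S) ^ 6 * P) * 1 * D ^ 3 := by ring
      _ ≤ (100000 * (1 + S) ^ 6 * P) * (1 + F) * D ^ 3 := by
          gcongr
          · norm_num
          · linarith
  · push Not at hcase
    have key : (1 + S) ^ 3 * Q ≤ 100000 * (P * (1 + F)) := by
      have hPF := mul_nonneg hP hF
      by_cases hS1 : S ≤ 1
      · have h1 : (1 + S) ^ 3 ≤ 8 := by
          have := pow_le_pow_left₀ (by linarith) (by linarith : 1 + S ≤ 2) 3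
          linarith
        have h2 : (1 + S) ^ 3 * Q ≤ 8 * P := by gcongr
        linarith
      · push Not at hS1
        have h1 : (1 + S) ^ 3 ≤ 8 * S ^ 4 := by
          calc (1 + S) ^ 3 ≤ (S + S) ^ 3 := by gcongr
            _ = 8 * S ^ 3 * 1 := by ring
            _ ≤ 8 * S ^ 3 * S := by gcongr
            _ = _ := by ring
        have h2 : S ^ 4 * Q ≤ 10000 * (P * F) := by
          have h3 : S ^ 2 ≤ (100 * P) ^ 2 := by gcongr
          calc S ^ 4 * Q = S ^ 2 * (Q * S ^ 2) := by ring
            _ ≤ (100 * P) ^ 2 * (Q * S ^ 2) := by gcongr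
            _ = 10000 * (P * (P * Q * S ^ 2)) := by ring
            _ ≤ _ := by gcongr
        have h3 : (1 + S) ^ 3 * Q ≤ 8 * S ^ 4 * Q := by gcongr
        linarith
    calc (1 + S) ^ 9 * Q = (1 + S) ^ 6 * ((1 + S) ^ 3 * Q) * 1 := by ring
      _ ≤ (1 + S) ^ 6 * (100000 * (P * (1 + F))) * D ^ 3 := by gcongr
      _ = _ := by ring

lemma frequency_weight_pow_bound {a b c d : ℝ} (h : d = a - b + c)
    (hac : (b - c) ^ 2 ≤ (a - b) ^ 2) :
    ((1 + a ^ 2) * (1 + b ^ 2) * (1 + c ^ 2)) ^ 3 * (b - c) ^ 2 ≤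
      100000 * (1 + (a ^ 2 + b ^ 2 + c ^ 2 + d ^ 2)) ^ 6 * (a - b) ^ 2 *
        (1 + (a ^ 4 - b ^ 4 + c ^ 4 - d ^ 4) ^ 2) * (1 + d ^ 2) ^ 3 := by
  have hres := resonance_bound h
  have hprod : ((1 + a ^ 2) * (1 + b ^ 2) * (1 + c ^ 2)) ^ 3 ≤
      (1 + (a ^ 2 + b ^ 2 + c ^ 2 + d ^ 2)) ^ 9 := by
    calc ((1 + a ^ 2) * (1 + b ^ 2) * (1 + c ^ 2)) ^ 3
        ≤ ((1 + (a ^ 2 + b ^ 2 + c ^ 2 + d ^ 2)) * (1 + (a ^ 2 + b ^ 2 + c ^ 2 + d ^ 2)) *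
          (1 + (a ^ 2 + b ^ 2 + c ^ 2 + d ^ 2))) ^ 3 := by
          gcongr <;> linarith [sq_nonneg a, sq_nonneg b, sq_nonneg c, sq_nonneg d]
      _ = (1 + (a ^ 2 + b ^ 2 + c ^ 2 + d ^ 2)) ^ 9 := by ring
  refine (mul_le_mul_of_nonneg_right hprod (sq_nonneg _)).trans ?_
  refine frequency_weight_aux (by positivity) (sq_nonneg _) (sq_nonneg _) (sq_nonneg _)
    (by linarith [sq_nonneg d]) hac hres fun hcase ↦ ?_
  have hSid : a ^ 2 + b ^ 2 + c ^ 2 + d ^ 2 = (a + c) ^ 2 + (a - b) ^ 2 + (b - c) ^ 2 := by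
    rw [h]; ring
  have hdid : 2 * d ^ 2 + (a - b) ^ 2 + (b - c) ^ 2 - (a + c) ^ 2 / 4 =
      ((a + c) / 2 + (a - 2 * b + c)) ^ 2 + ((a - b) + (b - c)) ^ 2 / 2 := by
    rw [h]; ring
  linarith [sq_nonneg ((a + c) / 2 + (a - 2 * b + c)), sq_nonneg ((a - b) + (b - c)),
    sq_nonneg (a - b)]

/-- The frequency part of the multiplier bound, for `s = -1/2`. -/
lemma frequency_weight_bound {a b c d : ℝ} (h : d = a - b + c) (hab : a ≠ b) (hbc : b ≠ c)
    (hac : |b - c| ≤ |a - b|) :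
    ((1 + a ^ 2) * (1 + b ^ 2) * (1 + c ^ 2)) ^ (1 / 2 : ℝ) * (1 + d ^ 2) ^ (-(1 / 2) : ℝ) *
        (1 + (a ^ 4 - b ^ 4 + c ^ 4 - d ^ 4) ^ 2) ^ (-(1 / 6) : ℝ) ≤
      100000 ^ (1 / 6 : ℝ) * ((|b - c| ^ (-(1 / 3) : ℝ) * |a - b| ^ (-(2 / 3) : ℝ)) *
        (|a - b| * (1 + (a ^ 2 + b ^ 2 + c ^ 2 + d ^ 2)))) := by
  have key := frequency_weight_pow_bound h (sq_le_sq.mpr hac)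
  have hp : 0 < |a - b| := abs_pos.mpr (sub_ne_zero.mpr hab)
  have hq : 0 < |b - c| := abs_pos.mpr (sub_ne_zero.mpr hbc)
  rw [← sq_abs (b - c), ← sq_abs (a - b)] at key
  set p := |a - b|
  set q := |b - c|
  set S := a ^ 2 + b ^ 2 + c ^ 2 + d ^ 2
  have hS0 : 0 ≤ S := by positivity
  set L := (1 + a ^ 2) * (1 + b ^ 2) * (1 + c ^ 2) with hL
  have hL0 : 0 < L := by positivity
  set D := 1 + d ^ 2 with hD
  have hD0 : 0 < D := by positivity
  set M := 1 + (a ^ 4 - b ^ 4 + c ^ 4 - d ^ 4) ^ 2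
  have hM0 : 0 < M := by positivity
  have root := Real.rpow_le_rpow (by positivity) key (by norm_num : (0 : ℝ) ≤ 1 / 6)
  have e1 : (L ^ 3 * q ^ 2) ^ (1 / 6 : ℝ) = L ^ (1 / 2 : ℝ) * q ^ (1 / 3 : ℝ) := by
    rw [Real.mul_rpow (by positivity) (by positivity), ← Real.rpow_natCast,
      ← Real.rpow_natCast, ← Real.rpow_mul hL0.le, ← Real.rpow_mul hq.le]
    norm_num
  have e2 : (100000 * (1 + S) ^ 6 * p ^ 2 * M * D ^ 3) ^ (1 / 6 : ℝ) =
      100000 ^ (1 / 6 : ℝ) * (1 + S) * p ^ (1 / 3 : ℝ) * M ^ (1 / 6 : ℝ) * D ^ (1 / 2 : ℝ) := by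
    rw [Real.mul_rpow (by positivity) (by positivity), Real.mul_rpow (by positivity) (by positivity),
      Real.mul_rpow (by positivity) (by positivity), Real.mul_rpow (by positivity) (by positivity),
      ← Real.rpow_natCast, ← Real.rpow_natCast, ← Real.rpow_natCast, ← Real.rpow_mul (by positivity),
      ← Real.rpow_mul hp.le, ← Real.rpow_mul hD0.le]
    norm_num
  rw [e1, e2] at root
  have e3 : p ^ (-(2 / 3) : ℝ) * p = p ^ (1 / 3 : ℝ) := by
    rw [← Real.rpow_add_one hp.ne']; norm_num
  have hqq : q ^ (-(1 / 3) : ℝ) * q ^ (1 / 3 : ℝ) = 1 := by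
    rw [← Real.rpow_add hq]; norm_num
  have hMM : M ^ (-(1 / 6) : ℝ) * M ^ (1 / 6 : ℝ) = 1 := by
    rw [← Real.rpow_add hM0]; norm_num
  have hDD : D ^ (-(1 / 2) : ℝ) * D ^ (1 / 2 : ℝ) = 1 := by
    rw [← Real.rpow_add hD0]; norm_num
  calc L ^ (1 / 2 : ℝ) * D ^ (-(1 / 2) : ℝ) * M ^ (-(1 / 6) : ℝ)
      = (L ^ (1 / 2 : ℝ) * q ^ (1 / 3 : ℝ)) *
        (D ^ (-(1 / 2) : ℝ) * M ^ (-(1 / 6) : ℝ) * q ^ (-(1 / 3) : ℝ)) := by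
        linear_combination (-(L ^ (1 / 2 : ℝ) * D ^ (-(1 / 2) : ℝ) * M ^ (-(1 / 6) : ℝ))) * hqq
    _ ≤ (100000 ^ (1 / 6 : ℝ) * (1 + S) * p ^ (1 / 3 : ℝ) * M ^ (1 / 6 : ℝ) * D ^ (1 / 2 : ℝ)) *
        (D ^ (-(1 / 2) : ℝ) * M ^ (-(1 / 6) : ℝ) * q ^ (-(1 / 3) : ℝ)) := by gcongr
    _ = (100000 ^ (1 / 6 : ℝ) * (1 + S) * p ^ (1 / 3 : ℝ) * q ^ (-(1 / 3) : ℝ)) *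
        ((M ^ (-(1 / 6) : ℝ) * M ^ (1 / 6 : ℝ)) * (D ^ (-(1 / 2) : ℝ) * D ^ (1 / 2 : ℝ))) := by ring
    _ = _ := by rw [hMM, hDD, ← e3]; ring

/-- Any regularity `s ≥ -1/2` reduces to `s = -1/2`. -/
lemma regularity_reduction {s a b c d : ℝ} (hs : -(1 / 2) ≤ s) (h : d = a - b + c) :
    (1 + d ^ 2) ^ s * ((1 + a ^ 2) * (1 + b ^ 2) * (1 + c ^ 2)) ^ (-s) ≤
      3 ^ (s + 1 / 2) * (((1 + a ^ 2) * (1 + b ^ 2) * (1 + c ^ 2)) ^ (1 / 2 : ℝ) *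
        (1 + d ^ 2) ^ (-(1 / 2) : ℝ)) := by
  have key : 1 + d ^ 2 ≤ 3 * ((1 + a ^ 2) * (1 + b ^ 2) * (1 + c ^ 2)) := by
    subst h
    have h1 : (a - b + c) ^ 2 ≤ 3 * (a ^ 2 + b ^ 2 + c ^ 2) := by
      nlinarith [sq_nonneg (a + b), sq_nonneg (b + c), sq_nonneg (a - c)]
    have h2 : 0 ≤ a ^ 2 * b ^ 2 + a ^ 2 * c ^ 2 + b ^ 2 * c ^ 2 + a ^ 2 * b ^ 2 * c ^ 2 := by
      positivity
    nlinarith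
  set L := (1 + a ^ 2) * (1 + b ^ 2) * (1 + c ^ 2)
  have hL0 : 0 < L := by positivity
  set D := 1 + d ^ 2
  have hD0 : 0 < D := by positivity
  have h1 := Real.rpow_le_rpow hD0.le key (by linarith : (0 : ℝ) ≤ s + 1 / 2)
  rw [Real.mul_rpow (by norm_num) hL0.le] at h1
  calc D ^ s * L ^ (-s) = D ^ (s + 1 / 2) * (D ^ (-(1 / 2) : ℝ) * L ^ (-s)) := by
        rw [← mul_assoc, ← Real.rpow_add hD0]; congr 2; ring
    _ ≤ (3 ^ (s + 1 / 2) * L ^ (s + 1 / 2)) * (D ^ (-(1 / 2) : ℝ) * L ^ (-s)) := by gcongr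
    _ = 3 ^ (s + 1 / 2) * (L ^ (s + 1 / 2) * L ^ (-s) * D ^ (-(1 / 2) : ℝ)) := by ring
    _ = _ := by rw [← Real.rpow_add hL0]; congr 4; ring

/-- The modulation part of the multiplier bound: the largest modulation controls the
resonance function. -/
lemma modulation_weight_bound {b x₁ x₂ x₃ x₄ Φ : ℝ} (hb1 : 1 / 2 < b) (hb2 : b ≤ 5 / 6)
    (hΦ : Φ = x₁ - x₂ + x₃ - x₄) :
    (1 + x₄ ^ 2) ^ (b - 1) *
        ((1 + x₁ ^ 2) ^ (-b) * (1 + x₂ ^ 2) ^ (-b) * (1 + x₃ ^ 2) ^ (-b)) ≤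
      16 ^ (1 / 6 : ℝ) * ((1 + Φ ^ 2) ^ (-(1 / 6) : ℝ) *
        ((1 + x₁ ^ 2) ^ (-b) * (1 + x₂ ^ 2) ^ (-b) * ((1 + x₃ ^ 2) ^ (-b) + (1 + x₄ ^ 2) ^ (-b)) +
        (1 + x₃ ^ 2) ^ (-b) * (1 + x₄ ^ 2) ^ (-b) *
          ((1 + x₁ ^ 2) ^ (-b) + (1 + x₂ ^ 2) ^ (-b)))) := by
  have hbase : ∀ M : ℝ, 1 + x₁ ^ 2 ≤ M → 1 + x₂ ^ 2 ≤ M → 1 + x₃ ^ 2 ≤ M → 1 + x₄ ^ 2 ≤ M →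
      M ^ (b - 1) ≤ 16 ^ (1 / 6 : ℝ) * (1 + Φ ^ 2) ^ (-(1 / 6) : ℝ) := by
    intro M h1 h2 h3 h4
    have hM1 : 1 ≤ M := by nlinarith [sq_nonneg x₁]
    have hle : 1 + Φ ^ 2 ≤ 16 * M := by
      subst hΦ
      nlinarith [sq_nonneg (x₁ + x₂), sq_nonneg (x₁ - x₃), sq_nonneg (x₁ + x₄),
        sq_nonneg (x₂ + x₃), sq_nonneg (x₂ - x₄), sq_nonneg (x₃ + x₄)]
    calc M ^ (b - 1) ≤ M ^ (-(1 / 6) : ℝ) :=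
          Real.rpow_le_rpow_of_exponent_le hM1 (by linarith)
      _ = 16 ^ (1 / 6 : ℝ) * (16 * M) ^ (-(1 / 6) : ℝ) := by
          rw [Real.mul_rpow (by norm_num) (by linarith), ← mul_assoc,
            ← Real.rpow_add (by norm_num)]; norm_num
      _ ≤ _ := by
          gcongr 16 ^ (1 / 6 : ℝ) * ?_
          exact Real.rpow_le_rpow_of_nonpos (by positivity) hle (by norm_num)
  have hswap : ∀ x y : ℝ, 1 ≤ y → y ≤ x → y ^ (b - 1) * x ^ (-b) ≤ x ^ (b - 1) * y ^ (-b) := by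
    intro x y hy hxy
    have hy0 : 0 < y := by linarith
    have hx0 : 0 < x := by linarith
    have h1 := Real.rpow_le_rpow hy0.le hxy (by linarith : 0 ≤ 2 * b - 1)
    calc y ^ (b - 1) * x ^ (-b) = y ^ (2 * b - 1) * (y ^ (-b) * x ^ (-b)) := by
          rw [← mul_assoc, ← Real.rpow_add hy0]; congr 2; ring
      _ ≤ x ^ (2 * b - 1) * (y ^ (-b) * x ^ (-b)) := by gcongr
      _ = x ^ (2 * b - 1) * x ^ (-b) * y ^ (-b) := by ring
      _ = _ := by rw [← Real.rpow_add hx0]; congr 2; ring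
  have h1 : 1 ≤ 1 + x₁ ^ 2 := by nlinarith [sq_nonneg x₁]
  have h2 : 1 ≤ 1 + x₂ ^ 2 := by nlinarith [sq_nonneg x₂]
  have h3 : 1 ≤ 1 + x₃ ^ 2 := by nlinarith [sq_nonneg x₃]
  have h4 : 1 ≤ 1 + x₄ ^ 2 := by nlinarith [sq_nonneg x₄]
  set X₁ := 1 + x₁ ^ 2
  set X₂ := 1 + x₂ ^ 2
  set X₃ := 1 + x₃ ^ 2
  set X₄ := 1 + x₄ ^ 2
  set R := 16 ^ (1 / 6 : ℝ) * (1 + Φ ^ 2) ^ (-(1 / 6) : ℝ)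
  have hR : 0 ≤ R := by positivity
  have p1 : 0 ≤ X₁ ^ (-b) := by positivity
  have p2 : 0 ≤ X₂ ^ (-b) := by positivity
  have p3 : 0 ≤ X₃ ^ (-b) := by positivity
  have p4 : 0 ≤ X₄ ^ (-b) := by positivity
  have n1 := mul_nonneg hR (mul_nonneg (mul_nonneg p2 p3) p4)
  have n2 := mul_nonneg hR (mul_nonneg (mul_nonneg p1 p3) p4)
  have n3 := mul_nonneg hR (mul_nonneg (mul_nonneg p1 p2) p4)
  have n4 := mul_nonneg hR (mul_nonneg (mul_nonneg p1 p2) p3)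
  rw [← mul_assoc (16 ^ (1 / 6 : ℝ))]
  have hmax : (X₁ ≤ X₄ ∧ X₂ ≤ X₄ ∧ X₃ ≤ X₄) ∨ (X₄ ≤ X₁ ∧ X₂ ≤ X₁ ∧ X₃ ≤ X₁) ∨
      (X₁ ≤ X₂ ∧ X₃ ≤ X₂ ∧ X₄ ≤ X₂) ∨ (X₁ ≤ X₃ ∧ X₂ ≤ X₃ ∧ X₄ ≤ X₃) := by grind
  rcases hmax with ⟨ha, hb, hc⟩ | ⟨ha, hb, hc⟩ | ⟨ha, hb, hc⟩ | ⟨ha, hb, hc⟩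
  · have := mul_le_mul_of_nonneg_right (hbase X₄ ha hb hc le_rfl) (mul_nonneg (mul_nonneg p1 p2) p3)
    linarith
  · have := mul_le_mul_of_nonneg_right (hbase X₁ le_rfl hb hc ha) (mul_nonneg (mul_nonneg p2 p3) p4)
    have := mul_le_mul_of_nonneg_right (hswap X₁ X₄ h4 ha) (mul_nonneg p2 p3)
    linarith
  · have := mul_le_mul_of_nonneg_right (hbase X₂ ha le_rfl hb hc) (mul_nonneg (mul_nonneg p1 p3) p4)
    have := mul_le_mul_of_nonneg_right (hswap X₂ X₄ h4 hc) (mul_nonneg p1 p3)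
    linarith
  · have := mul_le_mul_of_nonneg_right (hbase X₃ ha hb le_rfl hc) (mul_nonneg (mul_nonneg p1 p2) p4)
    have := mul_le_mul_of_nonneg_right (hswap X₃ X₄ h4 hc) (mul_nonneg p1 p2)
    linarith

/-- Change of variables along the resonance function, with two frequencies moving at a fixed
distance. -/
lemma lintegral_quartic_difference_le (δ κ : ℝ) (G : ℝ → ℝ≥0∞) :
    ∫⁻ x, ENNReal.ofReal |4 * x ^ 3 - 4 * (x - δ) ^ 3| * G (κ - (x ^ 4 - (x - δ) ^ 4)) ≤
      ∫⁻ y, G y := by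
  rcases eq_or_ne δ 0 with rfl | hδ
  · simp
  have hderiv : ∀ x ∈ (Set.univ : Set ℝ), HasDerivWithinAt (fun x ↦ κ - (x ^ 4 - (x - δ) ^ 4))
      (-(4 * x ^ 3 - 4 * (x - δ) ^ 3)) Set.univ x := by
    intro x _
    have h1 : HasDerivAt (fun x : ℝ ↦ x ^ 4) (4 * x ^ 3) x := by simpa using hasDerivAt_pow 4 x
    have h2 : HasDerivAt (fun x : ℝ ↦ (x - δ) ^ 4) (4 * (x - δ) ^ 3) x := by
      simpa using HasDerivAt.comp_sub_const x δ (hasDerivAt_pow 4 (x - δ))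
    exact ((h1.sub h2).const_sub κ).hasDerivWithinAt
  have hinj : Set.InjOn (fun x ↦ κ - (x ^ 4 - (x - δ) ^ 4)) Set.univ := by
    intro x _ y _ hxy
    have hfac : (x - y) * (δ * ((2 * x - δ) ^ 2 + (2 * x - δ) * (2 * y - δ) + (2 * y - δ) ^ 2 +
        δ ^ 2)) = 0 := by
      simp only at hxy
      linear_combination (-1 : ℝ) * hxy
    rcases mul_eq_zero.mp hfac with h | h
    · linarith
    · exfalso
      rcases mul_eq_zero.mp h with h | h
      · exact hδ h
      · have := sq_pos_of_ne_zero hδ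
        nlinarith [sq_nonneg ((2 * x - δ) + (2 * y - δ)), sq_nonneg (2 * x - δ),
          sq_nonneg (2 * y - δ)]
  have := lintegral_image_eq_lintegral_abs_deriv_mul MeasurableSet.univ hderiv hinj G
  simp only [abs_neg, Measure.restrict_univ] at this
  rw [← this]
  exact setLIntegral_le_lintegral _ _

/-- Scale-invariant integrability of the frequency kernel. -/
lemma lintegral_truncated_rpow_le (a : ℝ) :
    ∫⁻ x : ℝ, ENNReal.ofReal (if |x| ≤ a then |x| ^ (-(1 / 3) : ℝ) * a ^ (-(2 / 3) : ℝ) else 0) ≤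
      ENNReal.ofReal 3 := by
  rcases le_or_gt a 0 with ha | ha
  · have : ∀ x : ℝ, ENNReal.ofReal
        (if |x| ≤ a then |x| ^ (-(1 / 3) : ℝ) * a ^ (-(2 / 3) : ℝ) else 0) = 0 := by
      intro x
      split_ifs with h
      · have : |x| = 0 := le_antisymm (h.trans ha) (abs_nonneg x)
        rw [this, Real.zero_rpow (by norm_num)]; simp
      · simp
    simp_rw [this]
    simp
  set Fp : ℝ → ℝ≥0∞ := (Set.Ioc 0 a).indicator
    fun x ↦ ENNReal.ofReal (x ^ (-(1 / 3) : ℝ) * a ^ (-(2 / 3) : ℝ)) with hFp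
  have hFpm : Measurable Fp := by
    refine Measurable.indicator (by fun_prop) measurableSet_Ioc
  have hle : ∀ x : ℝ, ENNReal.ofReal
      (if |x| ≤ a then |x| ^ (-(1 / 3) : ℝ) * a ^ (-(2 / 3) : ℝ) else 0) ≤ Fp x + Fp (-x) := by
    intro x
    split_ifs with h
    · rcases lt_trichotomy x 0 with hx | hx | hx
      · have : -x ∈ Set.Ioc 0 a := ⟨by linarith, (neg_le_abs x).trans h⟩
        rw [hFp, Set.indicator_of_mem this, abs_of_neg hx]
        exact le_add_self
      · subst hx; rw [abs_zero, Real.zero_rpow (by norm_num)]; simp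
      · have : x ∈ Set.Ioc 0 a := ⟨hx, (le_abs_self x).trans h⟩
        rw [hFp, Set.indicator_of_mem this, abs_of_pos hx]
        exact le_self_add
    · simp
  have hval : ∫⁻ x, Fp x = ENNReal.ofReal (3 / 2) := by
    rw [hFp, lintegral_indicator measurableSet_Ioc]
    have hpow_int :
        IntervalIntegrable (fun x : ℝ ↦ x ^ (-(1 / 3) : ℝ) * a ^ (-(2 / 3) : ℝ)) volume 0 a :=
      (intervalIntegral.intervalIntegrable_rpow' (by norm_num)).mul_const _
    rw [← ofReal_integral_eq_lintegral_ofReal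
      ((intervalIntegrable_iff_integrableOn_Ioc_of_le ha.le).mp hpow_int)]
    · congr 1
      rw [← intervalIntegral.integral_of_le ha.le, intervalIntegral.integral_mul_const,
        integral_rpow (Or.inl (by norm_num)), Real.zero_rpow (by norm_num), sub_zero,
        div_mul_eq_mul_div, ← Real.rpow_add ha]
      norm_num
    · filter_upwards [ae_restrict_mem measurableSet_Ioc] with x hx
      have := hx.1
      positivity
  calc _ ≤ ∫⁻ x, (Fp x + Fp (-x)) := lintegral_mono hle
    _ = ENNReal.ofReal (3 / 2) + ENNReal.ofReal (3 / 2) := by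
      rw [lintegral_add_left hFpm, lintegral_neg_eq_self Fp, hval]
    _ = ENNReal.ofReal 3 := by
      rw [← ENNReal.ofReal_add (by norm_num) (by norm_num)]; norm_num

/-- The modulation weight `⟨σ⟩^{-2b}` at the point `z = (τ, ξ)`. -/
noncomputable def modWeight (b : ℝ) (z : ℝ × ℝ) : ℝ := (1 + (z.1 + z.2 ^ 4) ^ 2) ^ (-b)

lemma modWeight_pos (b : ℝ) (z : ℝ × ℝ) : 0 < modWeight b z := by
  unfold modWeight; positivity

@[fun_prop]
lemma measurable_modWeight (b : ℝ) : Measurable (modWeight b) := by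
  unfold modWeight; fun_prop

/-- The kernel integrated over a pair of frequencies with one free frequency. -/
noncomputable def smoothingKernel (b : ℝ) (z₁ z₂ z₃ z₄ : ℝ × ℝ) : ℝ :=
  (if |z₂.2 - z₃.2| ≤ |z₁.2 - z₂.2| then
    |z₂.2 - z₃.2| ^ (-(1 / 3) : ℝ) * |z₁.2 - z₂.2| ^ (-(2 / 3) : ℝ) else 0) *
      (modWeight b z₃ + modWeight b z₄)

/-- The kernel integrated by a change of variables along the resonance function. -/
noncomputable def transversalKernel (b : ℝ) (z₁ z₂ z₃ z₄ : ℝ × ℝ) : ℝ :=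
  (if |z₂.2 - z₃.2| ≤ |z₁.2 - z₂.2| then
    |z₁.2 - z₂.2| * (1 + (z₁.2 ^ 2 + z₂.2 ^ 2 + z₃.2 ^ 2 + z₄.2 ^ 2)) else 0) *
      (modWeight b z₁ * modWeight b z₂)

lemma smoothingKernel_nonneg (b : ℝ) (z₁ z₂ z₃ z₄ : ℝ × ℝ) :
    0 ≤ smoothingKernel b z₁ z₂ z₃ z₄ := by
  have := modWeight_pos b z₃
  have := modWeight_pos b z₄
  unfold smoothingKernel
  split_ifs <;> positivity

lemma transversalKernel_nonneg (b : ℝ) (z₁ z₂ z₃ z₄ : ℝ × ℝ) :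
    0 ≤ transversalKernel b z₁ z₂ z₃ z₄ := by
  have := modWeight_pos b z₁
  have := modWeight_pos b z₂
  unfold transversalKernel
  split_ifs <;> positivity

lemma measurable_smoothingKernel (b : ℝ) : Measurable
    fun p : (ℝ × ℝ) × (ℝ × ℝ) × (ℝ × ℝ) × (ℝ × ℝ) ↦
      smoothingKernel b p.1 p.2.1 p.2.2.1 p.2.2.2 := by
  unfold smoothingKernel
  refine Measurable.mul (Measurable.ite (measurableSet_le ?_ ?_) ?_ measurable_const) ?_ <;> fun_prop

lemma measurable_transversalKernel (b : ℝ) : Measurable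
    fun p : (ℝ × ℝ) × (ℝ × ℝ) × (ℝ × ℝ) × (ℝ × ℝ) ↦
      transversalKernel b p.1 p.2.1 p.2.2.1 p.2.2.2 := by
  unfold transversalKernel
  refine Measurable.mul (Measurable.ite (measurableSet_le ?_ ?_) ?_ measurable_const) ?_ <;> fun_prop

/-- The total mass of `⟨σ⟩^{-2b}`. -/
noncomputable def modMass (b : ℝ) : ℝ≥0∞ := ∫⁻ x : ℝ, ENNReal.ofReal ((1 + x ^ 2) ^ (-b))

lemma modMass_lt_top {b : ℝ} (hb : 1 / 2 < b) : modMass b < ∞ := by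
  have h : Integrable (fun x : ℝ ↦ ((1 : ℝ) + ‖x‖ ^ 2) ^ (-(2 * b) / 2)) volume :=
    integrable_rpow_neg_one_add_norm_sq (by simp; linarith)
  refine lt_of_eq_of_lt ?_ h.lintegral_lt_top
  unfold modMass
  congr! 4 with x
  · rw [Real.norm_eq_abs, sq_abs]
  · ring

lemma lintegral_modWeight_shift (b c ξ : ℝ) :
    ∫⁻ τ : ℝ, ENNReal.ofReal (modWeight b (τ + c, ξ)) = modMass b := by
  unfold modMass modWeight
  simp only [add_assoc]
  exact lintegral_add_right_eq_self (fun x : ℝ ↦ ENNReal.ofReal ((1 + x ^ 2) ^ (-b))) (c + ξ ^ 4)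

lemma lintegral_smoothingKernel_le (b : ℝ) (z₁ z₂ : ℝ × ℝ) :
    ∫⁻ z₃, ENNReal.ofReal (smoothingKernel b z₁ z₂ z₃ (z₁ - z₂ + z₃)) ≤
      ENNReal.ofReal 3 * (modMass b + modMass b) := by
  have hmeas : Measurable fun z₃ : ℝ × ℝ ↦
      ENNReal.ofReal (smoothingKernel b z₁ z₂ z₃ (z₁ - z₂ + z₃)) :=
    ((measurable_smoothingKernel b).comp
      (by fun_prop : Measurable fun z₃ : ℝ × ℝ ↦ (z₁, z₂, z₃, z₁ - z₂ + z₃))).ennreal_ofReal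
  rw [Measure.volume_eq_prod, lintegral_prod_symm _ hmeas.aemeasurable]
  have hinner : ∀ ξ : ℝ, ∫⁻ τ : ℝ,
      ENNReal.ofReal (smoothingKernel b z₁ z₂ (τ, ξ) (z₁ - z₂ + (τ, ξ))) =
      ENNReal.ofReal (if |ξ - z₂.2| ≤ |z₁.2 - z₂.2| then
        |ξ - z₂.2| ^ (-(1 / 3) : ℝ) * |z₁.2 - z₂.2| ^ (-(2 / 3) : ℝ) else 0) *
        (modMass b + modMass b) := by
    intro ξ
    have hfun : ∀ τ : ℝ, ENNReal.ofReal (smoothingKernel b z₁ z₂ (τ, ξ) (z₁ - z₂ + (τ, ξ))) =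
        ENNReal.ofReal (if |ξ - z₂.2| ≤ |z₁.2 - z₂.2| then
        |ξ - z₂.2| ^ (-(1 / 3) : ℝ) * |z₁.2 - z₂.2| ^ (-(2 / 3) : ℝ) else 0) *
        (ENNReal.ofReal (modWeight b (τ + 0, ξ)) +
          ENNReal.ofReal (modWeight b (τ + (z₁.1 - z₂.1), z₁.2 - z₂.2 + ξ))) := by
      intro τ
      unfold smoothingKernel
      rw [ENNReal.ofReal_mul (by split_ifs <;> positivity),
        ENNReal.ofReal_add (modWeight_pos _ _).le (modWeight_pos _ _).le, abs_sub_comm ξ]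
      have : z₁ - z₂ + (τ, ξ) = (τ + (z₁.1 - z₂.1), z₁.2 - z₂.2 + ξ) := by
        ext <;> simp [add_comm]
      rw [this, add_zero]
    simp_rw [hfun]
    rw [lintegral_const_mul _ (by fun_prop), lintegral_add_left (by fun_prop),
      lintegral_modWeight_shift, lintegral_modWeight_shift]
  simp_rw [hinner]
  rw [lintegral_mul_const _ (by
    refine Measurable.ennreal_ofReal
      (Measurable.ite (measurableSet_le ?_ ?_) ?_ measurable_const) <;> fun_prop)]
  gcongr
  have := lintegral_sub_right_eq_self (μ := volume) (fun x : ℝ ↦ ENNReal.ofReal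
    (if |x| ≤ |z₁.2 - z₂.2| then
      |x| ^ (-(1 / 3) : ℝ) * |z₁.2 - z₂.2| ^ (-(2 / 3) : ℝ) else 0)) z₂.2
  rw [this]
  exact lintegral_truncated_rpow_le _

lemma transversal_frequency_bound {a b c d : ℝ} (h : d = a - b + c)
    (hac : |b - c| ≤ |a - b|) :
    |a - b| * (1 + (a ^ 2 + b ^ 2 + c ^ 2 + d ^ 2)) ≤
      11 * ((if |a| ≤ 1 then 1 else 0) + |4 * a ^ 3 - 4 * b ^ 3|) := by
  have hsq : (b - c) ^ 2 ≤ (a - b) ^ 2 := sq_le_sq.mpr hac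
  set S := a ^ 2 + b ^ 2 + c ^ 2 + d ^ 2 with hS
  have hS0 : 0 ≤ S := by positivity
  rcases le_or_gt S 1 with hS1 | hS1
  · have ha : |a| ≤ 1 := by
      rw [← sq_le_one_iff_abs_le_one]; nlinarith [sq_nonneg b, sq_nonneg c, sq_nonneg d]
    have hb : |b| ≤ 1 := by
      rw [← sq_le_one_iff_abs_le_one]; nlinarith [sq_nonneg a, sq_nonneg c, sq_nonneg d]
    rw [if_pos ha]
    have hab : |a - b| ≤ 2 := (abs_sub a b).trans (by linarith)
    have : |a - b| * (1 + S) ≤ 2 * 2 := by gcongr; linarith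
    linarith [abs_nonneg (4 * a ^ 3 - 4 * b ^ 3)]
  · have hcube : |4 * a ^ 3 - 4 * b ^ 3| = |a - b| * (4 * (a ^ 2 + a * b + b ^ 2)) := by
      rw [show 4 * a ^ 3 - 4 * b ^ 3 = (a - b) * (4 * (a ^ 2 + a * b + b ^ 2)) by ring, abs_mul,
        abs_of_nonneg (a := 4 * _)]
      nlinarith [sq_nonneg (a + b), sq_nonneg a, sq_nonneg b]
    have hSle : S ≤ 22 * (a ^ 2 + a * b + b ^ 2) := by
      have h1 : c ^ 2 ≤ 2 * b ^ 2 + 2 * (b - c) ^ 2 := by nlinarith [sq_nonneg (b + (b - c))]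
      have h2 : d ^ 2 ≤ 2 * a ^ 2 + 2 * (b - c) ^ 2 := by
        rw [h]; nlinarith [sq_nonneg (a + (b - c))]
      nlinarith [sq_nonneg (a + b)]
    have h0 : (0 : ℝ) ≤ if |a| ≤ 1 then 1 else 0 := by split_ifs <;> norm_num
    calc |a - b| * (1 + S) ≤ |a - b| * (2 * (22 * (a ^ 2 + a * b + b ^ 2))) := by
          gcongr; linarith
      _ = 11 * |4 * a ^ 3 - 4 * b ^ 3| := by rw [hcube]; ring
      _ ≤ _ := by linarith

lemma lintegral_transversalKernel_le {b : ℝ} (hb : 0 ≤ b) (z₃ z₄ : ℝ × ℝ) :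
    ∫⁻ z₁, ENNReal.ofReal (transversalKernel b z₁ (z₁ + z₃ - z₄) z₃ z₄) ≤
      ENNReal.ofReal 11 * (ENNReal.ofReal 2 * modMass b + modMass b * modMass b) := by
  set δ := z₄.2 - z₃.2 with hδ
  set κ := z₃.1 - z₄.1 with hκ
  set w : ℝ → ℝ≥0∞ := fun x ↦ ENNReal.ofReal ((1 + x ^ 2) ^ (-b)) with hw
  have hwm : Measurable w := by fun_prop
  have hw1 : ∀ x, w x ≤ 1 := fun x ↦ ENNReal.ofReal_le_one.mpr
    (Real.rpow_le_one_of_one_le_of_nonpos (by nlinarith [sq_nonneg x]) (by linarith))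
  have hmass : modMass b = ∫⁻ x, w x := rfl
  set I : ℝ → ℝ≥0∞ := (Set.Icc (-1) 1).indicator 1 with hI
  have hIm : Measurable I := measurable_one.indicator measurableSet_Icc
  set J : ℝ → ℝ≥0∞ := fun ξ ↦ ENNReal.ofReal |4 * ξ ^ 3 - 4 * (ξ - δ) ^ 3| with hJ
  have hJm : Measurable J := by fun_prop
  have hpt : ∀ z₁ : ℝ × ℝ, ENNReal.ofReal (transversalKernel b z₁ (z₁ + z₃ - z₄) z₃ z₄) ≤
      ENNReal.ofReal 11 * (I z₁.2 * w (z₁.1 + z₁.2 ^ 4) +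
        J z₁.2 * (w (z₁.1 + z₁.2 ^ 4) * w (z₁.1 + κ + (z₁.2 - δ) ^ 4))) := by
    intro z₁
    have hm1 : ENNReal.ofReal (modWeight b z₁) = w (z₁.1 + z₁.2 ^ 4) := rfl
    have hm2 : ENNReal.ofReal (modWeight b (z₁ + z₃ - z₄)) = w (z₁.1 + κ + (z₁.2 - δ) ^ 4) := by
      simp only [modWeight, hw, hδ, hκ, Prod.fst_sub, Prod.fst_add, Prod.snd_sub, Prod.snd_add]
      congr 6
      · ring
      · ring
    unfold transversalKernel
    split_ifs with hcond
    · have hfreq := transversal_frequency_bound (a := z₁.2) (b := (z₁ + z₃ - z₄).2)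
        (c := z₃.2) (d := z₄.2) (by simp only [Prod.snd_sub, Prod.snd_add]; ring) hcond
      have hsnd : (z₁ + z₃ - z₄).2 = z₁.2 - δ := by simp [hδ]; ring
      rw [ENNReal.ofReal_mul (by positivity), ENNReal.ofReal_mul (modWeight_pos _ _).le, hm1, hm2]
      have hle : ENNReal.ofReal (|z₁.2 - (z₁ + z₃ - z₄).2| *
          (1 + (z₁.2 ^ 2 + (z₁ + z₃ - z₄).2 ^ 2 + z₃.2 ^ 2 + z₄.2 ^ 2))) ≤
          ENNReal.ofReal 11 * (I z₁.2 + J z₁.2) := by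
        refine (ENNReal.ofReal_le_ofReal hfreq).trans ?_
        rw [ENNReal.ofReal_mul (by norm_num),
          ENNReal.ofReal_add (by split_ifs <;> norm_num) (abs_nonneg _), hsnd]
        gcongr
        simp only [hI, Set.indicator_apply, Set.mem_Icc, ← abs_le, Pi.one_apply]
        split_ifs <;> simp
      refine (mul_le_mul_left hle _).trans ?_
      rw [mul_assoc, add_mul]
      gcongr
      exact mul_le_of_le_one_right' (hw1 _)
    · simp
  refine (lintegral_mono hpt).trans ?_
  rw [lintegral_const_mul _ (by fun_prop), lintegral_add_left (by fun_prop)]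
  gcongr
  · rw [Measure.volume_eq_prod, lintegral_prod_symm _ (by fun_prop)]
    simp only
    have : ∀ ξ : ℝ, ∫⁻ τ : ℝ, I ξ * w (τ + ξ ^ 4) = I ξ * modMass b := by
      intro ξ
      rw [lintegral_const_mul _ (by fun_prop), lintegral_add_right_eq_self w, hmass]
    simp_rw [this]
    rw [lintegral_mul_const _ hIm, hI, lintegral_indicator_one measurableSet_Icc, Real.volume_Icc]
    norm_num
  · rw [Measure.volume_eq_prod, lintegral_prod_symm _ (by fun_prop)]
    simp only
    have : ∀ ξ : ℝ, ∫⁻ τ : ℝ, J ξ * (w (τ + ξ ^ 4) * w (τ + κ + (ξ - δ) ^ 4)) =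
        ∫⁻ τ : ℝ, J ξ * (w τ * w (τ + κ - (ξ ^ 4 - (ξ - δ) ^ 4))) := by
      intro ξ
      rw [← lintegral_add_right_eq_self
        (fun τ ↦ J ξ * (w τ * w (τ + κ - (ξ ^ 4 - (ξ - δ) ^ 4)))) (ξ ^ 4)]
      congr! 5 with τ
      ring
    simp_rw [this]
    rw [lintegral_lintegral_swap (by fun_prop)]
    calc ∫⁻ τ, ∫⁻ ξ, J ξ * (w τ * w (τ + κ - (ξ ^ 4 - (ξ - δ) ^ 4)))
        = ∫⁻ τ, w τ * ∫⁻ ξ, J ξ * w (τ + κ - (ξ ^ 4 - (ξ - δ) ^ 4)) := by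
          congr! 2 with τ
          rw [← lintegral_const_mul _ (by fun_prop)]
          congr! 2 with ξ
          ring
      _ ≤ ∫⁻ τ, w τ * modMass b := by
          gcongr with τ
          exact lintegral_quartic_difference_le δ (τ + κ) w
      _ = modMass b * modMass b := by rw [lintegral_mul_const _ hwm, hmass]

/-- Cauchy–Schwarz for a function dominated by a geometric mean. -/
lemma sq_lintegral_le_of_sq_le_mul {X : Type*} [MeasurableSpace X] {μ : Measure X}
    {h p q : X → ℝ≥0∞} (hp : AEMeasurable p μ) (hq : AEMeasurable q μ)
    (hpq : ∀ x, h x ^ 2 ≤ p x * q x) :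
    (∫⁻ x, h x ∂μ) ^ 2 ≤ (∫⁻ x, p x ∂μ) * ∫⁻ x, q x ∂μ := by
  have hsqrt : ∀ y : ℝ≥0∞, (y ^ (1 / 2 : ℝ)) ^ (2 : ℝ) = y := fun y ↦ by
    rw [← ENNReal.rpow_mul]; norm_num
  have hle : ∀ x, h x ≤ ((fun x ↦ p x ^ (1 / 2 : ℝ)) * fun x ↦ q x ^ (1 / 2 : ℝ)) x := by
    intro x
    rw [Pi.mul_apply, ← ENNReal.mul_rpow_of_nonneg _ _ (by norm_num),
      one_div, ENNReal.le_rpow_inv_iff (by norm_num)]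
    exact_mod_cast hpq x
  have holder := ENNReal.lintegral_mul_le_Lp_mul_Lq μ Real.HolderConjugate.two_two
    (hp.pow_const (1 / 2 : ℝ)) (hq.pow_const (1 / 2 : ℝ))
  simp only [hsqrt] at holder
  calc (∫⁻ x, h x ∂μ) ^ 2
      ≤ ((∫⁻ x, p x ∂μ) ^ (1 / 2 : ℝ) * (∫⁻ x, q x ∂μ) ^ (1 / 2 : ℝ)) ^ 2 := by
        gcongr
        exact (lintegral_mono hle).trans holder
    _ = _ := by
        rw [mul_pow, ← ENNReal.rpow_natCast, ← ENNReal.rpow_natCast]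
        simp only [Nat.cast_ofNat, hsqrt]

/-- A trilinear `L²` estimate on the plane for a kernel dominated by the geometric mean of two
kernels with bounded partial masses. -/
lemma lintegral_trilinear_sq_le {F₁ F₂ F₃ : ℝ × ℝ → ℝ≥0∞}
    {k P Q : ℝ × ℝ → ℝ × ℝ → ℝ × ℝ → ℝ × ℝ → ℝ≥0∞} {A B : ℝ≥0∞}
    (h₁ : Measurable F₁) (h₂ : Measurable F₂) (h₃ : Measurable F₃)
    (hPm : Measurable fun p : (ℝ × ℝ) × (ℝ × ℝ) × (ℝ × ℝ) × (ℝ × ℝ) ↦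
      P p.1 p.2.1 p.2.2.1 p.2.2.2)
    (hQm : Measurable fun p : (ℝ × ℝ) × (ℝ × ℝ) × (ℝ × ℝ) × (ℝ × ℝ) ↦
      Q p.1 p.2.1 p.2.2.1 p.2.2.2)
    (hk : ∀ z₁ z₂ z₃ z₄, k z₁ z₂ z₃ z₄ ^ 2 ≤ P z₁ z₂ z₃ z₄ * Q z₁ z₂ z₃ z₄)
    (hP : ∀ z₁ z₂, ∫⁻ z₃, P z₁ z₂ z₃ (z₁ - z₂ + z₃) ≤ A)
    (hQ : ∀ z₃ z₄, ∫⁻ z₁, Q z₁ (z₁ + z₃ - z₄) z₃ z₄ ≤ B) :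
    ∫⁻ z₄, (∫⁻ z₃, ∫⁻ z₁, F₁ z₁ * F₂ (z₁ + z₃ - z₄) * F₃ z₃ * k z₁ (z₁ + z₃ - z₄) z₃ z₄) ^ 2 ≤
      A * B * ((∫⁻ z, F₁ z ^ 2) * (∫⁻ z, F₂ z ^ 2) * ∫⁻ z, F₃ z ^ 2) := by
  have hPm' : Measurable fun p : (ℝ × ℝ) × (ℝ × ℝ) × (ℝ × ℝ) ↦
      F₁ p.2.2 ^ 2 * F₂ (p.2.2 + p.2.1 - p.1) ^ 2 * P p.2.2 (p.2.2 + p.2.1 - p.1) p.2.1 p.1 :=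
    (by fun_prop : Measurable fun p : (ℝ × ℝ) × (ℝ × ℝ) × (ℝ × ℝ) ↦
      F₁ p.2.2 ^ 2 * F₂ (p.2.2 + p.2.1 - p.1) ^ 2).mul
    (hPm.comp (by fun_prop : Measurable fun p : (ℝ × ℝ) × (ℝ × ℝ) × (ℝ × ℝ) ↦
      (p.2.2, p.2.2 + p.2.1 - p.1, p.2.1, p.1)))
  set p : ℝ × ℝ → ℝ × ℝ → ℝ≥0∞ := fun z₄ z₃ ↦
    ∫⁻ z₁, F₁ z₁ ^ 2 * F₂ (z₁ + z₃ - z₄) ^ 2 * P z₁ (z₁ + z₃ - z₄) z₃ z₄ with hp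
  have hpm : Measurable fun y : (ℝ × ℝ) × (ℝ × ℝ) ↦ p y.1 y.2 := by
    refine Measurable.lintegral_prod_right' (f := fun y : ((ℝ × ℝ) × (ℝ × ℝ)) × (ℝ × ℝ) ↦
      F₁ y.2 ^ 2 * F₂ (y.2 + y.1.2 - y.1.1) ^ 2 * P y.2 (y.2 + y.1.2 - y.1.1) y.1.2 y.1.1) ?_
    exact hPm'.comp (by fun_prop : Measurable fun y : ((ℝ × ℝ) × (ℝ × ℝ)) × (ℝ × ℝ) ↦
      (y.1.1, y.1.2, y.2))
  have hinner : ∀ z₄ z₃, (∫⁻ z₁, F₁ z₁ * F₂ (z₁ + z₃ - z₄) * F₃ z₃ *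
      k z₁ (z₁ + z₃ - z₄) z₃ z₄) ^ 2 ≤ p z₄ z₃ * (F₃ z₃ ^ 2 * B) := by
    intro z₄ z₃
    have hQz : Measurable fun z₁ ↦ Q z₁ (z₁ + z₃ - z₄) z₃ z₄ :=
      hQm.comp (by fun_prop : Measurable fun z₁ : ℝ × ℝ ↦ (z₁, z₁ + z₃ - z₄, z₃, z₄))
    refine (sq_lintegral_le_of_sq_le_mul
      (p := fun z₁ ↦ F₁ z₁ ^ 2 * F₂ (z₁ + z₃ - z₄) ^ 2 * P z₁ (z₁ + z₃ - z₄) z₃ z₄)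
      (q := fun z₁ ↦ F₃ z₃ ^ 2 * Q z₁ (z₁ + z₃ - z₄) z₃ z₄) ?_ (by fun_prop) ?_).trans ?_
    · exact (hPm'.comp (by fun_prop : Measurable fun z₁ : ℝ × ℝ ↦ (z₄, z₃, z₁))).aemeasurable
    · intro z₁
      calc _ = F₁ z₁ ^ 2 * F₂ (z₁ + z₃ - z₄) ^ 2 * F₃ z₃ ^ 2 *
            k z₁ (z₁ + z₃ - z₄) z₃ z₄ ^ 2 := by ring
        _ ≤ F₁ z₁ ^ 2 * F₂ (z₁ + z₃ - z₄) ^ 2 * F₃ z₃ ^ 2 *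
            (P z₁ (z₁ + z₃ - z₄) z₃ z₄ * Q z₁ (z₁ + z₃ - z₄) z₃ z₄) := by
          gcongr; exact hk _ _ _ _
        _ = _ := by ring
    · rw [lintegral_const_mul _ hQz]
      gcongr
      exact hQ z₃ z₄
  have houter : ∀ z₄, (∫⁻ z₃, ∫⁻ z₁, F₁ z₁ * F₂ (z₁ + z₃ - z₄) * F₃ z₃ *
      k z₁ (z₁ + z₃ - z₄) z₃ z₄) ^ 2 ≤ (∫⁻ z₃, p z₄ z₃) * ((∫⁻ z, F₃ z ^ 2) * B) := by
    intro z₄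
    refine (sq_lintegral_le_of_sq_le_mul (p := p z₄) (q := fun z₃ ↦ F₃ z₃ ^ 2 * B) ?_
      (by fun_prop) (hinner z₄)).trans ?_
    · exact (hpm.comp (by fun_prop : Measurable fun z₃ : ℝ × ℝ ↦ (z₄, z₃))).aemeasurable
    · rw [lintegral_mul_const _ (by fun_prop)]
  have hsubst : ∀ z₁ z₃, ∫⁻ z₄, F₁ z₁ ^ 2 * F₂ (z₁ + z₃ - z₄) ^ 2 *
      P z₁ (z₁ + z₃ - z₄) z₃ z₄ = ∫⁻ z₂, F₁ z₁ ^ 2 * F₂ z₂ ^ 2 * P z₁ z₂ z₃ (z₁ - z₂ + z₃) := by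
    intro z₁ z₃
    rw [← lintegral_sub_left_eq_self
      (fun z₂ ↦ F₁ z₁ ^ 2 * F₂ z₂ ^ 2 * P z₁ z₂ z₃ (z₁ - z₂ + z₃)) (z₁ + z₃)]
    refine lintegral_congr fun z₄ ↦ ?_
    rw [show z₁ - (z₁ + z₃ - z₄) + z₃ = z₄ by abel]
  have hmass : ∫⁻ z₄, ∫⁻ z₃, p z₄ z₃ ≤ A * ((∫⁻ z, F₁ z ^ 2) * ∫⁻ z, F₂ z ^ 2) := by
    calc ∫⁻ z₄, ∫⁻ z₃, p z₄ z₃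
        = ∫⁻ z₃, ∫⁻ z₄, p z₄ z₃ := lintegral_lintegral_swap hpm.aemeasurable
      _ = ∫⁻ z₃, ∫⁻ z₁, ∫⁻ z₄, F₁ z₁ ^ 2 * F₂ (z₁ + z₃ - z₄) ^ 2 *
            P z₁ (z₁ + z₃ - z₄) z₃ z₄ := by
          congr! 2 with z₃
          refine lintegral_lintegral_swap (Measurable.aemeasurable ?_)
          exact hPm'.comp (by fun_prop : Measurable fun y : (ℝ × ℝ) × (ℝ × ℝ) ↦
            (y.1, z₃, y.2))
      _ = ∫⁻ z₃, ∫⁻ z₁, ∫⁻ z₂, F₁ z₁ ^ 2 * F₂ z₂ ^ 2 * P z₁ z₂ z₃ (z₁ - z₂ + z₃) := by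
          simp_rw [hsubst]
      _ = ∫⁻ z₁, ∫⁻ z₃, ∫⁻ z₂, F₁ z₁ ^ 2 * F₂ z₂ ^ 2 * P z₁ z₂ z₃ (z₁ - z₂ + z₃) := by
          refine lintegral_lintegral_swap (Measurable.aemeasurable ?_)
          refine Measurable.lintegral_prod_right' (f := fun y : ((ℝ × ℝ) × (ℝ × ℝ)) × (ℝ × ℝ) ↦
            F₁ y.1.2 ^ 2 * F₂ y.2 ^ 2 * P y.1.2 y.2 y.1.1 (y.1.2 - y.2 + y.1.1)) ?_
          exact Measurable.mul (by fun_prop) (hPm.comp (by fun_prop : Measurable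
            fun y : ((ℝ × ℝ) × (ℝ × ℝ)) × (ℝ × ℝ) ↦ (y.1.2, y.2, y.1.1, y.1.2 - y.2 + y.1.1)))
      _ = ∫⁻ z₁, ∫⁻ z₂, ∫⁻ z₃, F₁ z₁ ^ 2 * F₂ z₂ ^ 2 * P z₁ z₂ z₃ (z₁ - z₂ + z₃) := by
          congr! 2 with z₁
          refine lintegral_lintegral_swap (Measurable.aemeasurable ?_)
          exact Measurable.mul (by fun_prop) (hPm.comp (by fun_prop : Measurable
            fun y : (ℝ × ℝ) × (ℝ × ℝ) ↦ (z₁, y.2, y.1, z₁ - y.2 + y.1)))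
      _ ≤ ∫⁻ z₁, ∫⁻ z₂, F₁ z₁ ^ 2 * F₂ z₂ ^ 2 * A := by
          gcongr with z₁ z₂
          have : Measurable fun z₃ ↦ P z₁ z₂ z₃ (z₁ - z₂ + z₃) :=
            hPm.comp (by fun_prop : Measurable fun z₃ : ℝ × ℝ ↦ (z₁, z₂, z₃, z₁ - z₂ + z₃))
          rw [lintegral_const_mul _ this]
          gcongr
          exact hP z₁ z₂
      _ = _ := by
          have : ∀ z₁, ∫⁻ z₂, F₁ z₁ ^ 2 * F₂ z₂ ^ 2 * A =
              F₁ z₁ ^ 2 * ((∫⁻ z, F₂ z ^ 2) * A) := by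
            intro z₁
            rw [lintegral_mul_const _ (by fun_prop), lintegral_const_mul _ (by fun_prop), mul_assoc]
          simp_rw [this]
          rw [lintegral_mul_const _ (by fun_prop)]
          ring
  calc _ ≤ ∫⁻ z₄, (∫⁻ z₃, p z₄ z₃) * ((∫⁻ z, F₃ z ^ 2) * B) := lintegral_mono houter
    _ = (∫⁻ z₄, ∫⁻ z₃, p z₄ z₃) * ((∫⁻ z, F₃ z ^ 2) * B) :=
      lintegral_mul_const _ hpm.lintegral_prod_right'
    _ ≤ A * ((∫⁻ z, F₁ z ^ 2) * ∫⁻ z, F₂ z ^ 2) * ((∫⁻ z, F₃ z ^ 2) * B) := by gcongr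
    _ = _ := by ring

/-- The weight `⟨ξ⟩^s ⟨τ+ξ⁴⟩^b` of the Bourgain norm. -/
noncomputable def bourgainWeight (s b : ℝ) (z : ℝ × ℝ) : ℝ :=
  (1 + z.2 ^ 2) ^ (s / 2) * (1 + (z.1 + z.2 ^ 4) ^ 2) ^ (b / 2)

lemma bourgainWeight_pos (s b : ℝ) (z : ℝ × ℝ) : 0 < bourgainWeight s b z := by
  unfold bourgainWeight; positivity

@[fun_prop]
lemma measurable_bourgainWeight (s b : ℝ) : Measurable (bourgainWeight s b) := by
  unfold bourgainWeight; fun_prop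

lemma bourgainWeight_sq (s b : ℝ) (z : ℝ × ℝ) :
    bourgainWeight s b z ^ 2 = (1 + z.2 ^ 2) ^ s * (1 + (z.1 + z.2 ^ 4) ^ 2) ^ b := by
  unfold bourgainWeight
  rw [mul_pow, ← Real.rpow_mul_natCast (by positivity), ← Real.rpow_mul_natCast (by positivity)]
  norm_num

/-- The geometric mean of the smoothing kernel and the transversal kernel. -/
noncomputable def interactionKernel (b : ℝ) (z₁ z₂ z₃ z₄ : ℝ × ℝ) : ℝ :=
  √(smoothingKernel b z₁ z₂ z₃ z₄ * transversalKernel b z₁ z₂ z₃ z₄)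

lemma interactionKernel_sq (b : ℝ) (z₁ z₂ z₃ z₄ : ℝ × ℝ) :
    interactionKernel b z₁ z₂ z₃ z₄ ^ 2 =
      smoothingKernel b z₁ z₂ z₃ z₄ * transversalKernel b z₁ z₂ z₃ z₄ :=
  Real.sq_sqrt (mul_nonneg (smoothingKernel_nonneg ..) (transversalKernel_nonneg ..))

lemma interactionKernel_nonneg (b : ℝ) (z₁ z₂ z₃ z₄ : ℝ × ℝ) :
    0 ≤ interactionKernel b z₁ z₂ z₃ z₄ := Real.sqrt_nonneg _

/-- The constant in the pointwise bound for the multiplier of the trilinear form. -/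
noncomputable def multiplierConst (s : ℝ) : ℝ :=
  3 ^ (s + 1 / 2) * 100000 ^ (1 / 6 : ℝ) * 16 ^ (1 / 6 : ℝ)

lemma multiplierConst_pos (s : ℝ) : 0 < multiplierConst s := by
  unfold multiplierConst; positivity

lemma sq_bourgainWeight_le_of_abs_le {s b : ℝ} (hs : -(1 / 2) ≤ s) (hb1 : 1 / 2 < b)
    (hb2 : b ≤ 5 / 6) {z₁ z₂ z₃ z₄ : ℝ × ℝ} (hz : z₄ = z₁ - z₂ + z₃)
    (h12 : z₁.2 ≠ z₂.2) (h23 : z₂.2 ≠ z₃.2) (hac : |z₂.2 - z₃.2| ≤ |z₁.2 - z₂.2|) :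
    bourgainWeight s (b - 1) z₄ ^ 2 ≤ multiplierConst s *
      (bourgainWeight s b z₁ * bourgainWeight s b z₂ * bourgainWeight s b z₃) ^ 2 *
      (interactionKernel b z₁ z₂ z₃ z₄ ^ 2 + interactionKernel b z₃ z₄ z₁ z₂ ^ 2) := by
  have hd : z₄.2 = z₁.2 - z₂.2 + z₃.2 := by rw [hz]; rfl
  have ht : z₄.1 = z₁.1 - z₂.1 + z₃.1 := by rw [hz]; rfl
  have h34 : z₃.2 - z₄.2 = -(z₁.2 - z₂.2) := by rw [hd]; ring
  have h41 : z₄.2 - z₁.2 = -(z₂.2 - z₃.2) := by rw [hd]; ring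
  have hF := frequency_weight_bound hd h12 h23 hac
  have hR := regularity_reduction hs hd
  have hM := modulation_weight_bound hb1 hb2
    (x₁ := z₁.1 + z₁.2 ^ 4) (x₂ := z₂.1 + z₂.2 ^ 4) (x₃ := z₃.1 + z₃.2 ^ 4)
    (x₄ := z₄.1 + z₄.2 ^ 4) (Φ := z₁.2 ^ 4 - z₂.2 ^ 4 + z₃.2 ^ 4 - z₄.2 ^ 4) (by rw [ht]; ring)
  simp only [interactionKernel_sq, smoothingKernel, transversalKernel, h34, h41, abs_neg,
    if_pos hac]
  rw [mul_pow, mul_pow, bourgainWeight_sq, bourgainWeight_sq, bourgainWeight_sq, bourgainWeight_sq]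
  set L := (1 + z₁.2 ^ 2) * (1 + z₂.2 ^ 2) * (1 + z₃.2 ^ 2) with hL
  have hL0 : 0 < L := by positivity
  set N := (1 + (z₁.1 + z₁.2 ^ 4) ^ 2) * (1 + (z₂.1 + z₂.2 ^ 4) ^ 2) *
    (1 + (z₃.1 + z₃.2 ^ 4) ^ 2) with hN
  have hN0 : 0 < N := by positivity
  have hNb : (1 + (z₁.1 + z₁.2 ^ 4) ^ 2) ^ (-b) * (1 + (z₂.1 + z₂.2 ^ 4) ^ 2) ^ (-b) *
    (1 + (z₃.1 + z₃.2 ^ 4) ^ 2) ^ (-b) = N ^ (-b) := by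
    rw [hN, Real.mul_rpow (by positivity) (by positivity),
      Real.mul_rpow (by positivity) (by positivity)]
  have hW : (1 + z₁.2 ^ 2) ^ s * (1 + (z₁.1 + z₁.2 ^ 4) ^ 2) ^ b *
      ((1 + z₂.2 ^ 2) ^ s * (1 + (z₂.1 + z₂.2 ^ 4) ^ 2) ^ b) *
      ((1 + z₃.2 ^ 2) ^ s * (1 + (z₃.1 + z₃.2 ^ 4) ^ 2) ^ b) = L ^ s * N ^ b := by
    rw [hN, hL, Real.mul_rpow (by positivity) (by positivity),
      Real.mul_rpow (by positivity) (by positivity), Real.mul_rpow (by positivity) (by positivity),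
      Real.mul_rpow (by positivity) (by positivity)]
    ring
  rw [hNb] at hM
  rw [hW]
  have hg : ∀ z : ℝ × ℝ, (1 + (z.1 + z.2 ^ 4) ^ 2) ^ (-b) = modWeight b z := fun _ ↦ rfl
  simp only [hg] at hM
  have g1 := modWeight_pos b z₁
  have g2 := modWeight_pos b z₂
  have g3 := modWeight_pos b z₃
  have g4 := modWeight_pos b z₄
  set Φ := (1 + (z₁.2 ^ 4 - z₂.2 ^ 4 + z₃.2 ^ 4 - z₄.2 ^ 4) ^ 2) ^ (-(1 / 6) : ℝ) with hΦ
  have hΦ0 : 0 < Φ := by positivity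
  have hcancel : L ^ s * N ^ b * (L ^ (-s) * N ^ (-b)) = 1 := by
    rw [Real.rpow_neg hL0.le, Real.rpow_neg hN0.le]
    field_simp
  calc (1 + z₄.2 ^ 2) ^ s * (1 + (z₄.1 + z₄.2 ^ 4) ^ 2) ^ (b - 1)
      = (L ^ s * N ^ b) * (((1 + z₄.2 ^ 2) ^ s * L ^ (-s)) *
          ((1 + (z₄.1 + z₄.2 ^ 4) ^ 2) ^ (b - 1) * N ^ (-b))) := by
        linear_combination (-((1 + z₄.2 ^ 2) ^ s * (1 + (z₄.1 + z₄.2 ^ 4) ^ 2) ^ (b - 1))) * hcancel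
    _ ≤ (L ^ s * N ^ b) * ((3 ^ (s + 1 / 2) * (L ^ (1 / 2 : ℝ) *
          (1 + z₄.2 ^ 2) ^ (-(1 / 2) : ℝ))) * (16 ^ (1 / 6 : ℝ) * (Φ *
        (modWeight b z₁ * modWeight b z₂ * (modWeight b z₃ + modWeight b z₄) +
          modWeight b z₃ * modWeight b z₄ * (modWeight b z₁ + modWeight b z₂))))) := by
        gcongr
    _ = (L ^ s * N ^ b) * (3 ^ (s + 1 / 2) * 16 ^ (1 / 6 : ℝ)) *
        (modWeight b z₁ * modWeight b z₂ * (modWeight b z₃ + modWeight b z₄) +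
          modWeight b z₃ * modWeight b z₄ * (modWeight b z₁ + modWeight b z₂)) *
        (L ^ (1 / 2 : ℝ) * (1 + z₄.2 ^ 2) ^ (-(1 / 2) : ℝ) * Φ) := by ring
    _ ≤ (L ^ s * N ^ b) * (3 ^ (s + 1 / 2) * 16 ^ (1 / 6 : ℝ)) *
        (modWeight b z₁ * modWeight b z₂ * (modWeight b z₃ + modWeight b z₄) +
          modWeight b z₃ * modWeight b z₄ * (modWeight b z₁ + modWeight b z₂)) *
        (100000 ^ (1 / 6 : ℝ) * ((|z₂.2 - z₃.2| ^ (-(1 / 3) : ℝ) *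
          |z₁.2 - z₂.2| ^ (-(2 / 3) : ℝ)) * (|z₁.2 - z₂.2| *
            (1 + (z₁.2 ^ 2 + z₂.2 ^ 2 + z₃.2 ^ 2 + z₄.2 ^ 2))))) := by
        gcongr
    _ = _ := by unfold multiplierConst; ring

/-- Pointwise bound for the multiplier of the trilinear form. -/
lemma bourgainWeight_le {s b : ℝ} (hs : -(1 / 2) ≤ s) (hb1 : 1 / 2 < b)
    (hb2 : b ≤ 5 / 6) {z₁ z₂ z₃ z₄ : ℝ × ℝ} (hz : z₄ = z₁ - z₂ + z₃)
    (h12 : z₁.2 ≠ z₂.2) (h23 : z₂.2 ≠ z₃.2) :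
    bourgainWeight s (b - 1) z₄ ≤ √(multiplierConst s) *
      (bourgainWeight s b z₁ * bourgainWeight s b z₂ * bourgainWeight s b z₃ *
      ((interactionKernel b z₁ z₂ z₃ z₄ + interactionKernel b z₃ z₄ z₁ z₂) +
        (interactionKernel b z₃ z₂ z₁ z₄ + interactionKernel b z₁ z₄ z₃ z₂))) := by
  have hC := (multiplierConst_pos s).le
  have hw1 := (bourgainWeight_pos s b z₁).le
  have hw2 := (bourgainWeight_pos s b z₂).le
  have hw3 := (bourgainWeight_pos s b z₃).le
  have k1 := interactionKernel_nonneg b z₁ z₂ z₃ z₄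
  have k2 := interactionKernel_nonneg b z₃ z₄ z₁ z₂
  have k3 := interactionKernel_nonneg b z₃ z₂ z₁ z₄
  have k4 := interactionKernel_nonneg b z₁ z₄ z₃ z₂
  refine le_of_sq_le_sq ?_ (by positivity)
  rw [mul_pow, Real.sq_sqrt hC, mul_pow, ← mul_assoc]
  rcases le_total |z₂.2 - z₃.2| |z₁.2 - z₂.2| with hac | hac
  · refine (sq_bourgainWeight_le_of_abs_le hs hb1 hb2 hz h12 h23 hac).trans ?_
    gcongr
    nlinarith [mul_nonneg k1 k2, mul_nonneg (add_nonneg k1 k2) (add_nonneg k3 k4)]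
  · have hz' : z₄ = z₃ - z₂ + z₁ := by rw [hz]; abel
    rw [abs_sub_comm z₁.2, abs_sub_comm z₂.2 z₃.2] at hac
    refine (sq_bourgainWeight_le_of_abs_le hs hb1 hb2 hz' h23.symm h12.symm hac).trans ?_
    rw [mul_right_comm (bourgainWeight s b z₃), mul_comm (bourgainWeight s b z₃),
      mul_right_comm (bourgainWeight s b z₁) (bourgainWeight s b z₃)]
    gcongr
    nlinarith [mul_nonneg k3 k4, mul_nonneg (add_nonneg k1 k2) (add_nonneg k3 k4)]

/-- The trilinear form on the frequency side with kernel `k`. -/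
noncomputable def trilinearForm (F₁ F₂ F₃ : ℝ × ℝ → ℝ≥0∞)
    (k : ℝ × ℝ → ℝ × ℝ → ℝ × ℝ → ℝ × ℝ → ℝ≥0∞) (z₄ : ℝ × ℝ) : ℝ≥0∞ :=
  ∫⁻ z₃, ∫⁻ z₁, F₁ z₁ * F₂ (z₁ + z₃ - z₄) * F₃ z₃ * k z₁ (z₁ + z₃ - z₄) z₃ z₄

section TrilinearForm

variable {F₁ F₂ F₃ : ℝ × ℝ → ℝ≥0∞} {k : ℝ × ℝ → ℝ × ℝ → ℝ × ℝ → ℝ × ℝ → ℝ≥0∞}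

lemma measurable_trilinearForm_integrand (h₁ : Measurable F₁) (h₂ : Measurable F₂)
    (h₃ : Measurable F₃) (hk : Measurable fun p : (ℝ × ℝ) × (ℝ × ℝ) × (ℝ × ℝ) × (ℝ × ℝ) ↦
      k p.1 p.2.1 p.2.2.1 p.2.2.2) :
    Measurable fun p : (ℝ × ℝ) × (ℝ × ℝ) × (ℝ × ℝ) ↦
      F₁ p.2.2 * F₂ (p.2.2 + p.2.1 - p.1) * F₃ p.2.1 * k p.2.2 (p.2.2 + p.2.1 - p.1) p.2.1 p.1 :=
  (by fun_prop : Measurable fun p : (ℝ × ℝ) × (ℝ × ℝ) × (ℝ × ℝ) ↦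
    F₁ p.2.2 * F₂ (p.2.2 + p.2.1 - p.1) * F₃ p.2.1).mul
    (hk.comp (by fun_prop : Measurable fun p : (ℝ × ℝ) × (ℝ × ℝ) × (ℝ × ℝ) ↦
      (p.2.2, p.2.2 + p.2.1 - p.1, p.2.1, p.1)))

lemma measurable_lintegral_trilinearForm_integrand (h₁ : Measurable F₁) (h₂ : Measurable F₂)
    (h₃ : Measurable F₃) (hk : Measurable fun p : (ℝ × ℝ) × (ℝ × ℝ) × (ℝ × ℝ) × (ℝ × ℝ) ↦
      k p.1 p.2.1 p.2.2.1 p.2.2.2) :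
    Measurable fun p : (ℝ × ℝ) × (ℝ × ℝ) ↦
      ∫⁻ z₁, F₁ z₁ * F₂ (z₁ + p.2 - p.1) * F₃ p.2 * k z₁ (z₁ + p.2 - p.1) p.2 p.1 :=
  ((measurable_trilinearForm_integrand h₁ h₂ h₃ hk).comp
    (by fun_prop : Measurable fun y : ((ℝ × ℝ) × (ℝ × ℝ)) × (ℝ × ℝ) ↦
      (y.1.1, y.1.2, y.2))).lintegral_prod_right'

lemma measurable_trilinearForm (h₁ : Measurable F₁) (h₂ : Measurable F₂)
    (h₃ : Measurable F₃) (hk : Measurable fun p : (ℝ × ℝ) × (ℝ × ℝ) × (ℝ × ℝ) × (ℝ × ℝ) ↦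
      k p.1 p.2.1 p.2.2.1 p.2.2.2) :
    Measurable (trilinearForm F₁ F₂ F₃ k) :=
  (measurable_lintegral_trilinearForm_integrand h₁ h₂ h₃ hk).lintegral_prod_right'

lemma trilinearForm_swap (h₁ : Measurable F₁) (h₂ : Measurable F₂)
    (h₃ : Measurable F₃) (hk : Measurable fun p : (ℝ × ℝ) × (ℝ × ℝ) × (ℝ × ℝ) × (ℝ × ℝ) ↦
      k p.1 p.2.1 p.2.2.1 p.2.2.2) :
    trilinearForm F₁ F₂ F₃ (fun z₁ z₂ z₃ z₄ ↦ k z₃ z₂ z₁ z₄) = trilinearForm F₃ F₂ F₁ k := by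
  ext z₄
  unfold trilinearForm
  rw [lintegral_lintegral_swap]
  · refine lintegral_congr fun z₃ ↦ lintegral_congr fun z₁ ↦ ?_
    rw [add_comm z₃ z₁]
    ring
  · refine Measurable.aemeasurable ?_
    exact (measurable_trilinearForm_integrand (k := fun z₁ z₂ z₃ z₄ ↦ k z₃ z₂ z₁ z₄) h₁ h₂ h₃
      (hk.comp (by fun_prop : Measurable fun p : (ℝ × ℝ) × (ℝ × ℝ) × (ℝ × ℝ) × (ℝ × ℝ) ↦
        (p.2.2.1, p.2.1, p.1, p.2.2.2)))).comp
      (by fun_prop : Measurable fun y : (ℝ × ℝ) × (ℝ × ℝ) ↦ (z₄, y.1, y.2))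

lemma trilinearForm_add (h₁ : Measurable F₁) (h₂ : Measurable F₂)
    (h₃ : Measurable F₃) (hk : Measurable fun p : (ℝ × ℝ) × (ℝ × ℝ) × (ℝ × ℝ) × (ℝ × ℝ) ↦
      k p.1 p.2.1 p.2.2.1 p.2.2.2) (k' : ℝ × ℝ → ℝ × ℝ → ℝ × ℝ → ℝ × ℝ → ℝ≥0∞) (z₄ : ℝ × ℝ) :
    trilinearForm F₁ F₂ F₃ (fun z₁ z₂ z₃ z₄ ↦ k z₁ z₂ z₃ z₄ + k' z₁ z₂ z₃ z₄) z₄ =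
      trilinearForm F₁ F₂ F₃ k z₄ + trilinearForm F₁ F₂ F₃ k' z₄ := by
  unfold trilinearForm
  have hm : ∀ z₃, Measurable fun z₁ ↦
      F₁ z₁ * F₂ (z₁ + z₃ - z₄) * F₃ z₃ * k z₁ (z₁ + z₃ - z₄) z₃ z₄ := fun z₃ ↦
    (measurable_trilinearForm_integrand h₁ h₂ h₃ hk).comp
      (by fun_prop : Measurable fun z₁ : ℝ × ℝ ↦ (z₄, z₃, z₁))
  have hm' : Measurable fun z₃ ↦
      ∫⁻ z₁, F₁ z₁ * F₂ (z₁ + z₃ - z₄) * F₃ z₃ * k z₁ (z₁ + z₃ - z₄) z₃ z₄ :=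
    (measurable_lintegral_trilinearForm_integrand h₁ h₂ h₃ hk).comp
      (by fun_prop : Measurable fun z₃ : ℝ × ℝ ↦ (z₄, z₃))
  simp only [mul_add]
  rw [← lintegral_add_left hm']
  refine lintegral_congr fun z₃ ↦ ?_
  rw [← lintegral_add_left (hm z₃)]

end TrilinearForm

/-- The product of the two kernel masses. -/
noncomputable def kernelMass (b : ℝ) : ℝ≥0∞ :=
  (ENNReal.ofReal 3 * (modMass b + modMass b)) *
    (ENNReal.ofReal 11 * (ENNReal.ofReal 2 * modMass b + modMass b * modMass b))

lemma kernelMass_lt_top {b : ℝ} (hb : 1 / 2 < b) : kernelMass b < ∞ := by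
  have := modMass_lt_top hb
  unfold kernelMass
  finiteness

lemma Measurable.interactionKernel {X : Type*} [MeasurableSpace X] (b : ℝ)
    {f₁ f₂ f₃ f₄ : X → ℝ × ℝ} (h₁ : Measurable f₁) (h₂ : Measurable f₂) (h₃ : Measurable f₃)
    (h₄ : Measurable f₄) : Measurable fun x ↦
      ENNReal.ofReal (interactionKernel b (f₁ x) (f₂ x) (f₃ x) (f₄ x)) := by
  have hf := h₁.prodMk (h₂.prodMk (h₃.prodMk h₄))
  have hs := (measurable_smoothingKernel b).comp hf
  have ht := (measurable_transversalKernel b).comp hf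
  exact (hs.mul ht).sqrt.ennreal_ofReal

lemma ofReal_interactionKernel_sq (b : ℝ) (z₁ z₂ z₃ z₄ : ℝ × ℝ) :
    ENNReal.ofReal (interactionKernel b z₁ z₂ z₃ z₄) ^ 2 =
      ENNReal.ofReal (smoothingKernel b z₁ z₂ z₃ z₄) *
        ENNReal.ofReal (transversalKernel b z₁ z₂ z₃ z₄) := by
  rw [← ENNReal.ofReal_pow (interactionKernel_nonneg ..), interactionKernel_sq,
    ENNReal.ofReal_mul (smoothingKernel_nonneg ..)]

section KernelBounds

variable {b : ℝ} {F₁ F₂ F₃ : ℝ × ℝ → ℝ≥0∞}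

lemma lintegral_trilinearForm_interactionKernel_sq_le (hb : 0 ≤ b) (h₁ : Measurable F₁)
    (h₂ : Measurable F₂) (h₃ : Measurable F₃) :
    ∫⁻ z₄, trilinearForm F₁ F₂ F₃
        (fun z₁ z₂ z₃ z₄ ↦ ENNReal.ofReal (interactionKernel b z₁ z₂ z₃ z₄)) z₄ ^ 2 ≤
      kernelMass b * ((∫⁻ z, F₁ z ^ 2) * (∫⁻ z, F₂ z ^ 2) * ∫⁻ z, F₃ z ^ 2) :=
  lintegral_trilinear_sq_le h₁ h₂ h₃
    (P := fun z₁ z₂ z₃ z₄ ↦ ENNReal.ofReal (smoothingKernel b z₁ z₂ z₃ z₄))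
    (Q := fun z₁ z₂ z₃ z₄ ↦ ENNReal.ofReal (transversalKernel b z₁ z₂ z₃ z₄))
    (measurable_smoothingKernel b).ennreal_ofReal (measurable_transversalKernel b).ennreal_ofReal
    (fun _ _ _ _ ↦ (ofReal_interactionKernel_sq ..).le)
    (lintegral_smoothingKernel_le b) (lintegral_transversalKernel_le hb)

lemma lintegral_trilinearForm_interactionKernel_dual_sq_le (hb : 0 ≤ b) (h₁ : Measurable F₁)
    (h₂ : Measurable F₂) (h₃ : Measurable F₃) :
    ∫⁻ z₄, trilinearForm F₁ F₂ F₃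
        (fun z₁ z₂ z₃ z₄ ↦ ENNReal.ofReal (interactionKernel b z₃ z₄ z₁ z₂)) z₄ ^ 2 ≤
      kernelMass b * ((∫⁻ z, F₁ z ^ 2) * (∫⁻ z, F₂ z ^ 2) * ∫⁻ z, F₃ z ^ 2) := by
  have hrot : Measurable fun p : (ℝ × ℝ) × (ℝ × ℝ) × (ℝ × ℝ) × (ℝ × ℝ) ↦
      (p.2.2.1, p.2.2.2, p.1, p.2.1) := by fun_prop
  unfold kernelMass
  rw [mul_comm (ENNReal.ofReal 3 * _)]
  refine lintegral_trilinear_sq_le h₁ h₂ h₃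
    (P := fun z₁ z₂ z₃ z₄ ↦ ENNReal.ofReal (transversalKernel b z₃ z₄ z₁ z₂))
    (Q := fun z₁ z₂ z₃ z₄ ↦ ENNReal.ofReal (smoothingKernel b z₃ z₄ z₁ z₂))
    ((measurable_transversalKernel b).comp hrot).ennreal_ofReal
    ((measurable_smoothingKernel b).comp hrot).ennreal_ofReal
    (fun _ _ _ _ ↦ ((ofReal_interactionKernel_sq ..).trans (mul_comm _ _)).le) ?_ ?_
  · intro z₁ z₂
    refine le_trans (le_of_eq (lintegral_congr fun z₃ ↦ ?_))
      (lintegral_transversalKernel_le hb z₁ z₂)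
    rw [show z₁ - z₂ + z₃ = z₃ + z₁ - z₂ by abel]
  · intro z₃ z₄
    refine le_trans (le_of_eq (lintegral_congr fun z₁ ↦ ?_)) (lintegral_smoothingKernel_le b z₃ z₄)
    rw [show z₁ + z₃ - z₄ = z₃ - z₄ + z₁ by abel]

end KernelBounds

lemma add_four_sq_le (x₁ x₂ x₃ x₄ : ℝ≥0∞) :
    (x₁ + x₂ + (x₃ + x₄)) ^ 2 ≤ 4 * (x₁ ^ 2 + x₂ ^ 2 + (x₃ ^ 2 + x₄ ^ 2)) := by
  have h : ∀ x y : ℝ≥0∞, (x + y) ^ 2 ≤ 2 * (x ^ 2 + y ^ 2) := by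
    intro x y
    have := ENNReal.rpow_add_le_mul_rpow_add_rpow x y (one_le_two : (1 : ℝ) ≤ 2)
    norm_num at this
    exact_mod_cast this
  calc (x₁ + x₂ + (x₃ + x₄)) ^ 2 ≤ 2 * ((x₁ + x₂) ^ 2 + (x₃ + x₄) ^ 2) := h _ _
    _ ≤ 2 * (2 * (x₁ ^ 2 + x₂ ^ 2) + 2 * (x₃ ^ 2 + x₄ ^ 2)) := by gcongr <;> exact h _ _
    _ = _ := by ring

lemma ae_snd_ne (c : ℝ) : ∀ᵐ z : ℝ × ℝ, z.2 ≠ c := by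
  rw [Measure.volume_eq_prod]
  exact Measure.quasiMeasurePreserving_snd.ae (Measure.ae_ne volume c)

/-- The sum of the four trilinear forms that dominate the trilinear form of the estimate. -/
noncomputable def dominatingForm (b : ℝ) (F₁ F₂ F₃ : ℝ × ℝ → ℝ≥0∞) (z₄ : ℝ × ℝ) : ℝ≥0∞ :=
  (trilinearForm F₁ F₂ F₃
      (fun z₁ z₂ z₃ z₄ ↦ ENNReal.ofReal (interactionKernel b z₁ z₂ z₃ z₄)) z₄ +
    trilinearForm F₁ F₂ F₃
      (fun z₁ z₂ z₃ z₄ ↦ ENNReal.ofReal (interactionKernel b z₃ z₄ z₁ z₂)) z₄) +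
  (trilinearForm F₃ F₂ F₁
      (fun z₁ z₂ z₃ z₄ ↦ ENNReal.ofReal (interactionKernel b z₁ z₂ z₃ z₄)) z₄ +
    trilinearForm F₃ F₂ F₁
      (fun z₁ z₂ z₃ z₄ ↦ ENNReal.ofReal (interactionKernel b z₃ z₄ z₁ z₂)) z₄)

lemma dominatingForm_eq (b : ℝ) {F₁ F₂ F₃ : ℝ × ℝ → ℝ≥0∞} (h₁ : Measurable F₁)
    (h₂ : Measurable F₂) (h₃ : Measurable F₃) (z₄ : ℝ × ℝ) :
    dominatingForm b F₁ F₂ F₃ z₄ = trilinearForm F₁ F₂ F₃ (fun z₁ z₂ z₃ z₄ ↦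
      (ENNReal.ofReal (interactionKernel b z₁ z₂ z₃ z₄) +
        ENNReal.ofReal (interactionKernel b z₃ z₄ z₁ z₂)) +
      (ENNReal.ofReal (interactionKernel b z₃ z₂ z₁ z₄) +
        ENNReal.ofReal (interactionKernel b z₁ z₄ z₃ z₂))) z₄ := by
  have hk : Measurable fun p : (ℝ × ℝ) × (ℝ × ℝ) × (ℝ × ℝ) × (ℝ × ℝ) ↦
      ENNReal.ofReal (interactionKernel b p.1 p.2.1 p.2.2.1 p.2.2.2) :=
    Measurable.interactionKernel b (by fun_prop) (by fun_prop) (by fun_prop) (by fun_prop)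
  have hk' : Measurable fun p : (ℝ × ℝ) × (ℝ × ℝ) × (ℝ × ℝ) × (ℝ × ℝ) ↦
      ENNReal.ofReal (interactionKernel b p.2.2.1 p.2.2.2 p.1 p.2.1) :=
    Measurable.interactionKernel b (by fun_prop) (by fun_prop) (by fun_prop) (by fun_prop)
  have hswap : Measurable fun p : (ℝ × ℝ) × (ℝ × ℝ) × (ℝ × ℝ) × (ℝ × ℝ) ↦
      ENNReal.ofReal (interactionKernel b p.2.2.1 p.2.1 p.1 p.2.2.2) :=
    Measurable.interactionKernel b (by fun_prop) (by fun_prop) (by fun_prop) (by fun_prop)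
  rw [trilinearForm_add (k := fun z₁ z₂ z₃ z₄ ↦
      ENNReal.ofReal (interactionKernel b z₁ z₂ z₃ z₄) +
        ENNReal.ofReal (interactionKernel b z₃ z₄ z₁ z₂)) h₁ h₂ h₃ (hk.add hk'),
    trilinearForm_add (k := fun z₁ z₂ z₃ z₄ ↦
      ENNReal.ofReal (interactionKernel b z₁ z₂ z₃ z₄)) h₁ h₂ h₃ hk,
    trilinearForm_add (k := fun z₁ z₂ z₃ z₄ ↦
      ENNReal.ofReal (interactionKernel b z₃ z₂ z₁ z₄)) h₁ h₂ h₃ hswap, dominatingForm,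
    ← trilinearForm_swap (k := fun z₁ z₂ z₃ z₄ ↦
      ENNReal.ofReal (interactionKernel b z₁ z₂ z₃ z₄)) h₁ h₂ h₃ hk,
    ← trilinearForm_swap (k := fun z₁ z₂ z₃ z₄ ↦
      ENNReal.ofReal (interactionKernel b z₃ z₄ z₁ z₂)) h₁ h₂ h₃ hk']

lemma lintegral_dominatingForm_sq_le {b : ℝ} (hb : 0 ≤ b) {F₁ F₂ F₃ : ℝ × ℝ → ℝ≥0∞}
    (h₁ : Measurable F₁) (h₂ : Measurable F₂) (h₃ : Measurable F₃) :
    ∫⁻ z, dominatingForm b F₁ F₂ F₃ z ^ 2 ≤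
      16 * kernelMass b * ((∫⁻ z, F₁ z ^ 2) * (∫⁻ z, F₂ z ^ 2) * ∫⁻ z, F₃ z ^ 2) := by
  have hk : Measurable fun p : (ℝ × ℝ) × (ℝ × ℝ) × (ℝ × ℝ) × (ℝ × ℝ) ↦
      ENNReal.ofReal (interactionKernel b p.1 p.2.1 p.2.2.1 p.2.2.2) :=
    Measurable.interactionKernel b (by fun_prop) (by fun_prop) (by fun_prop) (by fun_prop)
  have hk' : Measurable fun p : (ℝ × ℝ) × (ℝ × ℝ) × (ℝ × ℝ) × (ℝ × ℝ) ↦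
      ENNReal.ofReal (interactionKernel b p.2.2.1 p.2.2.2 p.1 p.2.1) :=
    Measurable.interactionKernel b (by fun_prop) (by fun_prop) (by fun_prop) (by fun_prop)
  have e₁ := lintegral_trilinearForm_interactionKernel_sq_le hb h₁ h₂ h₃
  have e₂ := lintegral_trilinearForm_interactionKernel_dual_sq_le hb h₁ h₂ h₃
  have e₃ := lintegral_trilinearForm_interactionKernel_sq_le hb h₃ h₂ h₁
  have e₄ := lintegral_trilinearForm_interactionKernel_dual_sq_le hb h₃ h₂ h₁
  have t₁ := measurable_trilinearForm (k := fun z₁ z₂ z₃ z₄ ↦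
    ENNReal.ofReal (interactionKernel b z₁ z₂ z₃ z₄)) h₁ h₂ h₃ hk
  have t₂ := measurable_trilinearForm (k := fun z₁ z₂ z₃ z₄ ↦
    ENNReal.ofReal (interactionKernel b z₃ z₄ z₁ z₂)) h₁ h₂ h₃ hk'
  have t₃ := measurable_trilinearForm (k := fun z₁ z₂ z₃ z₄ ↦
    ENNReal.ofReal (interactionKernel b z₁ z₂ z₃ z₄)) h₃ h₂ h₁ hk
  refine (lintegral_mono fun z ↦ add_four_sq_le _ _ _ _).trans ?_
  rw [lintegral_const_mul' _ _ (by simp), lintegral_add_left (by fun_prop),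
    lintegral_add_left (by fun_prop), lintegral_add_left (by fun_prop)]
  refine (mul_le_mul_right (add_le_add (add_le_add e₁ e₂) (add_le_add e₃ e₄)) _).trans
    (le_of_eq ?_)
  ring

lemma bourgainWeight_mul_le_dominatingForm {s b : ℝ} (hs : -(1 / 2) ≤ s) (hb1 : 1 / 2 < b)
    (hb2 : b ≤ 5 / 6) {U₁ U₂ U₃ : ℝ × ℝ → ℝ≥0∞} (h₁ : Measurable U₁) (h₂ : Measurable U₂)
    (h₃ : Measurable U₃) (z₄ : ℝ × ℝ) :
    ENNReal.ofReal (bourgainWeight s (b - 1) z₄) *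
        ∫⁻ z₃, ∫⁻ z₁, U₁ z₁ * U₂ (z₁ + z₃ - z₄) * U₃ z₃ ≤
      ENNReal.ofReal √(multiplierConst s) * dominatingForm b
        (fun z ↦ ENNReal.ofReal (bourgainWeight s b z) * U₁ z)
        (fun z ↦ ENNReal.ofReal (bourgainWeight s b z) * U₂ z)
        (fun z ↦ ENNReal.ofReal (bourgainWeight s b z) * U₃ z) z₄ := by
  rw [dominatingForm_eq b (by fun_prop) (by fun_prop) (by fun_prop), trilinearForm,
    ← lintegral_const_mul' _ _ ENNReal.ofReal_ne_top,
    ← lintegral_const_mul' _ _ ENNReal.ofReal_ne_top]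
  refine lintegral_mono_ae ?_
  filter_upwards [ae_snd_ne z₄.2] with z₃ hz₃
  rw [← lintegral_const_mul' _ _ ENNReal.ofReal_ne_top,
    ← lintegral_const_mul' _ _ ENNReal.ofReal_ne_top]
  refine lintegral_mono_ae ?_
  filter_upwards [ae_snd_ne z₄.2] with z₁ hz₁
  have hreal := bourgainWeight_le hs hb1 hb2 (z₁ := z₁) (z₂ := z₁ + z₃ - z₄) (z₃ := z₃)
    (z₄ := z₄) (by abel)
    (by rw [Prod.snd_sub, Prod.snd_add]; intro h; exact hz₃ (by linarith))
    (by rw [Prod.snd_sub, Prod.snd_add]; intro h; exact hz₁ (by linarith))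
  have w₁ := (bourgainWeight_pos s b z₁).le
  have w₂ := (bourgainWeight_pos s b (z₁ + z₃ - z₄)).le
  have w₃ := (bourgainWeight_pos s b z₃).le
  have hle := ENNReal.ofReal_le_ofReal hreal
  rw [ENNReal.ofReal_mul (by positivity), ENNReal.ofReal_mul (by positivity),
    ENNReal.ofReal_mul (by positivity), ENNReal.ofReal_mul (by positivity),
    ENNReal.ofReal_add (add_nonneg (interactionKernel_nonneg ..) (interactionKernel_nonneg ..))
      (add_nonneg (interactionKernel_nonneg ..) (interactionKernel_nonneg ..)),
    ENNReal.ofReal_add (interactionKernel_nonneg ..) (interactionKernel_nonneg ..),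
    ENNReal.ofReal_add (interactionKernel_nonneg ..) (interactionKernel_nonneg ..)] at hle
  refine (mul_le_mul_left hle _).trans (le_of_eq ?_)
  ring

/-- The trilinear estimate on the frequency side. -/
theorem lintegral_bourgainWeight_trilinear_sq_le {s b : ℝ} (hs : -(1 / 2) ≤ s) (hb1 : 1 / 2 < b)
    (hb2 : b ≤ 5 / 6) {U₁ U₂ U₃ : ℝ × ℝ → ℝ≥0∞} (h₁ : Measurable U₁) (h₂ : Measurable U₂)
    (h₃ : Measurable U₃) :
    ∫⁻ z₄, (ENNReal.ofReal (bourgainWeight s (b - 1) z₄) *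
        ∫⁻ z₃, ∫⁻ z₁, U₁ z₁ * U₂ (z₁ + z₃ - z₄) * U₃ z₃) ^ 2 ≤
      ENNReal.ofReal (multiplierConst s) * (16 * kernelMass b *
        ((∫⁻ z, (ENNReal.ofReal (bourgainWeight s b z) * U₁ z) ^ 2) *
          (∫⁻ z, (ENNReal.ofReal (bourgainWeight s b z) * U₂ z) ^ 2) *
            ∫⁻ z, (ENNReal.ofReal (bourgainWeight s b z) * U₃ z) ^ 2)) := by
  refine le_trans (lintegral_mono fun z₄ ↦ pow_le_pow_left₀ bot_le
    (bourgainWeight_mul_le_dominatingForm hs hb1 hb2 h₁ h₂ h₃ z₄) 2) ?_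
  simp_rw [mul_pow (ENNReal.ofReal √(multiplierConst s)), ← ENNReal.ofReal_pow (Real.sqrt_nonneg _),
    Real.sq_sqrt (multiplierConst_pos s).le]
  rw [lintegral_const_mul' _ _ ENNReal.ofReal_ne_top]
  exact mul_le_mul_right (lintegral_dominatingForm_sq_le (by linarith) (by fun_prop) (by fun_prop)
    (by fun_prop)) _

section FourierProduct

open FourierTransform SchwartzMap Convolution

lemma SchwartzMap.fourier_pairing {E : Type*} [NormedAddCommGroup E] [InnerProductSpace ℝ E]
    [FiniteDimensional ℝ E] [MeasurableSpace E] [BorelSpace E] (B : ℂ →L[ℂ] ℂ →L[ℂ] ℂ)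
    (f g : 𝓢(E, ℂ)) : 𝓕 (pairing B f g) = convolution B (𝓕 f) (𝓕 g) := by
  have hneg : ∀ (h : 𝓢(E, ℂ)) (x : E), (𝓕⁻ h) x = (𝓕 h) (-x) := fun h x ↦ by
    rw [fourierInv_coe, fourier_coe, Real.fourierInv_eq_fourier_neg]
  have hinv : 𝓕⁻ (convolution B (𝓕 f) (𝓕 g)) = pairing B f g := by
    ext x
    rw [hneg, fourier_convolution, pairing_apply_apply, pairing_apply_apply, ← hneg, ← hneg,
      fourierInv_fourier_eq, fourierInv_fourier_eq]
  rw [← hinv, fourier_fourierInv_eq]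

lemma SchwartzMap.enorm_fourier_mul_le {E : Type*} [NormedAddCommGroup E] [InnerProductSpace ℝ E]
    [FiniteDimensional ℝ E] [MeasurableSpace E] [BorelSpace E] (f g : 𝓢(E, ℂ)) (w : E) :
    ‖𝓕 (fun v ↦ f v * g v) w‖ₑ ≤ ∫⁻ t, ‖𝓕 (f : E → ℂ) t‖ₑ * ‖𝓕 (g : E → ℂ) (w - t)‖ₑ := by
  have h : 𝓕 (fun v ↦ f v * g v) w = ∫ t, (𝓕 f) t * (𝓕 g) (w - t) := by
    have := congrArg (fun h : 𝓢(E, ℂ) ↦ h w) (fourier_pairing (ContinuousLinearMap.mul ℂ ℂ) f g)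
    simp only [convolution_apply, fourier_coe] at this
    exact this
  rw [h]
  refine (enorm_integral_le_lintegral_enorm _).trans (le_of_eq ?_)
  simp only [enorm_mul, fourier_coe]

/-- The plane with its Euclidean norm. -/
abbrev EuclideanPlane : Type := WithLp 2 (ℝ × ℝ)

lemma fourier_eq_spaceTimeFT (u : ℝ × ℝ → ℂ) (w : EuclideanPlane) :
    𝓕 (fun v : EuclideanPlane ↦ u (WithLp.ofLp v)) w =
      spaceTimeFT u (2 * Real.pi * w.fst) (2 * Real.pi * w.snd) := by
  rw [Real.fourier_eq', spaceTimeFT, ← (WithLp.volume_preserving_ofLp ℝ ℝ).integral_comp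
    (WithLp.homeomorphProd 2 ℝ ℝ).measurableEmbedding]
  congr! 2 with v
  rw [WithLp.prod_inner_apply, smul_eq_mul]
  congr 2
  simp
  ring

lemma fourier_toLp_eq_spaceTimeFT (u : ℝ × ℝ → ℂ) (z : ℝ × ℝ) :
    𝓕 (fun v : EuclideanPlane ↦ u (WithLp.ofLp v)) (WithLp.toLp 2 ((2 * Real.pi)⁻¹ • z)) =
      spaceTimeFT u z.1 z.2 := by
  rw [fourier_eq_spaceTimeFT]
  have : (2 * Real.pi) ≠ 0 := by positivity
  congr 1
  · simp; field_simp
  · simp; field_simp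

lemma exists_schwartzMap_eq {u : ℝ × ℝ → ℂ} (hu : ContDiff ℝ (⊤ : ℕ∞) u)
    (hc : HasCompactSupport u) :
    ∃ f : 𝓢(EuclideanPlane, ℂ), (f : EuclideanPlane → ℂ) = fun v ↦ u (WithLp.ofLp v) := by
  have h1 : HasCompactSupport fun v : EuclideanPlane ↦ u (WithLp.ofLp v) :=
    hc.comp_homeomorph (WithLp.homeomorphProd 2 ℝ ℝ)
  have h2 : ContDiff ℝ (⊤ : ℕ∞) fun v : EuclideanPlane ↦ u (WithLp.ofLp v) :=
    hu.comp (WithLp.prodContinuousLinearEquiv 2 ℝ ℝ ℝ).contDiff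
  exact ⟨h1.toSchwartzMap h2, rfl⟩

lemma measurable_spaceTimeFT {u : ℝ × ℝ → ℂ} (hu : ContDiff ℝ (⊤ : ℕ∞) u)
    (hc : HasCompactSupport u) : Measurable fun z : ℝ × ℝ ↦ spaceTimeFT u z.1 z.2 := by
  obtain ⟨f, hf⟩ := exists_schwartzMap_eq hu hc
  simp only [← fourier_toLp_eq_spaceTimeFT, ← hf, ← fourier_coe]
  have : Continuous fun z : ℝ × ℝ ↦ (WithLp.toLp 2 ((2 * Real.pi)⁻¹ • z) : EuclideanPlane) := by
    fun_prop
  exact ((𝓕 f).continuous.comp this).measurable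

/-- The Fourier transform of a product is dominated by the convolution of the transforms. -/
lemma exists_enorm_spaceTimeFT_mul_le : ∃ K : ℝ≥0∞, K < ∞ ∧ ∀ u v : ℝ × ℝ → ℂ,
    ContDiff ℝ (⊤ : ℕ∞) u → HasCompactSupport u → ContDiff ℝ (⊤ : ℕ∞) v → HasCompactSupport v →
    ∀ z : ℝ × ℝ, ‖spaceTimeFT (fun p ↦ u p * v p) z.1 z.2‖ₑ ≤
      K * ∫⁻ y : ℝ × ℝ, ‖spaceTimeFT u y.1 y.2‖ₑ * ‖spaceTimeFT v (z - y).1 (z - y).2‖ₑ := by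
  have hpi : (2 * Real.pi) ≠ 0 := by positivity
  refine ⟨ENNReal.ofReal |((2 * Real.pi) ^ Module.finrank ℝ (ℝ × ℝ))⁻¹|, ENNReal.ofReal_lt_top,
    fun u v hu huc hv hvc z ↦ ?_⟩
  obtain ⟨f, hf⟩ := exists_schwartzMap_eq hu huc
  obtain ⟨g, hg⟩ := exists_schwartzMap_eq hv hvc
  have hmu := measurable_spaceTimeFT hu huc
  have hmv := measurable_spaceTimeFT hv hvc
  set H : ℝ × ℝ → ℝ≥0∞ := fun y ↦
    ‖spaceTimeFT u y.1 y.2‖ₑ * ‖spaceTimeFT v (z - y).1 (z - y).2‖ₑ with hH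
  have hHm : Measurable H :=
    hmu.enorm.mul (hmv.comp (by fun_prop : Measurable fun y : ℝ × ℝ ↦ z - y)).enorm
  have key := SchwartzMap.enorm_fourier_mul_le f g (WithLp.toLp 2 ((2 * Real.pi)⁻¹ • z))
  rw [hf, hg, fourier_toLp_eq_spaceTimeFT (fun p ↦ u p * v p)] at key
  refine key.trans (le_of_eq ?_)
  calc _ = ∫⁻ t : EuclideanPlane, H ((2 * Real.pi) • WithLp.ofLp t) := by
        refine lintegral_congr fun t ↦ ?_
        rw [fourier_eq_spaceTimeFT, fourier_eq_spaceTimeFT]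
        simp only [hH]
        congr 3
        · simp; field_simp
        · simp; field_simp
    _ = ∫⁻ p : ℝ × ℝ, H ((2 * Real.pi) • p) :=
        (WithLp.volume_preserving_ofLp ℝ ℝ).lintegral_comp
          (hHm.comp (measurable_const_smul (2 * Real.pi)))
    _ = ∫⁻ p, H p ∂(Measure.map ((2 * Real.pi) • ·) (volume : Measure (ℝ × ℝ))) :=
        (lintegral_map hHm (measurable_const_smul (2 * Real.pi))).symm
    _ = _ := by
        rw [Measure.map_addHaar_smul volume hpi, lintegral_smul_measure, smul_eq_mul]

lemma spaceTimeFT_conj (u : ℝ × ℝ → ℂ) (z : ℝ × ℝ) :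
    spaceTimeFT (fun p ↦ (starRingEnd ℂ) (u p)) z.1 z.2 =
      (starRingEnd ℂ) (spaceTimeFT u (-z).1 (-z).2) := by
  unfold spaceTimeFT
  rw [← integral_conj]
  congr! 2 with p
  rw [map_mul, ← Complex.exp_conj]
  congr 2
  simp
  ring

/-- The Fourier transform of `u₁ ū₂ u₃` is dominated by the trilinear convolution. -/
lemma exists_enorm_spaceTimeFT_trilinear_le : ∃ K : ℝ≥0∞, K < ∞ ∧ ∀ u₁ u₂ u₃ : ℝ × ℝ → ℂ,
    ContDiff ℝ (⊤ : ℕ∞) u₁ → HasCompactSupport u₁ → ContDiff ℝ (⊤ : ℕ∞) u₂ →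
    HasCompactSupport u₂ → ContDiff ℝ (⊤ : ℕ∞) u₃ → HasCompactSupport u₃ → ∀ z : ℝ × ℝ,
    ‖spaceTimeFT (fun p ↦ u₁ p * (starRingEnd ℂ) (u₂ p) * u₃ p) z.1 z.2‖ₑ ≤
      K * ∫⁻ z₃ : ℝ × ℝ, ∫⁻ z₁ : ℝ × ℝ, ‖spaceTimeFT u₁ z₁.1 z₁.2‖ₑ *
        ‖spaceTimeFT u₂ (z₁ + z₃ - z).1 (z₁ + z₃ - z).2‖ₑ * ‖spaceTimeFT u₃ z₃.1 z₃.2‖ₑ := by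
  obtain ⟨K, hK, hmul⟩ := exists_enorm_spaceTimeFT_mul_le
  refine ⟨K * K, ENNReal.mul_lt_top hK hK, fun u₁ u₂ u₃ d₁ c₁ d₂ c₂ d₃ c₃ z ↦ ?_⟩
  have d₂' : ContDiff ℝ (⊤ : ℕ∞) fun p ↦ (starRingEnd ℂ) (u₂ p) :=
    Complex.conjCLE.contDiff.comp d₂
  have c₂' : HasCompactSupport fun p ↦ (starRingEnd ℂ) (u₂ p) :=
    c₂.comp_left (g := starRingEnd ℂ) (map_zero _)
  have hprod : (fun p ↦ u₁ p * (starRingEnd ℂ) (u₂ p) * u₃ p) =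
      fun p ↦ u₃ p * (u₁ p * (starRingEnd ℂ) (u₂ p)) := by ext p; ring
  rw [hprod, mul_assoc K K]
  refine (hmul u₃ _ d₃ c₃ (d₁.mul d₂') (c₁.mul_right) z).trans ?_
  gcongr
  rw [← lintegral_const_mul' _ _ hK.ne]
  refine lintegral_mono fun z₃ ↦ ?_
  calc _ ≤ ‖spaceTimeFT u₃ z₃.1 z₃.2‖ₑ * (K * ∫⁻ y : ℝ × ℝ, ‖spaceTimeFT u₁ y.1 y.2‖ₑ *
        ‖spaceTimeFT (fun p ↦ (starRingEnd ℂ) (u₂ p)) (z - z₃ - y).1 (z - z₃ - y).2‖ₑ) := by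
        gcongr
        exact hmul u₁ _ d₁ c₁ d₂' c₂' (z - z₃)
    _ = _ := by
        rw [mul_left_comm, ← lintegral_const_mul' _ _ enorm_ne_top]
        congr 1
        refine lintegral_congr fun z₁ ↦ ?_
        rw [spaceTimeFT_conj, RCLike.enorm_conj, show -(z - z₃ - z₁) = z₁ + z₃ - z by abel]
        ring

end FourierProduct

lemma Xnorm_sq (s b : ℝ) (u : ℝ × ℝ → ℂ) :
    Xnorm s b u ^ 2 =
      ∫⁻ z : ℝ × ℝ, (ENNReal.ofReal (bourgainWeight s b z) * ‖spaceTimeFT u z.1 z.2‖ₑ) ^ 2 := by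
  change eLpNorm (fun z : ℝ × ℝ ↦ ((bourgainWeight s b z : ℝ) : ℂ) * spaceTimeFT u z.1 z.2) 2
    volume ^ 2 = _
  rw [eLpNorm_eq_lintegral_rpow_enorm_toReal (by norm_num) (by norm_num),
    ← ENNReal.rpow_natCast, ← ENNReal.rpow_mul]
  norm_num
  refine lintegral_congr fun z ↦ ?_
  rw [← ofReal_norm, Complex.norm_real, Real.norm_of_nonneg (bourgainWeight_pos s b z).le]

/-- Trilinear estimate: for `s ≥ -1/2` and `1/2 < b ≤ 5/6`, for time-localized
smooth functions, `‖u₁ ū₂ u₃‖_{X^{s,b-1}} ≤ C ‖u₁‖_{X^{s,b}} ‖u₂‖_{X^{s,b}} ‖u₃‖_{X^{s,b}}`. -/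
theorem stmt_9 (s b : ℝ) (hs : -(1/2) ≤ s) (hb1 : 1/2 < b) (hb2 : b ≤ 5/6) :
    ∃ C > (0:ℝ), ∀ u₁ u₂ u₃ : ℝ × ℝ → ℂ,
      ContDiff ℝ (⊤ : ℕ∞) u₁ → HasCompactSupport u₁ →
        (Function.support u₁ ⊆ {p : ℝ × ℝ | |p.1| ≤ 2}) →
      ContDiff ℝ (⊤ : ℕ∞) u₂ → HasCompactSupport u₂ →
        (Function.support u₂ ⊆ {p : ℝ × ℝ | |p.1| ≤ 2}) →
      ContDiff ℝ (⊤ : ℕ∞) u₃ → HasCompactSupport u₃ →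
        (Function.support u₃ ⊆ {p : ℝ × ℝ | |p.1| ≤ 2}) →
      Xnorm s (b - 1) (fun p => u₁ p * (starRingEnd ℂ) (u₂ p) * u₃ p) ≤
        ENNReal.ofReal C * Xnorm s b u₁ * Xnorm s b u₂ * Xnorm s b u₃ := by
  obtain ⟨K, hK, hF⟩ := exists_enorm_spaceTimeFT_trilinear_le
  set A : ℝ≥0∞ := K ^ 2 * (ENNReal.ofReal (multiplierConst s) * (16 * kernelMass b)) with hA
  have hA_top : A ≠ ∞ := by
    have := (kernelMass_lt_top hb1).ne
    have := hK.ne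
    finiteness
  set C : ℝ := A.toReal + 1 with hC
  have hC0 : 0 ≤ A.toReal := ENNReal.toReal_nonneg
  have hAC : A ≤ ENNReal.ofReal C ^ 2 := by
    rw [← ENNReal.ofReal_pow (by positivity), ← ENNReal.ofReal_toReal hA_top]
    exact ENNReal.ofReal_le_ofReal (by rw [hC]; nlinarith)
  refine ⟨C, by positivity, fun u₁ u₂ u₃ d₁ c₁ _ d₂ c₂ _ d₃ c₃ _ ↦ ?_⟩
  rw [← ENNReal.pow_le_pow_left_iff two_ne_zero]
  calc Xnorm s (b - 1) (fun p => u₁ p * (starRingEnd ℂ) (u₂ p) * u₃ p) ^ 2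
      ≤ ∫⁻ z₄ : ℝ × ℝ, K ^ 2 * (ENNReal.ofReal (bourgainWeight s (b - 1) z₄) *
          ∫⁻ z₃ : ℝ × ℝ, ∫⁻ z₁ : ℝ × ℝ, ‖spaceTimeFT u₁ z₁.1 z₁.2‖ₑ *
            ‖spaceTimeFT u₂ (z₁ + z₃ - z₄).1 (z₁ + z₃ - z₄).2‖ₑ *
            ‖spaceTimeFT u₃ z₃.1 z₃.2‖ₑ) ^ 2 := by
        rw [Xnorm_sq]
        refine lintegral_mono fun z₄ ↦ ?_
        rw [← mul_pow, mul_left_comm]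
        gcongr
        exact hF u₁ u₂ u₃ d₁ c₁ d₂ c₂ d₃ c₃ z₄
    _ ≤ K ^ 2 * (ENNReal.ofReal (multiplierConst s) * (16 * kernelMass b *
          (Xnorm s b u₁ ^ 2 * Xnorm s b u₂ ^ 2 * Xnorm s b u₃ ^ 2))) := by
        rw [lintegral_const_mul' _ _ (ENNReal.pow_ne_top hK.ne), Xnorm_sq, Xnorm_sq, Xnorm_sq]
        gcongr
        exact lintegral_bourgainWeight_trilinear_sq_le hs hb1 hb2
          (measurable_spaceTimeFT d₁ c₁).enorm (measurable_spaceTimeFT d₂ c₂).enorm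
          (measurable_spaceTimeFT d₃ c₃).enorm
    _ = A * (Xnorm s b u₁ * Xnorm s b u₂ * Xnorm s b u₃) ^ 2 := by rw [hA]; ring
    _ ≤ ENNReal.ofReal C ^ 2 * (Xnorm s b u₁ * Xnorm s b u₂ * Xnorm s b u₃) ^ 2 := by gcongr
    _ = _ := by ring
end
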